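/- arXiv:2506.23264 — 3 statements merged into one kernel-verified Lean document; each statement's English description precedes it below -/
import Mathlib

section
/- Let n, k ∈ ℕ with n ≥ 2k. For any function f : C([n],k) → ℝ, max_{1≤r≤k} W^r(f) ≥ 5^{−k/2} · √(Var[f]), where Var[f] = E[f²] − (E[f])² is the variance of f with respect to the uniform measure on C([n],k). -/
open Finset

/-- Inner signed average over k-subsets R crossing each pair {a i, b i}:
E_R [ (-1)^{|R ∩ {b_1,...,b_r}|} f(R) ]. -/
noncomputable def signedAvg {V : Type*} [Fintype V] [DecidableEq V] (k : ℕ) {r : ℕ}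
    (f : Finset V → ℝ) (a b : Fin r → V) : ℝ :=
  (∑ R ∈ (Finset.univ.powersetCard k).filter
      (fun R => ∀ i, (R ∩ {a i, b i}).card = 1),
      (-1 : ℝ) ^ (R ∩ Finset.image b Finset.univ).card * f R) /
  (((Finset.univ.powersetCard k).filter
      (fun R => ∀ i, (R ∩ {a i, b i}).card = 1)).card)

/-- The level-r weight W^r(f) of a function on k-subsets: the square root of the
average, over all sequences (a_1,b_1,...,a_r,b_r) of 2r distinct vertices, of the
square of the inner signed average. -/
noncomputable def Wpow {V : Type*} [Fintype V] [DecidableEq V] (k r : ℕ)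
    (f : Finset V → ℝ) : ℝ :=
  Real.sqrt
    ((∑ p ∈ (Finset.univ : Finset ((Fin r → V) × (Fin r → V))).filter
        (fun p => Function.Injective (Sum.elim p.1 p.2)),
        (signedAvg k f p.1 p.2) ^ 2) /
      (((Finset.univ : Finset ((Fin r → V) × (Fin r → V))).filter
        (fun p => Function.Injective (Sum.elim p.1 p.2))).card))

/-- Mean of f with respect to the uniform measure on k-subsets. -/
noncomputable def meanUnif {V : Type*} [Fintype V] [DecidableEq V] (k : ℕ)
    (f : Finset V → ℝ) : ℝ :=
  (∑ R ∈ (Finset.univ : Finset V).powersetCard k, f R) /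
    (((Finset.univ : Finset V).powersetCard k).card)

/-- Variance of f with respect to the uniform measure on k-subsets. -/
noncomputable def varUnif {V : Type*} [Fintype V] [DecidableEq V] (k : ℕ)
    (f : Finset V → ℝ) : ℝ :=
  (∑ R ∈ (Finset.univ : Finset V).powersetCard k, (f R) ^ 2) /
      (((Finset.univ : Finset V).powersetCard k).card)
    - (meanUnif k f) ^ 2


section S14
variable {V : Type*} [DecidableEq V]

/-- plain finite average -/
noncomputable def av14 {ι : Type*} (s : Finset ι) (g : ι → ℝ) : ℝ := (∑ x ∈ s, g x) / (s.card : ℝ)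

noncomputable def od14 (p : V × V) (f : Finset V → ℝ) : Finset V → ℝ :=
  fun R => (f (insert p.1 R) - f (insert p.2 R)) / 2

noncomputable def ev14 (p : V × V) (f : Finset V → ℝ) : Finset V → ℝ :=
  fun R => (f (insert p.1 R) + f (insert p.2 R)) / 2

noncomputable def W14 : ℕ → Finset V → ℕ → (Finset V → ℝ) → ℝ
  | 0, U, j, f => (av14 (U.powersetCard j) f) ^ 2
  | _ + 1, _, 0, _ => 0
  | r + 1, U, j + 1, f => av14 U.offDiag (fun p => W14 r (U \ {p.1, p.2}) j (od14 p f))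

theorem av14_nonneg {ι : Type*} (s : Finset ι) (g : ι → ℝ) (h : ∀ x ∈ s, 0 ≤ g x) :
    0 ≤ av14 s g := div_nonneg (Finset.sum_nonneg h) (by positivity)

theorem av14_mono {ι : Type*} (s : Finset ι) (g g' : ι → ℝ) (h : ∀ x ∈ s, g x ≤ g' x) :
    av14 s g ≤ av14 s g' := by
  unfold av14
  have := Finset.sum_le_sum h
  gcongr

theorem av14_congr {ι : Type*} (s : Finset ι) (g g' : ι → ℝ) (h : ∀ x ∈ s, g x = g' x) :
    av14 s g = av14 s g' := by
  unfold av14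
  rw [Finset.sum_congr rfl h]

theorem av14_add {ι : Type*} (s : Finset ι) (g g' : ι → ℝ) :
    av14 s (fun x => g x + g' x) = av14 s g + av14 s g' := by
  unfold av14
  rw [Finset.sum_add_distrib, add_div]

theorem av14_sum {ι κ : Type*} (s : Finset ι) (t : Finset κ) (c : κ → ℝ) (g : κ → ι → ℝ) :
    av14 s (fun x => ∑ r ∈ t, c r * g r x) = ∑ r ∈ t, c r * av14 s (g r) := by
  unfold av14
  rw [Finset.sum_comm, Finset.sum_div]
  refine Finset.sum_congr rfl fun r _ => ?_
  rw [← Finset.mul_sum, mul_div_assoc]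

theorem W14_nonneg (r : ℕ) : ∀ (U : Finset V) (j : ℕ) (f : Finset V → ℝ), 0 ≤ W14 r U j f := by
  induction r with
  | zero => intro U j f; simp only [W14]; positivity
  | succ r ih =>
    intro U j f
    cases j with
    | zero => simp [W14]
    | succ j => simp only [W14]; exact av14_nonneg _ _ fun p _ => ih _ _ _

theorem W14_zero (r : ℕ) : ∀ (U : Finset V) (j : ℕ) (f : Finset V → ℝ), j < r → W14 r U j f = 0 := by
  induction r with
  | zero => intro U j f h; omega
  | succ r ih =>
    intro U j f h
    cases j with
    | zero => simp [W14]
    | succ j =>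
      simp only [W14, av14]
      rw [Finset.sum_eq_zero fun p _ => ih _ _ _ (by omega)]; simp

theorem sd14_card {U : Finset V} {p : V × V} (hp : p ∈ U.offDiag) : (U \ {p.1, p.2}).card = U.card - 2 := by
  rw [Finset.mem_offDiag] at hp
  rw [Finset.card_sdiff_of_subset (by intro x hx; simp at hx; rcases hx with rfl | rfl <;> tauto),
    Finset.card_pair hp.2.2]

theorem odev14_comm (p q : V × V) (f : Finset V → ℝ) : od14 q (ev14 p f) = ev14 p (od14 q f) := by
  funext R
  simp only [od14, ev14]
  rw [Finset.insert_comm p.1 q.1, Finset.insert_comm p.1 q.2, Finset.insert_comm p.2 q.1,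
    Finset.insert_comm p.2 q.2]
  ring

theorem av14_swap (U : Finset V) (G : V × V → V × V → ℝ) :
    av14 U.offDiag (fun p => av14 (U \ {p.1, p.2}).offDiag (fun q => G p q)) =
    av14 U.offDiag (fun q => av14 (U \ {q.1, q.2}).offDiag (fun p => G p q)) := by
  have key : ∀ H : V × V → V × V → ℝ,
      av14 U.offDiag (fun p => av14 (U \ {p.1, p.2}).offDiag (fun q => H p q)) =
      (∑ p ∈ U.offDiag, ∑ q ∈ (U \ {p.1, p.2}).offDiag, H p q) /
        (((U.card - 2) * (U.card - 2) - (U.card - 2) : ℕ) : ℝ) / (U.offDiag.card : ℝ) := by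
    intro H
    simp only [av14]
    congr 1
    rw [Finset.sum_div]
    refine Finset.sum_congr rfl fun p hp => ?_
    rw [Finset.offDiag_card, sd14_card hp]
  rw [key, key (fun q p => G p q)]
  congr 2
  refine Finset.sum_comm' ?_
  intro p q
  simp only [Finset.mem_offDiag, Finset.mem_sdiff, Finset.mem_insert, Finset.mem_singleton]
  tauto

/-- pushing forward -/
theorem push14 {U : Finset V} {a b : V} (ha : a ∈ U) (hab : a ≠ b) (j : ℕ)
    (g : Finset V → ℝ) :
    ∑ R ∈ (U \ {a, b}).powersetCard j, g (insert a R) =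
      ∑ R ∈ U.powersetCard (j + 1), g R * (if a ∈ R then 1 else 0) * (if b ∈ R then 0 else 1) := by
  have h1 : ∑ R ∈ U.powersetCard (j + 1), g R * (if a ∈ R then 1 else 0) * (if b ∈ R then 0 else 1)
      = ∑ R ∈ (U.powersetCard (j + 1)).filter (fun R => a ∈ R ∧ b ∉ R), g R := by
    rw [Finset.sum_filter]
    refine Finset.sum_congr rfl fun R _ => ?_
    by_cases h1 : a ∈ R <;> by_cases h2 : b ∈ R <;> simp [h1, h2]
  rw [h1]
  refine Finset.sum_bij' (fun R _ => insert a R) (fun R _ => R.erase a) ?_ ?_ ?_ ?_ ?_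
  · intro R hR
    simp only [Finset.mem_powersetCard, Finset.mem_filter] at hR ⊢
    have haR : a ∉ R := fun h => by have := hR.1 h; simp at this
    have hbR : b ∉ R := fun h => by have := hR.1 h; simp at this
    refine ⟨⟨?_, by rw [Finset.card_insert_of_notMem haR, hR.2]⟩, by simp, ?_⟩
    · exact Finset.insert_subset ha (hR.1.trans Finset.sdiff_subset)
    · simp [hbR, hab.symm]
  · intro R hR
    simp only [Finset.mem_powersetCard, Finset.mem_filter] at hR ⊢
    refine ⟨?_, by rw [Finset.card_erase_of_mem hR.2.1, hR.1.2]; rfl⟩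
    intro x hx
    rw [Finset.mem_erase] at hx
    simp only [Finset.mem_sdiff, Finset.mem_insert, Finset.mem_singleton]
    refine ⟨hR.1.1 hx.2, ?_⟩
    rintro (h | h)
    · exact hx.1 h
    · subst h; exact hR.2.2 hx.2
  · intro R hR
    simp only [Finset.mem_powersetCard] at hR
    have haR : a ∉ R := fun h => by have := hR.1 h; simp at this
    exact Finset.erase_insert haR
  · intro R hR
    simp only [Finset.mem_filter] at hR
    exact Finset.insert_erase hR.2.1
  · intro R hR; rfl

noncomputable def x14 (a : V) (R : Finset V) : ℝ := if a ∈ R then 1 else 0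

theorem x14_sum {U R : Finset V} (h : R ⊆ U) : ∑ a ∈ U, x14 a R = R.card := by
  simp only [x14, Finset.sum_ite_mem, Finset.sum_const, nsmul_eq_mul, mul_one]
  rw [Finset.inter_eq_right.mpr h]

theorem x14_sq (a : V) (R : Finset V) : x14 a R * x14 a R = x14 a R := by
  simp only [x14]; split_ifs <;> simp

theorem push14' {U : Finset V} {a b : V} (ha : a ∈ U) (hab : a ≠ b) (j : ℕ)
    (g : Finset V → ℝ) :
    ∑ R ∈ (U \ {a, b}).powersetCard j, g (insert a R) =
      ∑ R ∈ U.powersetCard (j + 1), g R * (x14 a R * (1 - x14 b R)) := by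
  rw [push14 ha hab]
  refine Finset.sum_congr rfl fun R _ => ?_
  simp only [x14]
  by_cases h1 : a ∈ R <;> by_cases h2 : b ∈ R <;> simp [h1, h2]

theorem push14'' {U : Finset V} {a b : V} (hb : b ∈ U) (hab : a ≠ b) (j : ℕ)
    (g : Finset V → ℝ) :
    ∑ R ∈ (U \ {a, b}).powersetCard j, g (insert b R) =
      ∑ R ∈ U.powersetCard (j + 1), g R * (x14 b R * (1 - x14 a R)) := by
  rw [Finset.pair_comm, push14' hb hab.symm]

theorem ev14_sum {U : Finset V} {p : V × V} (hp : p ∈ U.offDiag) (j : ℕ) (g : Finset V → ℝ) :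
    ∑ R ∈ (U \ {p.1, p.2}).powersetCard j, ev14 p g R =
      (∑ R ∈ U.powersetCard (j + 1), g R * (x14 p.1 R + x14 p.2 R - 2 * (x14 p.1 R * x14 p.2 R))) / 2 := by
  rw [Finset.mem_offDiag] at hp
  simp only [ev14]
  rw [← Finset.sum_div, Finset.sum_add_distrib, push14' hp.1 hp.2.2, push14'' hp.2.1 hp.2.2,
    ← Finset.sum_add_distrib]
  congr 1
  refine Finset.sum_congr rfl fun R _ => ?_
  ring

theorem od14_sum {U : Finset V} {p : V × V} (hp : p ∈ U.offDiag) (j : ℕ) (g : Finset V → ℝ) :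
    ∑ R ∈ (U \ {p.1, p.2}).powersetCard j, od14 p g R =
      (∑ R ∈ U.powersetCard (j + 1), g R * (x14 p.1 R - x14 p.2 R)) / 2 := by
  rw [Finset.mem_offDiag] at hp
  simp only [od14]
  rw [← Finset.sum_div, Finset.sum_sub_distrib, push14' hp.1 hp.2.2, push14'' hp.2.1 hp.2.2,
    ← Finset.sum_sub_distrib]
  congr 1
  refine Finset.sum_congr rfl fun R _ => ?_
  ring

theorem odod14_sum {U : Finset V} {p q : V × V} (hp : p ∈ U.offDiag)
    (hq : q ∈ (U \ {p.1, p.2}).offDiag) (j : ℕ) (g : Finset V → ℝ) :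
    ∑ R ∈ ((U \ {p.1, p.2}) \ {q.1, q.2}).powersetCard j, od14 q (od14 p g) R =
      (∑ R ∈ U.powersetCard (j + 2), g R * ((x14 p.1 R - x14 p.2 R) * (x14 q.1 R - x14 q.2 R))) / 4 := by
  rw [od14_sum hq]
  have h1 : ∀ R, od14 p g R * (x14 q.1 R - x14 q.2 R) =
      od14 p (fun R => g R * (x14 q.1 R - x14 q.2 R)) R := by
    intro R
    simp only [Finset.mem_offDiag, Finset.mem_sdiff, Finset.mem_insert, Finset.mem_singleton] at hq hp
    have e1 : ∀ y ∈ ({p.1, p.2} : Finset V), ∀ z, z ∉ ({p.1, p.2} : Finset V) → x14 z (insert y R) = x14 z R := by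
      intro y hy z hz
      have : z ≠ y := by rintro rfl; exact hz hy
      simp [x14, this]
    simp only [od14]
    rw [e1 p.1 (by simp) q.1 (by simpa using hq.1.2), e1 p.1 (by simp) q.2 (by simpa using hq.2.1.2),
      e1 p.2 (by simp) q.1 (by simpa using hq.1.2), e1 p.2 (by simp) q.2 (by simpa using hq.2.1.2)]
    ring
  rw [Finset.sum_congr rfl fun R _ => h1 R, od14_sum hp]
  rw [div_div]
  have h4 : (2 : ℝ) * 2 = 4 := by norm_num
  rw [h4]
  congr 1
  refine Finset.sum_congr rfl fun R _ => ?_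
  ring

theorem sumoff14 (U : Finset V) (G : V → V → ℝ) :
    ∑ p ∈ U.offDiag, G p.1 p.2 = ∑ a ∈ U, ∑ b ∈ U, G a b - ∑ a ∈ U, G a a := by
  have h1 : ∑ p ∈ U ×ˢ U, G p.1 p.2 = ∑ p ∈ U.diag, G p.1 p.2 + ∑ p ∈ U.offDiag, G p.1 p.2 := by
    rw [← Finset.sum_union (Finset.disjoint_diag_offDiag U), Finset.diag_union_offDiag]
  have h2 : ∑ p ∈ U.diag, G p.1 p.2 = ∑ a ∈ U, G a a := by
    rw [Finset.sum_diag]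
  rw [Finset.sum_product] at h1
  linarith

theorem cr14_sum {U R : Finset V} {j : ℕ} (hR : R ∈ U.powersetCard j) :
    ∑ p ∈ U.offDiag, (x14 p.1 R + x14 p.2 R - 2 * (x14 p.1 R * x14 p.2 R)) =
      2 * j * (U.card - j) := by
  rw [Finset.mem_powersetCard] at hR
  rw [sumoff14 U (fun a b => x14 a R + x14 b R - 2 * (x14 a R * x14 b R))]
  simp only [x14_sq, Finset.sum_sub_distrib, Finset.sum_add_distrib, ← Finset.mul_sum,
    Finset.sum_const, x14_sum hR.1, ← Finset.sum_mul, hR.2, nsmul_eq_mul]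
  ring

theorem var14 (T : Finset V) (d : V → ℝ) :
    (T.card : ℝ) * ∑ c ∈ T, d c ^ 2 = (∑ c ∈ T, d c) ^ 2 +
      (∑ q ∈ T.offDiag, (d q.1 - d q.2) ^ 2) / 2 := by
  rw [sumoff14 T (fun a b => (d a - d b) ^ 2)]
  have : ∀ a b, (d a - d b) ^ 2 = d a ^ 2 + d b ^ 2 - 2 * (d a * d b) := by intros; ring
  simp only [this, Finset.sum_sub_distrib, Finset.sum_add_distrib, ← Finset.mul_sum,
    Finset.sum_const, ← Finset.sum_mul, nsmul_eq_mul]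
  have e : ∑ i ∈ T, d i * d i = ∑ i ∈ T, d i ^ 2 := Finset.sum_congr rfl fun i _ => by ring
  rw [e]
  ring

theorem poin14 (U : Finset V) (v : V → V → ℝ) (hs : ∀ a b, v a b = v b a) (h0 : ∀ a, v a a = 0)
    (ht : ∑ a ∈ U, ∑ b ∈ U, v a b = 0) (hm : 3 ≤ U.card) :
    (U.card : ℝ) * ∑ a ∈ U, ∑ b ∈ U, v a b ^ 2 ≤
      ∑ p ∈ U.offDiag, ∑ c ∈ U \ {p.1, p.2}, (v p.1 c - v p.2 c) ^ 2 := by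
  set m : ℝ := (U.card : ℝ) with hmdef
  have hm' : (3 : ℝ) ≤ m := by rw [hmdef]; exact_mod_cast hm
  set y : V → ℝ := fun a => ∑ b ∈ U, v a b with hy
  set A := ∑ a ∈ U, ∑ b ∈ U, v a b ^ 2 with hA
  set Y := ∑ a ∈ U, y a ^ 2 with hY
  have hyt : ∑ a ∈ U, y a = 0 := ht
  have hA' : ∑ b ∈ U, ∑ a ∈ U, v a b ^ 2 = A := by rw [Finset.sum_comm]
  have e1 : ∑ p ∈ U.offDiag, ∑ c ∈ U \ {p.1, p.2}, (v p.1 c - v p.2 c) ^ 2 =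
      2 * (m - 1) * A - 2 * Y := by
    have h1 : ∀ p ∈ U.offDiag, ∑ c ∈ U \ {p.1, p.2}, (v p.1 c - v p.2 c) ^ 2 =
        ∑ c ∈ U, (v p.1 c - v p.2 c) ^ 2 - 2 * v p.1 p.2 ^ 2 := by
      intro p hp
      rw [Finset.mem_offDiag] at hp
      have := Finset.sum_sdiff (s₁ := {p.1, p.2}) (s₂ := U) (f := fun c => (v p.1 c - v p.2 c) ^ 2)
        (by intro x hx; simp at hx; rcases hx with rfl | rfl <;> tauto)
      rw [Finset.sum_pair hp.2.2] at this
      simp only [h0, hs p.2 p.1] at this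
      linarith
    rw [Finset.sum_congr rfl h1,
      sumoff14 U (fun a b => ∑ c ∈ U, (v a c - v b c) ^ 2 - 2 * v a b ^ 2)]
    have h2 : ∀ a b c, (v a c - v b c) ^ 2 = v a c ^ 2 + v b c ^ 2 - 2 * (v a c * v b c) := by
      intros; ring
    simp only [sub_self, h0]
    simp only [h2, Finset.sum_sub_distrib, Finset.sum_add_distrib, ← Finset.mul_sum,
      Finset.sum_const, nsmul_eq_mul]
    have h3 : ∑ a ∈ U, ∑ b ∈ U, ∑ c ∈ U, v a c * v b c = Y := by
      calc ∑ a ∈ U, ∑ b ∈ U, ∑ c ∈ U, v a c * v b c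
          = ∑ a ∈ U, ∑ c ∈ U, ∑ b ∈ U, v a c * v b c :=
            Finset.sum_congr rfl fun a _ => Finset.sum_comm
        _ = ∑ c ∈ U, ∑ a ∈ U, ∑ b ∈ U, v a c * v b c := Finset.sum_comm
        _ = Y := by
          refine Finset.sum_congr rfl fun c _ => ?_
          rw [sq, ← Finset.sum_mul_sum]
          simp only [hy, hs c]
    rw [h3, ← hA, ← hmdef]
    norm_num
    ring
  have e2 : 0 ≤ (m - 2) * ((m - 2) * A - 2 * Y) := by
    have h1 : ∑ p ∈ U.offDiag, ((m - 2) * v p.1 p.2 - (y p.1 + y p.2)) ^ 2 =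
        (m - 2) * ((m - 2) * A - 2 * Y) := by
      rw [sumoff14 U (fun a b => ((m - 2) * v a b - (y a + y b)) ^ 2)]
      have h2 : ∀ a b, ((m - 2) * v a b - (y a + y b)) ^ 2 = (m - 2) ^ 2 * v a b ^ 2
         - 2 * (m - 2) * (v a b * y a) - 2 * (m - 2) * (v a b * y b) + y a ^ 2 + y b ^ 2
         + 2 * (y a * y b) := by intros; ring
      have h3 : ∑ a ∈ U, ∑ b ∈ U, v a b * y a = Y := by
        refine Finset.sum_congr rfl fun a _ => ?_
        rw [← Finset.sum_mul, sq]
      have h4 : ∑ a ∈ U, ∑ b ∈ U, v a b * y b = Y := by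
        rw [Finset.sum_comm, ← h3]
        refine Finset.sum_congr rfl fun a _ => Finset.sum_congr rfl fun b _ => ?_
        rw [hs]
      simp only [h2, h0, Finset.sum_sub_distrib, Finset.sum_add_distrib, ← Finset.mul_sum,
        Finset.sum_const, nsmul_eq_mul, hyt, h3, h4]
      have h5 : ∑ x ∈ U, ((m - 2) * 0 - (y x + y x)) ^ 2 = 4 * Y := by
        rw [hY, Finset.mul_sum]
        exact Finset.sum_congr rfl fun a _ => by ring
      rw [h5, ← hA, ← hY, ← hmdef]
      simp only [mul_zero, Finset.sum_const_zero]
      ring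
    rw [← h1]
    positivity
  rw [e1]
  have e3 := nonneg_of_mul_nonneg_right e2 (by linarith : (0 : ℝ) < m - 2)
  linarith

theorem poin14' (U : Finset V) (u : V → V → ℝ) (hs : ∀ a b, u a b = u b a) (hm : 3 ≤ U.card) :
    (U.card : ℝ) * (U.card - 2) * (∑ p ∈ U.offDiag, u p.1 p.2 ^ 2
        - (U.offDiag.card : ℝ) * (av14 U.offDiag (fun p => u p.1 p.2)) ^ 2) ≤
      ∑ p ∈ U.offDiag, (∑ c ∈ U \ {p.1, p.2}, (u p.1 c - u p.2 c)) ^ 2 +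
      (∑ p ∈ U.offDiag, ∑ q ∈ (U \ {p.1, p.2}).offDiag,
        (u p.1 q.1 - u p.2 q.1 - (u p.1 q.2 - u p.2 q.2)) ^ 2) / 2 := by
  set μ := av14 U.offDiag (fun p => u p.1 p.2) with hμ
  set v : V → V → ℝ := fun a b => if a = b then 0 else u a b - μ with hv
  have hN : (0 : ℝ) < U.offDiag.card := by
    rw [Finset.offDiag_card]
    have : U.card < U.card * U.card := by nlinarith
    exact_mod_cast Nat.sub_pos_of_lt this
  have hμ' : ∑ p ∈ U.offDiag, u p.1 p.2 = U.offDiag.card * μ := by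
    rw [hμ, av14]; field_simp
  have hvo : ∀ p ∈ U.offDiag, v p.1 p.2 = u p.1 p.2 - μ := by
    intro p hp
    rw [Finset.mem_offDiag] at hp
    simp [hv, hp.2.2]
  have h0 : ∀ a, v a a = 0 := fun a => by simp [hv]
  have hsv : ∀ a b, v a b = v b a := fun a b => by simp only [hv, hs a b, eq_comm]
  have ht : ∑ a ∈ U, ∑ b ∈ U, v a b = 0 := by
    have := sumoff14 U v
    rw [Finset.sum_congr rfl hvo, Finset.sum_sub_distrib, hμ'] at this
    simp only [h0, Finset.sum_const, nsmul_eq_mul, mul_zero, sub_zero] at this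
    linarith
  have hA : ∑ a ∈ U, ∑ b ∈ U, v a b ^ 2 = ∑ p ∈ U.offDiag, u p.1 p.2 ^ 2
        - (U.offDiag.card : ℝ) * μ ^ 2 := by
    have := sumoff14 U (fun a b => v a b ^ 2)
    rw [Finset.sum_congr rfl (fun p hp => by rw [hvo p hp])] at this
    have e : ∀ p : V × V, (u p.1 p.2 - μ) ^ 2 = u p.1 p.2 ^ 2 - 2 * μ * u p.1 p.2 + μ ^ 2 := by
      intro p; ring
    simp only [e, h0, Finset.sum_add_distrib, Finset.sum_sub_distrib, ← Finset.mul_sum, hμ',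
      Finset.sum_const, nsmul_eq_mul] at this
    have z : (0 : ℝ) ^ 2 = 0 := by norm_num
    rw [z] at this
    linarith
  have hp := poin14 U v hsv h0 ht hm
  rw [hA] at hp
  have hd : ∀ p ∈ U.offDiag, ∀ c ∈ U \ {p.1, p.2}, v p.1 c - v p.2 c = u p.1 c - u p.2 c := by
    intro p hp c hc
    simp only [Finset.mem_sdiff, Finset.mem_insert, Finset.mem_singleton, not_or] at hc
    simp [hv, Ne.symm hc.2.1, Ne.symm hc.2.2]
  rw [Finset.sum_congr rfl fun p hp => Finset.sum_congr rfl fun c hc => by rw [hd p hp c hc]] at hp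
  have hm2 : (0 : ℝ) ≤ U.card - 2 := by
    have : (3 : ℝ) ≤ U.card := by exact_mod_cast hm
    linarith
  have hfin : ((U.card : ℝ) - 2) * ∑ p ∈ U.offDiag, ∑ c ∈ U \ {p.1, p.2}, (u p.1 c - u p.2 c) ^ 2 =
      ∑ p ∈ U.offDiag, (∑ c ∈ U \ {p.1, p.2}, (u p.1 c - u p.2 c)) ^ 2 +
      (∑ p ∈ U.offDiag, ∑ q ∈ (U \ {p.1, p.2}).offDiag,
        (u p.1 q.1 - u p.2 q.1 - (u p.1 q.2 - u p.2 q.2)) ^ 2) / 2 := by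
    rw [Finset.sum_div, ← Finset.sum_add_distrib, Finset.mul_sum]
    refine Finset.sum_congr rfl fun p hp => ?_
    have := var14 (U \ {p.1, p.2}) (fun c => u p.1 c - u p.2 c)
    rw [sd14_card hp, Nat.cast_sub (by omega)] at this
    exact_mod_cast this
  rw [← hfin]
  have := mul_le_mul_of_nonneg_left hp hm2
  linarith

theorem chooseid14 (N i : ℕ) (h : i ≤ N) :
    ((N + 2).choose (i + 1) : ℝ) * (i + 1) * (N + 1 - i) = (N + 2) * ((N + 1) * (N.choose i : ℝ)) := by
  have h1 : (N + 2) * (N + 1).choose i = (N + 2).choose (i + 1) * (i + 1) := Nat.add_one_mul_choose_eq (N + 1) i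
  have h2 : (N + 1).choose i * (N + 1 - i) = (N + 1) * N.choose i := (Nat.choose_mul_succ_eq N i).symm.trans (mul_comm _ _)
  have h1' : ((N : ℝ) + 2) * ((N + 1).choose i : ℝ) = ((N + 2).choose (i + 1) : ℝ) * (i + 1) := by exact_mod_cast h1
  have h2' : ((N + 1).choose i : ℝ) * ((N : ℝ) + 1 - i) = (N + 1) * (N.choose i : ℝ) := by
    have := congrArg (Nat.cast : ℕ → ℝ) h2
    rw [Nat.cast_mul, Nat.cast_sub (by omega)] at this
    push_cast at this
    exact this
  rw [← h1', ← h2']; ring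

theorem chooseineq14 (N i : ℕ) (h : i ≤ N) :
    4 * ((N : ℝ) + 1) * (N.choose i : ℝ) ≤ (N + 2) * ((N + 2).choose (i + 1) : ℝ) := by
  have h3 := chooseid14 N i h
  set B := ((N + 2).choose (i + 1) : ℝ)
  set C := (N.choose i : ℝ)
  have hi : (i : ℝ) ≤ N := by exact_mod_cast h
  have hi0 : (0 : ℝ) ≤ i := by positivity
  have hB : 0 ≤ B := by positivity
  have h4 : 4 * (((i : ℝ) + 1) * (N + 1 - i)) ≤ (N + 2) ^ 2 := by nlinarith [sq_nonneg ((N : ℝ) - 2 * i)]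
  have h5 := mul_le_mul_of_nonneg_left h4 hB
  have h6 : ((N : ℝ) + 2) * (4 * (N + 1) * C) ≤ (N + 2) * ((N + 2) * B) := by nlinarith
  exact le_of_mul_le_mul_left h6 (by positivity)

theorem offcard14 (U : Finset V) (N : ℕ) (h : U.card = N + 2) :
    (U.offDiag.card : ℝ) = (N + 2) * (N + 1) := by
  have : U.offDiag.card = (N + 2) * (N + 1) := by
    rw [Finset.offDiag_card, h, Nat.mul_succ (N + 2) (N + 1)]; simp
  rw [this]; push_cast; ring

theorem avcross14 (U : Finset V) (j : ℕ) (hU : 2 * (j + 1) ≤ U.card) (g : Finset V → ℝ) :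
    av14 U.offDiag (fun p => av14 ((U \ {p.1, p.2}).powersetCard j) (ev14 p g)) =
      av14 (U.powersetCard (j + 1)) g := by
  obtain ⟨N, hN⟩ : ∃ N, U.card = N + 2 := ⟨U.card - 2, by omega⟩
  have hid := chooseid14 N j (by omega)
  have hK : (0 : ℝ) < N.choose j := by exact_mod_cast Nat.choose_pos (by omega)
  have hB : (0 : ℝ) < (N + 2).choose (j + 1) := by exact_mod_cast Nat.choose_pos (by omega)
  have h1 : ∀ p ∈ U.offDiag, av14 ((U \ {p.1, p.2}).powersetCard j) (ev14 p g) =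
      (∑ R ∈ U.powersetCard (j + 1), g R * (x14 p.1 R + x14 p.2 R - 2 * (x14 p.1 R * x14 p.2 R))) / 2 / (N.choose j) := by
    intro p hp
    rw [av14, ev14_sum hp, Finset.card_powersetCard, sd14_card hp, hN]; rfl
  rw [av14_congr _ _ _ h1, av14, av14, offcard14 U N hN, Finset.card_powersetCard, hN,
    ← Finset.sum_div, ← Finset.sum_div, Finset.sum_comm]
  have h2 : ∀ R ∈ U.powersetCard (j + 1), ∑ p ∈ U.offDiag,
      g R * (x14 p.1 R + x14 p.2 R - 2 * (x14 p.1 R * x14 p.2 R)) = g R * (2 * (j + 1) * (N + 1 - j)) := by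
    intro R hR
    rw [← Finset.mul_sum, cr14_sum hR, hN]; push_cast; ring
  rw [Finset.sum_congr rfl h2, ← Finset.sum_mul]
  rw [div_div, div_div, div_eq_div_iff (by positivity) (by positivity)]
  linear_combination 2 * (∑ R ∈ U.powersetCard (j + 1), g R) * hid

theorem base14_S (U : Finset V) (j N : ℕ) (hN : U.card = N + 2) (hj : 2 * j ≤ N)
    (f : Finset V → ℝ) (u : V → V → ℝ)
    (hu : ∀ a b, u a b = (∑ R ∈ U.powersetCard (j + 1),
        f R * (x14 a R + x14 b R - 2 * (x14 a R * x14 b R))) / 2 / (N.choose j)) :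
    (∑ p ∈ U.offDiag, ∑ q ∈ (U \ {p.1, p.2}).offDiag,
        (u p.1 q.1 - u p.2 q.1 - (u p.1 q.2 - u p.2 q.2)) ^ 2) / 2 ≤
      ((N : ℝ) + 2) * N * ((N + 2) * (N + 1)) * W14 2 U (j + 1) f := by
  have hK : (0 : ℝ) < N.choose j := by exact_mod_cast Nat.choose_pos (by omega)
  have hS : ∀ a b c d, u a c - u b c - (u a d - u b d) =
      - (∑ R ∈ U.powersetCard (j + 1), f R * ((x14 a R - x14 b R) * (x14 c R - x14 d R))) / (N.choose j) := by
    intro a b c d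
    simp only [hu]
    rw [div_div, div_div, div_div, div_div, ← sub_div, ← sub_div, ← sub_div, ← Finset.sum_sub_distrib,
      ← Finset.sum_sub_distrib, ← Finset.sum_sub_distrib, ← Finset.sum_neg_distrib,
      div_eq_div_iff (by positivity) (by positivity), Finset.sum_mul, Finset.sum_mul]
    refine Finset.sum_congr rfl fun R _ => ?_
    ring
  cases j with
  | zero =>
    have h0 : ∀ p ∈ U.offDiag, ∀ q ∈ (U \ {p.1, p.2}).offDiag,
        (u p.1 q.1 - u p.2 q.1 - (u p.1 q.2 - u p.2 q.2)) ^ 2 = 0 := by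
      intro p hp q hq
      rw [hS, Finset.sum_eq_zero]
      · simp
      intro R hR
      simp only [Finset.mem_offDiag, Finset.mem_sdiff, Finset.mem_insert, Finset.mem_singleton,
        not_or] at hp hq
      rw [Finset.mem_powersetCard, zero_add, Finset.card_eq_one] at hR
      obtain ⟨-, z, rfl⟩ := hR
      have hz : ∀ y w : V, y ≠ w → x14 y {z} * x14 w {z} = 0 := by
        intro y w hyw
        simp only [x14, Finset.mem_singleton]
        by_cases h1 : y = z
        · have : w ≠ z := by rintro rfl; exact hyw h1
          simp [this]
        · simp [h1]
      have e1 := hz p.1 q.1 (Ne.symm hq.1.2.1)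
      have e2 := hz p.2 q.1 (Ne.symm hq.1.2.2)
      have e3 := hz p.1 q.2 (Ne.symm hq.2.1.2.1)
      have e4 := hz p.2 q.2 (Ne.symm hq.2.1.2.2)
      linear_combination f {z} * (e1 - e2 - e3 + e4)
    rw [Finset.sum_eq_zero fun p hp => Finset.sum_eq_zero fun q hq => h0 p hp q hq, zero_div]
    have := W14_nonneg 2 U (0 + 1) f
    positivity
  | succ i =>
    obtain ⟨M, rfl⟩ : ∃ M, N = M + 2 := ⟨N - 2, by omega⟩
    have hC : (0 : ℝ) < M.choose i := by exact_mod_cast Nat.choose_pos (by omega)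
    have hin := chooseineq14 M i (by omega)
    set K := (((M + 2).choose (i + 1) : ℕ) : ℝ)
    set C := ((M.choose i : ℕ) : ℝ)
    have hW : W14 2 U (i + 1 + 1) f = (∑ p ∈ U.offDiag, ∑ q ∈ (U \ {p.1, p.2}).offDiag,
        ((∑ R ∈ U.powersetCard (i + 2), f R * ((x14 p.1 R - x14 p.2 R) * (x14 q.1 R - x14 q.2 R))) / 4 / C) ^ 2)
          / (((M : ℝ) + 2) * (M + 1)) / ((M + 4) * (M + 3)) := by
      simp only [W14]
      rw [av14, offcard14 U (M + 2) hN]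
      have hp1 : ∀ p ∈ U.offDiag, av14 (U \ {p.1, p.2}).offDiag (fun q =>
          av14 (((U \ {p.1, p.2}) \ {q.1, q.2}).powersetCard i) (od14 q (od14 p f)) ^ 2) =
          (∑ q ∈ (U \ {p.1, p.2}).offDiag,
        ((∑ R ∈ U.powersetCard (i + 2), f R * ((x14 p.1 R - x14 p.2 R) * (x14 q.1 R - x14 q.2 R))) / 4 / C) ^ 2)
          / (((M : ℝ) + 2) * (M + 1)) := by
        intro p hp
        have hc : (U \ {p.1, p.2}).card = M + 2 := by rw [sd14_card hp, hN]; rfl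
        rw [av14, offcard14 _ M hc]
        congr 1
        refine Finset.sum_congr rfl fun q hq => ?_
        rw [av14, odod14_sum hp hq, Finset.card_powersetCard, sd14_card hq, hc]
        rfl
      rw [Finset.sum_congr rfl hp1, ← Finset.sum_div]
      congr 1
      push_cast; ring
    have hle : ∀ p q : V × V, (u p.1 q.1 - u p.2 q.1 - (u p.1 q.2 - u p.2 q.2)) ^ 2 ≤
        (((M : ℝ) + 2) / (M + 1)) ^ 2 *
        ((∑ R ∈ U.powersetCard (i + 2), f R * ((x14 p.1 R - x14 p.2 R) * (x14 q.1 R - x14 q.2 R))) / 4 / C) ^ 2 := by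
      intro p q
      rw [hS]
      set Q := ∑ R ∈ U.powersetCard (i + 2), f R * ((x14 p.1 R - x14 p.2 R) * (x14 q.1 R - x14 q.2 R)) with hQ
      have e1 : (-Q / K) ^ 2 = Q ^ 2 * (1 / K) ^ 2 := by ring
      have e2 : (((M : ℝ) + 2) / (M + 1)) ^ 2 * (Q / 4 / C) ^ 2 = Q ^ 2 * ((M + 2) / (4 * (M + 1) * C)) ^ 2 := by
        field_simp
      change (-Q / K) ^ 2 ≤ _
      rw [e1, e2]
      have e3 : 1 / K ≤ (M + 2) / (4 * (M + 1) * C) := by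
        rw [div_le_div_iff₀ hK (by positivity)]
        linarith
      gcongr
    have hsum := Finset.sum_le_sum fun p (_ : p ∈ U.offDiag) =>
      Finset.sum_le_sum fun q (_ : q ∈ (U \ {p.1, p.2}).offDiag) => hle p q
    simp only [← Finset.mul_sum] at hsum
    rw [hW]
    set SS := ∑ p ∈ U.offDiag, ∑ q ∈ (U \ {p.1, p.2}).offDiag,
        ((∑ R ∈ U.powersetCard (i + 2), f R * ((x14 p.1 R - x14 p.2 R) * (x14 q.1 R - x14 q.2 R))) / 4 / C) ^ 2 with hSS
    have hSS0 : 0 ≤ SS := by rw [hSS]; positivity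
    have hfin : (((M : ℝ) + 2) / (M + 1)) ^ 2 * SS / 2 ≤ (M + 4) / (M + 1) * SS := by
      rw [mul_div_right_comm]
      refine mul_le_mul_of_nonneg_right ?_ hSS0
      rw [div_pow, div_div, div_le_div_iff₀ (by positivity) (by positivity)]
      have : (0 : ℝ) ≤ M := by positivity
      nlinarith [mul_nonneg this this, mul_nonneg (mul_nonneg this this) this]
    have hrhs : (((M + 2 : ℕ) : ℝ) + 2) * ((M + 2 : ℕ) : ℝ) * ((((M + 2 : ℕ) : ℝ) + 2) * (((M + 2 : ℕ) : ℝ) + 1)) *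
        (SS / (((M : ℝ) + 2) * (M + 1)) / ((M + 4) * (M + 3))) = (M + 4) / (M + 1) * SS := by
      push_cast
      field_simp
      ring
    rw [hrhs]
    linarith

theorem base14 (U : Finset V) (j : ℕ) (hU : 2 * (j + 1) ≤ U.card) (f : Finset V → ℝ) :
    av14 U.offDiag (fun p => W14 0 (U \ {p.1, p.2}) j (ev14 p f)) ≤
      W14 0 U (j + 1) f + W14 1 U (j + 1) f + W14 2 U (j + 1) f := by
  obtain ⟨N, hN⟩ : ∃ N, U.card = N + 2 := ⟨U.card - 2, by omega⟩
  have hK : (0 : ℝ) < N.choose j := by exact_mod_cast Nat.choose_pos (by omega)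
  obtain ⟨u, hu⟩ : ∃ u : V → V → ℝ, ∀ a b, u a b = (∑ R ∈ U.powersetCard (j + 1),
        f R * (x14 a R + x14 b R - 2 * (x14 a R * x14 b R))) / 2 / (N.choose j) := ⟨_, fun _ _ => rfl⟩
  have hs : ∀ a b, u a b = u b a := by
    intro a b
    rw [hu, hu]
    congr 2
    refine Finset.sum_congr rfl fun R _ => ?_
    ring
  have hu' : ∀ p ∈ U.offDiag, av14 ((U \ {p.1, p.2}).powersetCard j) (ev14 p f) = u p.1 p.2 := by
    intro p hp
    rw [av14, ev14_sum hp, Finset.card_powersetCard, sd14_card hp, hN, hu]; rfl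
  have hmean : av14 (U.powersetCard (j + 1)) f = av14 U.offDiag (fun p => u p.1 p.2) := by
    rw [← avcross14 U j hU f]
    exact av14_congr _ _ _ hu'
  have hL : av14 U.offDiag (fun p => W14 0 (U \ {p.1, p.2}) j (ev14 p f)) =
      av14 U.offDiag (fun p => u p.1 p.2 ^ 2) := by
    refine av14_congr _ _ _ fun p hp => ?_
    simp only [W14]
    rw [hu' p hp]
  have hW0 : W14 0 U (j + 1) f = (av14 U.offDiag (fun p => u p.1 p.2)) ^ 2 := by
    simp only [W14]
    rw [hmean]
  have hn1 := W14_nonneg 1 U (j + 1) f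
  have hn2 := W14_nonneg 2 U (j + 1) f
  rw [hL, hW0]
  by_cases hN0 : N = 0
  · subst hN0
    obtain ⟨a, b, hab, rfl⟩ := Finset.card_eq_two.mp hN
    have e : ∀ G : V → V → ℝ, av14 (({a, b} : Finset V).offDiag) (fun p => G p.1 p.2) = (G a b + G b a) / 2 := by
      intro G
      rw [av14, sumoff14, offcard14 _ 0 hN, Finset.sum_pair hab, Finset.sum_pair hab,
        Finset.sum_pair hab, Finset.sum_pair hab]
      norm_num
      ring
    rw [e (fun a b => u a b ^ 2), e u, hs b a]
    have : (u a b ^ 2 + u a b ^ 2) / 2 = ((u a b + u a b) / 2) ^ 2 := by ring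
    linarith
  have hN1 : (1 : ℝ) ≤ N := by exact_mod_cast Nat.one_le_iff_ne_zero.mpr hN0
  have hp := poin14' U u hs (by omega)
  have hS := base14_S U j N hN (by omega) f u hu
  have hT : ∑ p ∈ U.offDiag, (∑ c ∈ U \ {p.1, p.2}, (u p.1 c - u p.2 c)) ^ 2 ≤
      ((N : ℝ) + 2) * N * ((N + 2) * (N + 1)) * W14 1 U (j + 1) f := by
    have h1 : ∀ p ∈ U.offDiag, ∑ c ∈ U \ {p.1, p.2}, (u p.1 c - u p.2 c) =
        ((N : ℝ) - 2 * j) * av14 ((U \ {p.1, p.2}).powersetCard j) (od14 p f) := by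
      intro p hp
      rw [av14, od14_sum hp, Finset.card_powersetCard, sd14_card hp, hN]
      simp only [hu]
      simp only [← sub_div, ← Finset.sum_sub_distrib]
      rw [← Finset.sum_div, ← Finset.sum_div, Finset.sum_comm, ← mul_div_assoc, ← mul_div_assoc,
        Finset.mul_sum]
      congr 2
      refine Finset.sum_congr rfl fun R hR => ?_
      have hc := sd14_card hp
      rw [Finset.mem_offDiag] at hp
      rw [Finset.mem_powersetCard] at hR
      have h2 := Finset.sum_sdiff (s₁ := {p.1, p.2}) (s₂ := U) (f := fun c => x14 c R)
        (by intro x hx; simp at hx; rcases hx with rfl | rfl <;> tauto)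
      rw [Finset.sum_pair hp.2.2, x14_sum hR.1, hR.2] at h2
      have h3 : ∀ c, f R * (x14 p.1 R + x14 c R - 2 * (x14 p.1 R * x14 c R)) -
          f R * (x14 p.2 R + x14 c R - 2 * (x14 p.2 R * x14 c R)) =
          f R * (x14 p.1 R - x14 p.2 R) * (1 - 2 * x14 c R) := by intro c; ring
      simp only [h3]
      rw [← Finset.mul_sum, Finset.sum_sub_distrib, ← Finset.mul_sum, Finset.sum_const, hc, hN]
      have h4 : ∑ c ∈ U \ {p.1, p.2}, x14 c R = j + 1 - (x14 p.1 R + x14 p.2 R) := by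
        push_cast at h2; linarith
      rw [h4]
      have q1 := x14_sq p.1 R
      have q2 := x14_sq p.2 R
      simp only [Nat.add_sub_cancel, nsmul_eq_mul, mul_one]
      linear_combination 2 * f R * q1 - 2 * f R * q2
    have hW1 : W14 1 U (j + 1) f = (∑ p ∈ U.offDiag,
        (av14 ((U \ {p.1, p.2}).powersetCard j) (od14 p f)) ^ 2) / ((N + 2) * (N + 1)) := by
      simp only [W14]
      rw [av14, offcard14 U N hN]
    rw [Finset.sum_congr rfl fun p hp => by rw [h1 p hp, mul_pow], ← Finset.mul_sum, hW1]
    set SS := ∑ p ∈ U.offDiag, (av14 ((U \ {p.1, p.2}).powersetCard j) (od14 p f)) ^ 2 with hSS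
    have hSS0 : 0 ≤ SS := by rw [hSS]; positivity
    have e : ((N : ℝ) + 2) * N * ((N + 2) * (N + 1)) * (SS / ((N + 2) * (N + 1))) = ((N + 2) * N) * SS := by
      field_simp
    rw [e]
    refine mul_le_mul_of_nonneg_right ?_ hSS0
    have hj : (2 * j : ℝ) ≤ N := by exact_mod_cast (by omega : 2 * j ≤ N)
    have hj0 : (0 : ℝ) ≤ j := by positivity
    nlinarith
  rw [hN] at hp
  push_cast at hp
  have hcard := offcard14 U N hN
  set μ := av14 U.offDiag (fun p => u p.1 p.2)
  have hA : ∑ p ∈ U.offDiag, u p.1 p.2 ^ 2 = (N + 2) * (N + 1) * av14 U.offDiag (fun p => u p.1 p.2 ^ 2) := by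
    rw [av14, hcard]; field_simp
  rw [hA, hcard] at hp
  have hpos : (0 : ℝ) < ((N : ℝ) + 2) * N * ((N + 2) * (N + 1)) := by positivity
  have : ((N : ℝ) + 2) * N * ((N + 2) * (N + 1)) * (av14 U.offDiag (fun p => u p.1 p.2 ^ 2)) ≤
      ((N : ℝ) + 2) * N * ((N + 2) * (N + 1)) * (μ ^ 2 + W14 1 U (j + 1) f + W14 2 U (j + 1) f) := by
    linarith
  exact le_of_mul_le_mul_left this hpos

theorem step14 (r : ℕ) : ∀ (U : Finset V) (j : ℕ) (f : Finset V → ℝ), 2 * (j + 1) ≤ U.card →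
    av14 U.offDiag (fun p => W14 r (U \ {p.1, p.2}) j (ev14 p f)) ≤
      W14 r U (j + 1) f + W14 (r + 1) U (j + 1) f + W14 (r + 2) U (j + 1) f := by
  induction r with
  | zero => intro U j f hU; exact base14 U j hU f
  | succ r ih =>
    intro U j f hU
    cases j with
    | zero =>
      have h1 := W14_nonneg (r + 1) U (0 + 1) f
      have h2 := W14_nonneg (r + 1 + 1) U (0 + 1) f
      have h3 := W14_nonneg (r + 1 + 2) U (0 + 1) f
      have : av14 U.offDiag (fun p => W14 (r + 1) (U \ {p.1, p.2}) 0 (ev14 p f)) = 0 := by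
        simp [W14, av14]
      linarith
    | succ j =>
      have e : av14 U.offDiag (fun p => W14 (r + 1) (U \ {p.1, p.2}) (j + 1) (ev14 p f)) =
          av14 U.offDiag (fun q => av14 (U \ {q.1, q.2}).offDiag
            (fun p => W14 r ((U \ {q.1, q.2}) \ {p.1, p.2}) j (ev14 p (od14 q f)))) := by
        simp only [W14]
        rw [av14_swap]
        simp only [odev14_comm]
        refine av14_congr _ _ _ fun q _ => av14_congr _ _ _ fun p _ => ?_
        rw [sdiff_right_comm]
      rw [e]
      have e2 : W14 (r + 1) U (j + 1 + 1) f + W14 (r + 1 + 1) U (j + 1 + 1) f + W14 (r + 1 + 2) U (j + 1 + 1) f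
        = av14 U.offDiag (fun q => W14 r (U \ {q.1, q.2}) (j + 1) (od14 q f) +
            W14 (r + 1) (U \ {q.1, q.2}) (j + 1) (od14 q f) +
            W14 (r + 2) (U \ {q.1, q.2}) (j + 1) (od14 q f)) := by
        rw [av14_add, av14_add]
        conv_lhs => unfold W14
      rw [e2]
      refine av14_mono _ _ _ fun q hq => ?_
      exact ih _ _ _ (by rw [sd14_card hq]; omega)

theorem bin14 (n : ℕ) (x : ℕ → ℝ) :
    ∑ r ∈ Finset.range (n + 1), (n.choose r : ℝ) * (x r + x (r + 1)) =
      ∑ r ∈ Finset.range (n + 2), ((n + 1).choose r : ℝ) * x r := by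
  rw [Finset.sum_range_succ' _ (n + 1)]
  simp only [Nat.choose_succ_succ, mul_add, Finset.sum_add_distrib, Nat.cast_add, add_mul]
  have h : ∑ r ∈ Finset.range (n + 1), (n.choose r : ℝ) * x r =
      ∑ r ∈ Finset.range (n + 1), (n.choose (r + 1) : ℝ) * x (r + 1) + (n.choose 0 : ℝ) * x 0 := by
    rw [← Finset.sum_range_succ' (fun r => (n.choose r : ℝ) * x r), Finset.sum_range_succ _ (n + 1)]
    simp
  rw [h]
  simp
  ring

theorem main14 (j : ℕ) : ∀ (U : Finset V) (f : Finset V → ℝ), 2 * j ≤ U.card →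
    av14 (U.powersetCard j) (fun R => f R ^ 2) ≤
      ∑ r ∈ Finset.range (2 * j + 1), ((2 * j).choose r : ℝ) * W14 r U j f := by
  induction j with
  | zero =>
    intro U f _
    simp [W14, av14]
  | succ j ih =>
    intro U f hU
    rw [← avcross14 U j hU]
    have h1 : ∀ p : V × V, ∀ R, ev14 p (fun R => f R ^ 2) R = ev14 p f R ^ 2 + od14 p f R ^ 2 := by
      intro p R
      simp only [ev14, od14]; ring
    have h2 : ∀ p ∈ U.offDiag, av14 ((U \ {p.1, p.2}).powersetCard j) (ev14 p (fun R => f R ^ 2)) ≤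
        ∑ r ∈ Finset.range (2 * j + 1), ((2 * j).choose r : ℝ) *
          (W14 r (U \ {p.1, p.2}) j (ev14 p f) + W14 r (U \ {p.1, p.2}) j (od14 p f)) := by
      intro p hp
      have hc : 2 * j ≤ (U \ {p.1, p.2}).card := by rw [sd14_card hp]; omega
      rw [av14_congr _ _ _ fun R _ => h1 p R, av14_add]
      simp only [mul_add, Finset.sum_add_distrib]
      exact add_le_add (ih _ _ hc) (ih _ _ hc)
    refine (av14_mono _ _ _ h2).trans ?_
    rw [av14_sum]
    have h3 : ∀ r ∈ Finset.range (2 * j + 1), ((2 * j).choose r : ℝ) * av14 U.offDiag (fun p =>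
          (W14 r (U \ {p.1, p.2}) j (ev14 p f) + W14 r (U \ {p.1, p.2}) j (od14 p f))) ≤
        ((2 * j).choose r : ℝ) * ((W14 r U (j + 1) f + W14 (r + 1) U (j + 1) f) +
          (W14 (r + 1) U (j + 1) f + W14 (r + 1 + 1) U (j + 1) f)) := by
      intro r _
      refine mul_le_mul_of_nonneg_left ?_ (by positivity)
      rw [av14_add]
      have a1 := step14 r U j f hU
      have a2 : W14 (r + 1) U (j + 1) f = av14 U.offDiag (fun p => W14 r (U \ {p.1, p.2}) j (od14 p f)) := by
        conv_lhs => unfold W14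
      linarith
    refine (Finset.sum_le_sum h3).trans ?_
    rw [bin14 (2 * j) (fun r => W14 r U (j + 1) f + W14 (r + 1) U (j + 1) f),
      bin14 (2 * j + 1) (fun r => W14 r U (j + 1) f)]
    exact le_of_eq rfl

def I14 [Fintype V] (r : ℕ) (U : Finset V) : Finset ((Fin r → V) × (Fin r → V)) :=
  (Finset.univ : Finset ((Fin r → V) × (Fin r → V))).filter
    (fun p => Function.Injective (Sum.elim p.1 p.2) ∧ ∀ i, p.1 i ∈ U ∧ p.2 i ∈ U)

theorem inj14 {r : ℕ} (a b : V) (as bs : Fin r → V) :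
    Function.Injective (Sum.elim (Fin.cons a as : Fin (r + 1) → V) (Fin.cons b bs : Fin (r + 1) → V)) ↔
      (a ≠ b ∧ Function.Injective (Sum.elim as bs) ∧ ∀ i, as i ≠ a ∧ as i ≠ b ∧ bs i ≠ a ∧ bs i ≠ b) := by
  rw [Sum.elim_injective, Sum.elim_injective, Fin.cons_injective_iff, Fin.cons_injective_iff]
  simp only [Fin.forall_fin_succ, Fin.cons_zero, Fin.cons_succ, Set.mem_range, not_exists]
  constructor
  · rintro ⟨⟨h1, h2⟩, ⟨h3, h4⟩, ⟨h5, h6⟩, h7⟩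
    exact ⟨h5, ⟨h2, h4, fun i l => (h7 i).2 l⟩, fun i => ⟨h1 i, (h7 i).1, Ne.symm (h6 i), h3 i⟩⟩
  · rintro ⟨h1, ⟨h2, h3, h4⟩, h5⟩
    exact ⟨⟨fun i => (h5 i).1, h2⟩, ⟨fun i => (h5 i).2.2.2, h3⟩, ⟨h1, fun i => Ne.symm (h5 i).2.2.1⟩,
      fun i => ⟨(h5 i).2.1, h4 i⟩⟩

theorem memI14 [Fintype V] {r : ℕ} (U : Finset V) (a b : V) (as bs : Fin r → V) :
    ((Fin.cons a as : Fin (r + 1) → V), (Fin.cons b bs : Fin (r + 1) → V)) ∈ I14 (r + 1) U ↔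
      (a, b) ∈ U.offDiag ∧ (as, bs) ∈ I14 r (U \ {a, b}) := by
  simp only [I14, Finset.mem_filter, Finset.mem_univ, true_and, inj14, Finset.mem_offDiag,
    Finset.mem_sdiff, Finset.mem_insert, Finset.mem_singleton, Fin.forall_fin_succ, Fin.cons_zero,
    Fin.cons_succ, not_or]
  constructor
  · rintro ⟨⟨h1, h2, h3⟩, ⟨h4, h5⟩, h6⟩
    exact ⟨⟨h4, h5, h1⟩, h2, fun i => ⟨⟨(h6 i).1, (h3 i).1, (h3 i).2.1⟩, (h6 i).2, (h3 i).2.2.1, (h3 i).2.2.2⟩⟩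
  · rintro ⟨⟨h4, h5, h1⟩, h2, h3⟩
    exact ⟨⟨h1, h2, fun i => ⟨(h3 i).1.2.1, (h3 i).1.2.2, (h3 i).2.2.1, (h3 i).2.2.2⟩⟩, ⟨h4, h5⟩,
      fun i => ⟨(h3 i).1.1, (h3 i).2.1⟩⟩

theorem sumI14 [Fintype V] {r : ℕ} (U : Finset V) (G : (Fin (r + 1) → V) → (Fin (r + 1) → V) → ℝ) :
    ∑ p ∈ I14 (r + 1) U, G p.1 p.2 = ∑ q ∈ U.offDiag, ∑ p ∈ I14 r (U \ {q.1, q.2}),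
      G (Fin.cons q.1 p.1) (Fin.cons q.2 p.2) := by
  rw [Finset.sum_sigma']
  refine Finset.sum_bij' (fun p _ => ⟨(p.1 0, p.2 0), (Fin.tail p.1, Fin.tail p.2)⟩)
    (fun s _ => (Fin.cons s.1.1 s.2.1, Fin.cons s.1.2 s.2.2)) ?_ ?_ ?_ ?_ ?_
  · intro p hp
    rw [Finset.mem_sigma]
    refine (memI14 U (p.1 0) (p.2 0) (Fin.tail p.1) (Fin.tail p.2)).mp ?_
    rw [Fin.cons_self_tail, Fin.cons_self_tail]
    exact hp
  · rintro ⟨⟨a, b⟩, ⟨as, bs⟩⟩ hs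
    rw [Finset.mem_sigma] at hs
    exact (memI14 U a b as bs).mpr hs
  · intro p hp
    simp only [Fin.cons_self_tail]
  · rintro ⟨⟨a, b⟩, ⟨as, bs⟩⟩ hs
    simp
  · intro p hp
    simp only [Fin.cons_self_tail]

def D14 : ℕ → ℕ → ℝ
  | 0, _ => 1
  | r + 1, m => (m * m - m : ℕ) * D14 r (m - 2)

theorem D14_pos (r : ℕ) : ∀ m, 2 * r ≤ m → 0 < D14 r m := by
  induction r with
  | zero => intro m _; simp [D14]
  | succ r ih =>
    intro m hm
    have h1 : m < m * m := by nlinarith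
    have h2 : (0 : ℝ) < ((m * m - m : ℕ) : ℝ) := by exact_mod_cast Nat.sub_pos_of_lt h1
    exact mul_pos h2 (ih _ (by omega))

theorem cardI14 [Fintype V] (r : ℕ) : ∀ U : Finset V, ((I14 r U).card : ℝ) = D14 r U.card := by
  induction r with
  | zero =>
    intro U
    have : I14 0 U = Finset.univ := by
      ext p
      simp [I14, Function.Injective]
    rw [this]
    simp [D14]
  | succ r ih =>
    intro U
    have h := sumI14 (r := r) U (fun _ _ => 1)
    simp only [Finset.sum_const, nsmul_eq_mul, mul_one] at h
    rw [h, Finset.sum_congr rfl fun q hq => by rw [ih, sd14_card hq], Finset.sum_const,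
      Finset.offDiag_card, nsmul_eq_mul]
    rfl

def C14 (U : Finset V) (k : ℕ) {r : ℕ} (a b : Fin r → V) : Finset (Finset V) :=
  (U.powersetCard k).filter (fun R => ∀ i, (R ∩ {a i, b i}).card = 1)

noncomputable def sA14 (U : Finset V) (k : ℕ) {r : ℕ} (f : Finset V → ℝ) (a b : Fin r → V) : ℝ :=
  (∑ R ∈ C14 U k a b, (-1 : ℝ) ^ (R ∩ Finset.image b Finset.univ).card * f R) / ((C14 U k a b).card)

theorem cross14 {a b : V} (hab : a ≠ b) (R : Finset V) :
    (R ∩ {a, b}).card = 1 ↔ (a ∈ R ∧ b ∉ R) ∨ (b ∈ R ∧ a ∉ R) := by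
  by_cases h1 : a ∈ R <;> by_cases h2 : b ∈ R
  · have : R ∩ {a, b} = {a, b} := by ext x; simp; rintro (rfl | rfl) <;> assumption
    rw [this, Finset.card_pair hab]; simp [h1, h2]
  · have : R ∩ {a, b} = {a} := by ext x; simp; grind
    rw [this]; simp [h1, h2]
  · have : R ∩ {a, b} = {b} := by ext x; simp; grind
    rw [this]; simp [h1, h2]
  · have : R ∩ {a, b} = ∅ := by ext x; simp; grind
    rw [this]; simp [h1, h2]

theorem sumC14 {r : ℕ} {U : Finset V} {a b : V} (j : ℕ) (as bs : Fin r → V)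
    (hp : (a, b) ∈ U.offDiag) (h : ∀ i, as i ∈ U \ {a, b} ∧ bs i ∈ U \ {a, b}) (G : Finset V → ℝ) :
    ∑ R ∈ C14 U (j + 1) (Fin.cons a as : Fin (r + 1) → V) (Fin.cons b bs : Fin (r + 1) → V), G R =
      ∑ R ∈ C14 (U \ {a, b}) j as bs, (G (insert a R) + G (insert b R)) := by
  have hins : ∀ y ∈ ({a, b} : Finset V), ∀ R : Finset V,
      (∀ i, (insert y R ∩ {as i, bs i}).card = 1) ↔ ∀ i, (R ∩ {as i, bs i}).card = 1 := by
    intro y hy R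
    refine forall_congr' fun i => ?_
    have : insert y R ∩ {as i, bs i} = R ∩ {as i, bs i} := by
      rw [Finset.insert_inter_of_notMem]
      intro hm
      have h1 := (Finset.mem_sdiff.mp (h i).1).2
      have h2 := (Finset.mem_sdiff.mp (h i).2).2
      simp only [Finset.mem_insert, Finset.mem_singleton] at hm
      rcases hm with rfl | rfl
      · exact h1 hy
      · exact h2 hy
    rw [this]
  have hp' := hp
  rw [Finset.mem_offDiag] at hp
  obtain ⟨ha, hb, hab⟩ := hp
  simp only at ha hb hab
  simp only [C14]
  rw [Finset.sum_filter, Finset.sum_filter]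
  set G' : Finset V → ℝ := fun R => if ∀ i, (R ∩ {as i, bs i}).card = 1 then G R else 0 with hG'
  have e1 : ∀ R, (if ∀ i, (R ∩ {(Fin.cons a as : Fin (r + 1) → V) i, (Fin.cons b bs : Fin (r + 1) → V) i}).card = 1
      then G R else 0) = G' R * (x14 a R * (1 - x14 b R)) + G' R * (x14 b R * (1 - x14 a R)) := by
    intro R
    simp only [Fin.forall_fin_succ, Fin.cons_zero, Fin.cons_succ, cross14 hab, hG', x14]
    by_cases h1 : a ∈ R <;> by_cases h2 : b ∈ R <;> simp [h1, h2]
  have e2 : ∀ R, (if ∀ i, (R ∩ {as i, bs i}).card = 1 then G (insert a R) + G (insert b R) else 0) =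
      G' (insert a R) + G' (insert b R) := by
    intro R
    simp only [hG', hins a (by simp), hins b (by simp)]
    split_ifs <;> simp
  rw [Finset.sum_congr rfl fun R _ => e1 R, Finset.sum_congr rfl fun R _ => e2 R,
    Finset.sum_add_distrib, Finset.sum_add_distrib, push14' ha hab, push14'' hb hab]

theorem sAcons14 {r : ℕ} {U : Finset V} {a b : V} (j : ℕ) (as bs : Fin r → V)
    (hp : (a, b) ∈ U.offDiag) (h : ∀ i, as i ∈ U \ {a, b} ∧ bs i ∈ U \ {a, b}) (f : Finset V → ℝ) :
    sA14 U (j + 1) f (Fin.cons a as : Fin (r + 1) → V) (Fin.cons b bs : Fin (r + 1) → V) =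
      sA14 (U \ {a, b}) j (od14 (a, b) f) as bs := by
  have hc := sumC14 j as bs hp h (fun _ => 1)
  simp only [Finset.sum_const, nsmul_eq_mul, mul_one] at hc
  unfold sA14
  rw [hc, sumC14 j as bs hp h]
  have him : Finset.image (Fin.cons b bs : Fin (r + 1) → V) Finset.univ =
      insert b (Finset.image bs Finset.univ) := by
    ext x
    simp [Fin.exists_fin_succ, eq_comm]
  have hs : ∀ R ∈ C14 (U \ {a, b}) j as bs,
      (-1 : ℝ) ^ (insert a R ∩ Finset.image (Fin.cons b bs : Fin (r + 1) → V) Finset.univ).card * f (insert a R) +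
      (-1 : ℝ) ^ (insert b R ∩ Finset.image (Fin.cons b bs : Fin (r + 1) → V) Finset.univ).card * f (insert b R) =
      2 * ((-1 : ℝ) ^ (R ∩ Finset.image bs Finset.univ).card * od14 (a, b) f R) := by
    intro R hR
    rw [Finset.mem_offDiag] at hp
    obtain ⟨ha, hb, hab⟩ := hp
    simp only at ha hb hab
    simp only [C14, Finset.mem_filter, Finset.mem_powersetCard] at hR
    have hbR : b ∉ R := fun hh => by have := hR.1.1 hh; simp at this
    have haI : a ∉ Finset.image bs Finset.univ := by
      intro hh
      rw [Finset.mem_image] at hh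
      obtain ⟨i, -, hi⟩ := hh
      have := (h i).2
      rw [hi] at this
      simp at this
    have e1 : insert a R ∩ insert b (Finset.image bs Finset.univ) = R ∩ Finset.image bs Finset.univ := by
      rw [Finset.insert_inter_of_notMem (by simp only [Finset.mem_insert, not_or]; exact ⟨hab, haI⟩),
        Finset.inter_insert_of_notMem hbR]
    have e2 : insert b R ∩ insert b (Finset.image bs Finset.univ) = insert b (R ∩ Finset.image bs Finset.univ) := by
      rw [← Finset.insert_inter_distrib]
    rw [him, e1, e2, Finset.card_insert_of_notMem (by simp [hbR]), pow_succ]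
    simp only [od14]
    ring
  rw [Finset.sum_congr rfl hs, ← Finset.mul_sum]
  have : ((C14 (U \ {a, b}) j as bs).card : ℝ) * (1 + 1) = 2 * (C14 (U \ {a, b}) j as bs).card := by ring
  rw [this, mul_div_mul_left _ _ (by norm_num)]

theorem link14 [Fintype V] (r : ℕ) : ∀ (U : Finset V) (j : ℕ) (f : Finset V → ℝ), r ≤ j →
    2 * j ≤ U.card → W14 r U j f = (∑ p ∈ I14 r U, (sA14 U j f p.1 p.2) ^ 2) / ((I14 r U).card : ℝ) := by
  induction r with
  | zero =>
    intro U j f _ _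
    have : I14 0 U = Finset.univ := by
      ext p
      simp [I14, Function.Injective]
    rw [this]
    simp [W14, av14, sA14, C14]
  | succ r ih =>
    intro U j f hr hU
    obtain ⟨j, rfl⟩ : ∃ i, j = i + 1 := ⟨j - 1, by omega⟩
    simp only [W14]
    rw [sumI14 U (fun a b => sA14 U (j + 1) f a b ^ 2), cardI14, av14]
    have h1 : ∀ q ∈ U.offDiag, W14 r (U \ {q.1, q.2}) j (od14 q f) =
      (∑ p ∈ I14 r (U \ {q.1, q.2}), sA14 U (j + 1) f (Fin.cons q.1 p.1 : Fin (r + 1) → V) (Fin.cons q.2 p.2 : Fin (r + 1) → V) ^ 2)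
        / D14 r (U.card - 2) := by
      intro q hq
      rw [ih _ _ _ (by omega) (by rw [sd14_card hq]; omega), cardI14, sd14_card hq]
      congr 1
      refine Finset.sum_congr rfl fun p hp => ?_
      simp only [I14, Finset.mem_filter] at hp
      rw [sAcons14 j p.1 p.2 hq hp.2.2]
    rw [Finset.sum_congr rfl h1, ← Finset.sum_div, div_div, Finset.offDiag_card, mul_comm]
    rfl

end S14

theorem stmt14 (n k : ℕ) (hk : 1 ≤ k) (hn : 2 * k ≤ n)
    (f : Finset (Fin n) → ℝ) :
    ∃ r : ℕ, 1 ≤ r ∧ r ≤ k ∧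
      (5 : ℝ) ^ (-(k : ℝ) / 2) * Real.sqrt (varUnif k f) ≤ Wpow k r f := by
  have hcard : (Finset.univ : Finset (Fin n)).card = n := by simp
  have hW : ∀ r, r ≤ k → Wpow k r f = Real.sqrt (W14 r (Finset.univ : Finset (Fin n)) k f) := by
    intro r hr
    rw [link14 r _ k f hr (by rw [hcard]; exact hn)]
    have hI : I14 r (Finset.univ : Finset (Fin n)) =
        (Finset.univ : Finset ((Fin r → Fin n) × (Fin r → Fin n))).filter
          (fun p => Function.Injective (Sum.elim p.1 p.2)) := by
      ext p
      simp [I14]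
    rw [hI]
    rfl
  by_contra hcon
  push Not at hcon
  have h5 : ((5 : ℝ) ^ (-(k : ℝ) / 2)) ^ 2 = (5 ^ k)⁻¹ := by
    rw [← Real.rpow_natCast, ← Real.rpow_mul (by norm_num)]
    have : -(k : ℝ) / 2 * ((2 : ℕ) : ℝ) = -(k : ℝ) := by push_cast; ring
    rw [this, Real.rpow_neg (by norm_num), Real.rpow_natCast]
  have hlt : ∀ r, 1 ≤ r → r ≤ k → W14 r (Finset.univ : Finset (Fin n)) k f < (5 ^ k)⁻¹ * varUnif k f := by
    intro r h1 h2
    have h := hcon r h1 h2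
    rw [hW r h2] at h
    have hv : 0 < varUnif k f := by
      by_contra hv
      rw [Real.sqrt_eq_zero_of_nonpos (not_lt.mp hv), mul_zero] at h
      exact absurd h (not_lt.mpr (Real.sqrt_nonneg _))
    have h3 := pow_lt_pow_left₀ h (Real.sqrt_nonneg _) (two_ne_zero)
    rw [mul_pow, Real.sq_sqrt (W14_nonneg _ _ _ _), Real.sq_sqrt hv.le, h5] at h3
    exact h3
  have hpos : 0 < varUnif k f := by
    have h1 := hlt 1 le_rfl hk
    have h2 := (W14_nonneg 1 (Finset.univ : Finset (Fin n)) k f).trans_lt h1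
    exact pos_of_mul_pos_right h2 (by positivity)
  have hm := main14 k (Finset.univ : Finset (Fin n)) f (by rw [hcard]; exact hn)
  rw [Finset.sum_range_succ'] at hm
  have h0 : ((2 * k).choose 0 : ℝ) * W14 0 (Finset.univ : Finset (Fin n)) k f = meanUnif k f ^ 2 := by
    simp [W14, meanUnif, av14]
  rw [h0] at hm
  have hvar : varUnif k f = av14 ((Finset.univ : Finset (Fin n)).powersetCard k) (fun R => f R ^ 2) - meanUnif k f ^ 2 := rfl
  set M := (5 ^ k : ℝ)⁻¹ * varUnif k f with hM
  have hMpos : 0 < M := by positivity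
  have hb : ∀ r ∈ Finset.range (2 * k), ((2 * k).choose (r + 1) : ℝ) * W14 (r + 1) (Finset.univ : Finset (Fin n)) k f ≤
      ((2 * k).choose (r + 1) : ℝ) * M := by
    intro r _
    refine mul_le_mul_of_nonneg_left ?_ (by positivity)
    by_cases hr : r + 1 ≤ k
    · exact (hlt (r + 1) (by omega) hr).le
    · rw [W14_zero _ _ _ _ (by omega)]; exact hMpos.le
  have hs := Finset.sum_le_sum hb
  rw [← Finset.sum_mul] at hs
  have hch : ∑ r ∈ Finset.range (2 * k), ((2 * k).choose (r + 1) : ℝ) + 1 = 4 ^ k := by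
    have := Nat.sum_range_choose (2 * k)
    rw [Finset.sum_range_succ', pow_mul] at this
    have h2 := congrArg (Nat.cast : ℕ → ℝ) this
    push_cast at h2
    norm_num at h2
    exact h2
  have h45 : (4 : ℝ) ^ k ≤ 5 ^ k := by gcongr; norm_num
  have hMv : 5 ^ k * M = varUnif k f := by rw [hM]; field_simp
  nlinarith
end

section
/- For any k ∈ ℕ and δ > 0, there exists α > 0 such that the following holds for every n. Consider a partial red-blue colouring of the edges of the complete k-uniform hypergraph on n vertices in which each colour class contains at least δ·n^k edges and at most α·n^k edges are left uncoloured. Then there are at least α·n^{k−1} sets of k−1 vertices, each of which is contained in at least α·n red edges and at least α·n blue edges. -/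
open Finset

/-- the tuple using `y` before position `i` and `x` from position `i` on -/
def hyb {k n : ℕ} (i : ℕ) (p : (Fin k → Fin n) × (Fin k → Fin n)) : Fin k → Fin n :=
  fun j => if j.val < i then p.2 j else p.1 j

def hybSwap {k n : ℕ} (i : ℕ) (p : (Fin k → Fin n) × (Fin k → Fin n)) :
    (Fin k → Fin n) × (Fin k → Fin n) :=
  (hyb i p, hyb i (p.2, p.1))

lemma hybSwap_inj {k n : ℕ} (i : ℕ) : Function.Injective (hybSwap (k := k) (n := n) i) := by
  apply Function.Involutive.injective
  rintro ⟨x, y⟩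
  ext j
  all_goals
    simp only [hybSwap, hyb]
    split_ifs <;> rfl

lemma hyb_succ {k n : ℕ} (i : Fin k) (p : (Fin k → Fin n) × (Fin k → Fin n)) :
    hyb (i.val + 1) p = Function.update (hyb i.val p) i ((hybSwap i.val p).2 i) := by
  ext j
  by_cases h : j = i
  · subst h; simp [hyb, hybSwap]
  · have : j.val ≠ i.val := fun h' => h (Fin.ext h')
    rw [Function.update_of_ne h]
    simp only [hyb]
    congr 1
    have h2 : (j.val < i.val + 1) = (j.val < i.val) := by apply propext; omega
    simp only [h2]

lemma path_count {k n : ℕ} (hpos : 0 < k) (R B : Finset (Fin k → Fin n)) :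
    R.card * B.card ≤ (k + 1) * ((univ \ (R ∪ B)).card * n ^ k) +
      ∑ i : Fin k, (univ.filter (fun p : (Fin k → Fin n) × (Fin k → Fin n) =>
        p.1 ∈ R ∧ Function.update p.1 i (p.2 i) ∈ B)).card := by
  classical
  set U := univ \ (R ∪ B) with hU
  have hsub : R ×ˢ B ⊆
      ((range (k+1)).biUnion (fun i => univ.filter (fun p => hyb i p ∈ U))) ∪
      ((univ : Finset (Fin k)).biUnion (fun i => univ.filter (fun p =>
        hyb i.val p ∈ R ∧ hyb (i.val+1) p ∈ B))) := by
    intro p hp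
    rw [mem_product] at hp
    by_contra hcon
    simp only [mem_union, mem_biUnion, mem_range, mem_filter, mem_univ, true_and, not_or,
      not_exists, not_and] at hcon
    obtain ⟨h1, h2⟩ := hcon
    have key : ∀ i, i ≤ k → hyb i p ∈ R ∧ (i < k → hyb (i+1) p ∈ R) := by
      have step : ∀ i, i < k → hyb i p ∈ R → hyb (i+1) p ∈ R := by
        intro i hi hR
        have hb := h2 ⟨i, hi⟩ hR
        have hu := h1 (i+1) (by omega)
        simp only [hU, mem_sdiff, mem_univ, true_and, mem_union, not_not] at hu
        tauto
      intro i hi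
      have : hyb i p ∈ R := by
        induction i with
        | zero =>
          have h0 : hyb 0 p = p.1 := by ext j; simp [hyb]
          rw [h0]; exact hp.1
        | succ i ih => exact step i (by omega) (ih (by omega))
      exact ⟨this, fun h => step i h this⟩
    · have hk1 := (key (k-1) (by omega)).1
      apply h2 ⟨k-1, by omega⟩ hk1
      have : hyb (k-1+1) p = p.2 := by
        ext j; simp only [hyb]; rw [if_pos (by omega)]
      simpa [this] using hp.2
  have hcardprod : (univ : Finset (Fin k → Fin n)).card = n ^ k := by simp
  calc R.card * B.card = (R ×ˢ B).card := (card_product _ _).symm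
    _ ≤ _ := card_le_card hsub
    _ ≤ _ := card_union_le _ _
    _ ≤ _ := by
      apply Nat.add_le_add
      · refine (card_biUnion_le).trans ?_
        refine (sum_le_card_nsmul _ _ (U.card * n ^ k) ?_).trans (by simp)
        intro i _
        rw [← hcardprod, ← card_product]
        apply card_le_card_of_injOn (hybSwap i)
        · intro p hp
          simp only [coe_filter, mem_univ, true_and, Set.mem_ofPred_eq] at hp
          simp [hybSwap, hp]
        · exact (hybSwap_inj i).injOn
      · refine (card_biUnion_le).trans ?_
        apply sum_le_sum
        intro i _
        apply card_le_card_of_injOn (hybSwap i.val)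
        · intro p hp
          simp only [coe_filter, mem_univ, true_and, Set.mem_ofPred_eq] at hp ⊢
          rw [hyb_succ] at hp
          exact hp
        · exact (hybSwap_inj _).injOn

lemma card_box {k n : ℕ} (i : Fin k) (D E : Finset (Fin n)) :
    (Fintype.piFinset (fun j : Fin k => if j = i then D else E)).card
      = D.card * E.card ^ (k-1) := by
  rw [Fintype.card_piFinset, ← mul_prod_erase univ _ (mem_univ i)]
  simp only [if_true]
  congr 1
  rw [prod_congr rfl (g := fun _ => E.card)]
  · simp
  · intro j hj; rw [if_neg (ne_of_mem_erase hj)]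

def face {k n : ℕ} (i : Fin k) (z : Fin k → Fin n) : Finset (Fin n) := (univ.erase i).image z

lemma image_eq_face {k n : ℕ} (i : Fin k) (z : Fin k → Fin n) :
    univ.image z = insert (z i) (face i z) := by
  rw [face, ← image_insert, insert_erase (mem_univ i)]

lemma face_update {k n : ℕ} (i : Fin k) (z : Fin k → Fin n) (v : Fin n) :
    face i (Function.update z i v) = face i z := by
  apply image_congr
  intro j hj
  rw [Function.update_of_ne]
  simpa using hj

lemma face_card_le {k n : ℕ} (i : Fin k) (z : Fin k → Fin n) : (face i z).card ≤ k - 1 :=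
  card_image_le.trans (by simp)

lemma low_count {k n : ℕ} (i : Fin k) (C : Finset (Finset (Fin n)))
    (hC : C ⊆ (univ : Finset (Fin n)).powersetCard k) (a : ℝ) (ha : 0 ≤ a) :
    ((univ.filter (fun p : (Fin k → Fin n) × (Fin k → Fin n) =>
      univ.image (Function.update p.1 i (p.2 i)) ∈ C ∧
      ((C.filter (fun T => face i p.1 ⊆ T)).card : ℝ) < a * n)).card : ℝ) ≤
      a * (n : ℝ) ^ (2 * k) := by
  classical
  have hk : 1 ≤ k := by have := i.2; omega
  have h1 : ∀ z : Fin k → Fin n,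
      ((univ.filter (fun w : Fin k → Fin n => univ.image (Function.update z i (w i)) ∈ C ∧
      ((C.filter (fun T => face i z ⊆ T)).card : ℝ) < a * n)).card : ℝ) ≤ a * (n:ℝ)^k := by
    intro z
    by_cases hlow : ((C.filter (fun T => face i z ⊆ T)).card : ℝ) < a * n
    · set D := univ.filter (fun v : Fin n => insert v (face i z) ∈ C) with hD
      have hnot : ∀ v ∈ D, v ∉ face i z := by
        intro v hv hmem
        rw [hD, mem_filter, insert_eq_of_mem hmem] at hv
        have := (mem_powersetCard.1 (hC hv.2)).2
        have := face_card_le i z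
        omega
      have hDc : D.card ≤ (C.filter (fun T => face i z ⊆ T)).card := by
        apply card_le_card_of_injOn (fun v => insert v (face i z))
        · intro v hv
          have hv' : v ∈ D := hv
          rw [hD, mem_filter] at hv'
          simp [hv'.2]
        · intro v hv v' hv' h
          have : v ∈ insert v' (face i z) := by
            have h' : insert v (face i z) = insert v' (face i z) := h
            rw [← h']; exact mem_insert_self _ _
          rcases mem_insert.1 this with h | h
          · exact h
          · exact absurd h (hnot v hv)
      have hs : (univ.filter (fun w : Fin k → Fin n => univ.image (Function.update z i (w i)) ∈ C ∧
          ((C.filter (fun T => face i z ⊆ T)).card : ℝ) < a * n)) ⊆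
          Fintype.piFinset (fun j : Fin k => if j = i then D else univ) := by
        intro w hw
        rw [mem_filter] at hw
        rw [Fintype.mem_piFinset]
        intro j
        by_cases hj : j = i
        · subst hj
          have := hw.2.1
          rw [image_eq_face j, face_update, Function.update_self] at this
          simp [hD, this]
        · simp [hj]
      have hc := card_le_card hs
      rw [card_box, card_univ, Fintype.card_fin] at hc
      have hc2 := hc.trans (Nat.mul_le_mul_right _ hDc)
      have hc3 : ((univ.filter (fun w : Fin k → Fin n =>
          univ.image (Function.update z i (w i)) ∈ C ∧
          ((C.filter (fun T => face i z ⊆ T)).card : ℝ) < a * n)).card : ℝ) ≤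
          ((C.filter (fun T => face i z ⊆ T)).card : ℝ) * (n:ℝ)^(k-1) := by exact_mod_cast hc2
      refine hc3.trans ?_
      have : (n:ℝ)^k = n * (n:ℝ)^(k-1) := by rw [← pow_succ']; congr 1; omega
      rw [this, ← mul_assoc]
      gcongr
    · simp only [hlow, and_false, filter_false, card_empty, Nat.cast_zero]
      positivity
  rw [← univ_product_univ, card_filter, sum_product]
  simp only [← card_filter]
  push_cast
  refine (sum_le_card_nsmul _ _ _ (fun z _ => h1 z)).trans ?_
  simp
  apply le_of_eq
  ring

lemma high_count {k n : ℕ} (i : Fin k) (G : Finset (Finset (Fin n)))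
    (hG : G ⊆ (univ : Finset (Fin n)).powersetCard (k-1)) :
    (univ.filter (fun p : (Fin k → Fin n) × (Fin k → Fin n) => face i p.1 ∈ G)).card ≤
      G.card * (n * (k-1)^(k-1)) * n ^ k := by
  classical
  have hs : (univ.filter (fun p : (Fin k → Fin n) × (Fin k → Fin n) => face i p.1 ∈ G)) ⊆
      (G.biUnion (fun S => Fintype.piFinset (fun j : Fin k => if j = i then univ else S))) ×ˢ
        (univ : Finset (Fin k → Fin n)) := by
    intro p hp
    rw [mem_filter] at hp
    rw [mem_product]
    refine ⟨mem_biUnion.2 ⟨_, hp.2, ?_⟩, mem_univ _⟩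
    rw [Fintype.mem_piFinset]
    intro j
    by_cases hj : j = i
    · simp [hj]
    · simp only [hj, if_false]
      exact mem_image_of_mem _ (by simp [hj])
  refine (card_le_card hs).trans ?_
  rw [card_product]
  apply Nat.mul_le_mul _ (by simp)
  refine card_biUnion_le.trans ?_
  refine (sum_le_card_nsmul _ _ (n * (k-1)^(k-1)) ?_).trans (by simp)
  intro S hS
  rw [card_box, (mem_powersetCard.1 (hG hS)).2]
  simp

def tup (k : ℕ) {n : ℕ} (C : Finset (Finset (Fin n))) : Finset (Fin k → Fin n) :=
  univ.filter (fun z => univ.image z ∈ C)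

lemma card_le_tup {k n : ℕ} (C : Finset (Finset (Fin n)))
    (hC : C ⊆ (univ : Finset (Fin n)).powersetCard k) : C.card ≤ (tup k C).card := by
  classical
  have : C ⊆ (tup k C).image (fun z => univ.image z) := by
    intro T hT
    have hc := (mem_powersetCard.1 (hC hT)).2
    have him : univ.image (T.orderEmbOfFin hc) = T := by
      ext x
      have := T.range_orderEmbOfFin hc
      rw [Set.ext_iff] at this
      simpa using this x
    refine mem_image.2 ⟨T.orderEmbOfFin hc, ?_, him⟩
    simp only [tup, mem_filter, mem_univ, true_and]
    rw [him]; exact hT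
  exact (card_le_card this).trans card_image_le

lemma tup_card_le {k n : ℕ} (C : Finset (Finset (Fin n)))
    (hC : C ⊆ (univ : Finset (Fin n)).powersetCard k) : (tup k C).card ≤ C.card * k ^ k := by
  classical
  have hs : tup k C ⊆ C.biUnion (fun S => Fintype.piFinset (fun _ : Fin k => S)) := by
    intro z hz
    simp only [tup, mem_filter, mem_univ, true_and] at hz
    refine mem_biUnion.2 ⟨_, hz, ?_⟩
    rw [Fintype.mem_piFinset]
    intro j
    exact mem_image_of_mem _ (mem_univ _)
  refine (card_le_card hs).trans (card_biUnion_le.trans ?_)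
  refine (sum_le_card_nsmul _ _ (k^k) ?_).trans (by simp)
  intro S hS
  rw [Fintype.card_piFinset]
  simp [(mem_powersetCard.1 (hC hS)).2]

lemma noninj_card {k n : ℕ} :
    (univ.filter (fun z : Fin k → Fin n => ¬ Function.Injective z)).card ≤
      k * k * n ^ (k-1) := by
  classical
  have hs : (univ.filter (fun z : Fin k → Fin n => ¬ Function.Injective z)) ⊆
      (univ : Finset (Fin k × Fin k)).biUnion (fun q => univ.filter
        (fun z : Fin k → Fin n => q.1 ≠ q.2 ∧ z q.1 = z q.2)) := by
    intro z hz
    simp only [mem_filter, mem_univ, true_and, Function.Injective, not_forall] at hz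
    obtain ⟨a, b, h, hne⟩ := hz
    exact mem_biUnion.2 ⟨(a, b), mem_univ _, by simp [h, hne]⟩
  refine (card_le_card hs).trans (card_biUnion_le.trans ?_)
  refine (sum_le_card_nsmul _ _ (n^(k-1)) ?_).trans (by simp)
  rintro ⟨a, b⟩ -
  by_cases hab : a = b
  · simp [hab]
  · have : n ^ (k-1) = (univ : Finset ({j : Fin k // j ≠ a} → Fin n)).card := by
      simp [Fintype.card_subtype_compl]
    rw [this]
    apply card_le_card_of_injOn (fun z j => z j.1)
    · intro z _; simp
    · intro z hz w hw h
      simp only [coe_filter, mem_univ, true_and, Set.mem_ofPred_eq] at hz hw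
      have h' : ∀ j, j ≠ a → z j = w j := fun j hj => congrFun h ⟨j, hj⟩
      ext j
      by_cases hj : j = a
      · subst hj; rw [hz.2, hw.2, h' b (Ne.symm hab)]
      · rw [h' j hj]

lemma exists_adj {n k : ℕ} (Red Blue : Finset (Finset (Fin n)))
    (hR : Red ⊆ (univ : Finset (Fin n)).powersetCard k)
    (hB : Blue ⊆ (univ : Finset (Fin n)).powersetCard k)
    (hd : Disjoint Red Blue)
    (hall : (univ : Finset (Fin n)).powersetCard k \ (Red ∪ Blue) = ∅) (m : ℕ) :
    ∀ A ∈ Red, ∀ B ∈ Blue, (A \ B).card = m → ∃ S ∈ (univ : Finset (Fin n)).powersetCard (k-1),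
      (∃ T ∈ Red, S ⊆ T) ∧ (∃ T ∈ Blue, S ⊆ T) := by
  classical
  induction m with
  | zero =>
    intro A hA B hBb h
    exfalso
    have hsub : A ⊆ B := by rwa [card_eq_zero, sdiff_eq_empty_iff_subset] at h
    have h1 := (mem_powersetCard.1 (hR hA)).2
    have h2 := (mem_powersetCard.1 (hB hBb)).2
    have := eq_of_subset_of_card_le hsub (by omega)
    subst this
    exact disjoint_left.1 hd hA hBb
  | succ m ih =>
    intro A hA B hBb h
    have h1 := (mem_powersetCard.1 (hR hA)).2
    have h2 := (mem_powersetCard.1 (hB hBb)).2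
    obtain ⟨a, ha⟩ : (A \ B).Nonempty := by rw [← card_pos]; omega
    obtain ⟨b, hb⟩ : (B \ A).Nonempty := by
      rw [← card_pos]
      have := card_sdiff_add_card_inter A B
      have h4 := card_sdiff_add_card_inter B A
      rw [inter_comm] at h4
      omega
    rw [mem_sdiff] at ha hb
    have hbn : b ∉ A.erase a := fun h => hb.2 (mem_of_mem_erase h)
    have hA'c : (insert b (A.erase a)).card = k := by
      rw [card_insert_of_notMem hbn, card_erase_of_mem ha.1]
      have : 0 < A.card := card_pos.2 ⟨a, ha.1⟩
      omega
    have hcol : insert b (A.erase a) ∈ Red ∪ Blue := by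
      by_contra hc
      have : insert b (A.erase a) ∈ (univ : Finset (Fin n)).powersetCard k \ (Red ∪ Blue) :=
        mem_sdiff.2 ⟨mem_powersetCard.2 ⟨subset_univ _, hA'c⟩, hc⟩
      rw [hall] at this
      simp at this
    rcases mem_union.1 hcol with hr | hbl
    · apply ih _ hr B hBb
      have : insert b (A.erase a) \ B = (A \ B).erase a := by
        ext x
        simp only [mem_sdiff, mem_insert, mem_erase]
        constructor
        · rintro ⟨rfl | h, h'⟩
          · exact absurd hb.1 h'
          · tauto
        · tauto
      rw [this, card_erase_of_mem (mem_sdiff.2 ha)]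
      omega
    · refine ⟨A.erase a, mem_powersetCard.2 ⟨subset_univ _, ?_⟩, ⟨A, hA, erase_subset _ _⟩,
        ⟨_, hbl, subset_insert _ _⟩⟩
      rw [card_erase_of_mem ha.1, h1]

lemma large_case {k n : ℕ} (hk : 1 ≤ k) (hn : 0 < n) (δ α : ℝ) (hδ : 0 < δ) (hα : 0 < α)
    (Red Blue : Finset (Finset (Fin n)))
    (hR : Red ⊆ (univ : Finset (Fin n)).powersetCard k)
    (hB : Blue ⊆ (univ : Finset (Fin n)).powersetCard k)
    (hRc : δ * (n : ℝ) ^ k ≤ (Red.card : ℝ))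
    (hBc : δ * (n : ℝ) ^ k ≤ (Blue.card : ℝ))
    (hU : ((((univ : Finset (Fin n)).powersetCard k \ (Red ∪ Blue)).card : ℝ) ≤ α * (n : ℝ) ^ k))
    (G : Finset (Finset (Fin n)))
    (hG : G = (((univ : Finset (Fin n)).powersetCard (k - 1))).filter
          (fun S => α * (n : ℝ) ≤ ((Red.filter (fun R => S ⊆ R)).card : ℝ) ∧
                    α * (n : ℝ) ≤ ((Blue.filter (fun R => S ⊆ R)).card : ℝ)))
    (hGc : (G.card : ℝ) < α * (n : ℝ) ^ (k - 1)) :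
    δ ^ 2 * n ≤ α * (((k : ℝ) + 1) * k ^ k + k * (k ^ k + 2)) * n + (k + 1) * (k * k) := by
  classical
  have hnk : (n:ℝ)^k = n * (n:ℝ)^(k-1) := by rw [← pow_succ']; congr 1; omega
  have hn' : (0:ℝ) < n := by exact_mod_cast hn
  -- bound for each direction
  have hE : ∀ i : Fin k, ((univ.filter (fun p : (Fin k → Fin n) × (Fin k → Fin n) =>
        p.1 ∈ tup k Red ∧ Function.update p.1 i (p.2 i) ∈ tup k Blue)).card : ℝ) ≤
        α * (k ^ k + 2) * (n:ℝ) ^ (2 * k) := by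
    intro i
    set X1 := univ.filter (fun p : (Fin k → Fin n) × (Fin k → Fin n) => face i p.1 ∈ G) with hX1
    set XB := univ.filter (fun p : (Fin k → Fin n) × (Fin k → Fin n) =>
      univ.image (Function.update p.1 i (p.2 i)) ∈ Blue ∧
      ((Blue.filter (fun T => face i p.1 ⊆ T)).card : ℝ) < α * n) with hXB
    set XR := univ.filter (fun p : (Fin k → Fin n) × (Fin k → Fin n) =>
      univ.image (Function.update p.1 i (p.2 i)) ∈ Red ∧
      ((Red.filter (fun T => face i p.1 ⊆ T)).card : ℝ) < α * n) with hXR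
    set XR' := univ.filter (fun p : (Fin k → Fin n) × (Fin k → Fin n) =>
      univ.image p.1 ∈ Red ∧
      ((Red.filter (fun T => face i p.1 ⊆ T)).card : ℝ) < α * n) with hXR'
    have hRR : XR'.card ≤ XR.card := by
      apply card_le_card_of_injOn (fun p =>
        (Function.update p.1 i (p.2 i), Function.update p.2 i (p.1 i)))
      · intro p hp
        have hp' : p ∈ XR' := hp
        rw [hXR', mem_filter] at hp'
        have : (Function.update p.1 i (p.2 i), Function.update p.2 i (p.1 i)) ∈ XR := by
          rw [hXR, mem_filter]
          refine ⟨mem_univ _, ?_, ?_⟩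
          · simpa using hp'.2.1
          · simp only [face_update]; exact hp'.2.2
        exact this
      · apply Function.Injective.injOn
        apply Function.Involutive.injective
        rintro ⟨x, y⟩
        simp
    have hsub : (univ.filter (fun p : (Fin k → Fin n) × (Fin k → Fin n) =>
        p.1 ∈ tup k Red ∧ Function.update p.1 i (p.2 i) ∈ tup k Blue)) ⊆ (X1 ∪ XB) ∪ XR' := by
      intro p hp
      simp only [tup, mem_filter, mem_univ, true_and] at hp
      simp only [mem_union, hX1, hXB, hXR', mem_filter, mem_univ, true_and]
      by_cases h1 : ((Blue.filter (fun T => face i p.1 ⊆ T)).card : ℝ) < α * n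
      · exact Or.inl (Or.inr ⟨hp.2, h1⟩)
      by_cases h2 : ((Red.filter (fun T => face i p.1 ⊆ T)).card : ℝ) < α * n
      · exact Or.inr ⟨hp.1, h2⟩
      left; left
      rw [hG, mem_filter, mem_powersetCard]
      refine ⟨⟨subset_univ _, ?_⟩, not_lt.1 h2, not_lt.1 h1⟩
      have hc := (mem_powersetCard.1 (hR hp.1)).2
      rw [image_eq_face i] at hc
      have h3 := card_insert_le (p.1 i) (face i p.1)
      have h4 := face_card_le i p.1
      omega
    have hc : _ ≤ X1.card + XB.card + XR.card := (card_le_card hsub).trans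
      ((card_union_le _ _).trans (Nat.add_le_add (card_union_le _ _) hRR))
    have hc' : ((univ.filter (fun p : (Fin k → Fin n) × (Fin k → Fin n) =>
        p.1 ∈ tup k Red ∧ Function.update p.1 i (p.2 i) ∈ tup k Blue)).card : ℝ) ≤
        X1.card + XB.card + XR.card := by exact_mod_cast hc
    have b1 := low_count i Blue hB α hα.le
    have b2 := low_count i Red hR α hα.le
    have b3 : (X1.card : ℝ) ≤ α * k ^ k * (n:ℝ) ^ (2 * k) := by
      have h := high_count i G (by rw [hG]; exact filter_subset _ _)
      have hpw : (k-1)^(k-1) ≤ k^k :=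
        (Nat.pow_le_pow_left (Nat.sub_le _ _) _).trans (Nat.pow_le_pow_right hk (Nat.sub_le _ _))
      have h' : X1.card ≤ G.card * (n * k ^ k) * n ^ k := h.trans (by gcongr)
      have h2 : (X1.card : ℝ) ≤ G.card * (n * (k:ℝ) ^ k) * (n:ℝ) ^ k := by exact_mod_cast h'
      calc (X1.card : ℝ) ≤ _ := h2
        _ ≤ (α * (n : ℝ) ^ (k - 1)) * (n * (k:ℝ) ^ k) * (n:ℝ) ^ k := by gcongr
        _ = α * k ^ k * ((n * (n:ℝ) ^ (k-1)) * (n:ℝ) ^ k) := by ring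
        _ = _ := by rw [← hnk]; ring
    linarith
  have hUc : ((univ \ (tup k Red ∪ tup k Blue)).card : ℝ) ≤
      α * (n:ℝ)^k * k ^ k + k * k * (n:ℝ)^(k-1) := by
    set W := (univ : Finset (Fin n)).powersetCard k \ (Red ∪ Blue) with hW
    have hsub : univ \ (tup k Red ∪ tup k Blue) ⊆ tup k W ∪
        univ.filter (fun z : Fin k → Fin n => ¬ Function.Injective z) := by
      intro z hz
      simp only [tup, mem_sdiff, mem_union, mem_filter, mem_univ, true_and, hW,
        mem_powersetCard, subset_univ] at hz ⊢
      by_cases hinj : Function.Injective z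
      · left
        exact ⟨by rw [card_image_of_injective _ hinj]; simp, hz⟩
      · right; exact hinj
    have h := (card_le_card hsub).trans ((card_union_le _ _).trans
      (Nat.add_le_add (tup_card_le W sdiff_subset) noninj_card))
    have h' : ((univ \ (tup k Red ∪ tup k Blue)).card : ℝ) ≤
      W.card * (k:ℝ) ^ k + k * k * (n:ℝ)^(k-1) := by exact_mod_cast h
    refine h'.trans ?_
    gcongr
  have hp := path_count hk (tup k Red) (tup k Blue)
  have hp' : ((tup k Red).card : ℝ) * (tup k Blue).card ≤
      ((k:ℝ) + 1) * ((univ \ (tup k Red ∪ tup k Blue)).card * (n:ℝ) ^ k) +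
      ∑ i : Fin k, ((univ.filter (fun p : (Fin k → Fin n) × (Fin k → Fin n) =>
        p.1 ∈ tup k Red ∧ Function.update p.1 i (p.2 i) ∈ tup k Blue)).card : ℝ) := by
    exact_mod_cast hp
  have hsum := sum_le_card_nsmul univ _ _ (fun i _ => hE i)
  simp only [card_univ, Fintype.card_fin, nsmul_eq_mul] at hsum
  have hR1 : δ * (n:ℝ)^k ≤ (tup k Red).card := hRc.trans (by exact_mod_cast card_le_tup Red hR)
  have hB1 : δ * (n:ℝ)^k ≤ (tup k Blue).card := hBc.trans (by exact_mod_cast card_le_tup Blue hB)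
  have hprod : (δ * (n:ℝ)^k) * (δ * (n:ℝ)^k) ≤ ((tup k Red).card : ℝ) * (tup k Blue).card := by
    gcongr
  have hfirst : ((k:ℝ) + 1) * ((univ \ (tup k Red ∪ tup k Blue)).card * (n:ℝ) ^ k) ≤
      ((k:ℝ) + 1) * ((α * (n:ℝ)^k * k ^ k + k * k * (n:ℝ)^(k-1)) * (n:ℝ) ^ k) := by gcongr
  have htot := hprod.trans (hp'.trans (add_le_add hfirst hsum))
  have hq : (0:ℝ) < (n:ℝ)^(k-1) * (n:ℝ)^k := by positivity
  refine le_of_mul_le_mul_right ?_ hq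
  rw [pow_mul', hnk] at htot
  rw [hnk]
  linarith

theorem stmt16 (k : ℕ) (hk : 1 ≤ k) (δ : ℝ) (hδ : 0 < δ) :
    ∃ α : ℝ, 0 < α ∧ ∀ n : ℕ, ∀ Red Blue : Finset (Finset (Fin n)),
      Red ⊆ (Finset.univ : Finset (Fin n)).powersetCard k →
      Blue ⊆ (Finset.univ : Finset (Fin n)).powersetCard k →
      Disjoint Red Blue →
      δ * (n : ℝ) ^ k ≤ (Red.card : ℝ) →
      δ * (n : ℝ) ^ k ≤ (Blue.card : ℝ) →
      ((((Finset.univ : Finset (Fin n)).powersetCard k \ (Red ∪ Blue)).card : ℝ) ≤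
        α * (n : ℝ) ^ k) →
      α * (n : ℝ) ^ (k - 1) ≤
        (((((Finset.univ : Finset (Fin n)).powersetCard (k - 1))).filter
          (fun S => α * (n : ℝ) ≤ ((Red.filter (fun R => S ⊆ R)).card : ℝ) ∧
                    α * (n : ℝ) ≤ ((Blue.filter (fun R => S ⊆ R)).card : ℝ))).card : ℝ) := by
  obtain ⟨N, hN⟩ := exists_nat_gt (((k:ℝ) + 1) * (k * k) * 2 / δ ^ 2)
  have hδ2 : 0 < δ ^ 2 := by positivity
  rw [div_lt_iff₀ hδ2] at hN
  set M : ℝ := ((k : ℝ) + 1) * k ^ k + k * (k ^ k + 2) with hM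
  have hMpos : 0 < M := by
    have : (0:ℝ) < k := by exact_mod_cast hk
    positivity
  have hPpos : (0:ℝ) < (N:ℝ)^k + 1 := by positivity
  refine ⟨min (δ ^ 2 / (2 * M)) (1 / ((N:ℝ)^k + 1)), by positivity, ?_⟩
  set α := min (δ ^ 2 / (2 * M)) (1 / ((N:ℝ)^k + 1)) with hαdef
  have hα : 0 < α := by positivity
  have hα1 : α * M ≤ δ ^ 2 / 2 := by
    have h : α ≤ δ ^ 2 / (2 * M) := min_le_left _ _
    rw [le_div_iff₀ (by positivity)] at h
    linarith
  have hα2 : α * ((N:ℝ)^k + 1) ≤ 1 := by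
    have h : α ≤ 1 / ((N:ℝ)^k + 1) := min_le_right _ _
    rwa [le_div_iff₀ hPpos] at h
  intro n Red Blue hR hB hd hRc hBc hU
  rcases Nat.eq_zero_or_pos n with hn0 | hn
  · subst hn0
    rcases Nat.eq_or_lt_of_le hk with h1 | h1
    · subst h1
      have : α ≤ 1 := by
        have : 0 ≤ α * (N:ℝ)^1 := by positivity
        linarith
      simpa using this
    · have : k - 1 ≠ 0 := by omega
      simp [this]
  have hn' : (1:ℝ) ≤ n := by exact_mod_cast hn
  by_cases hnN : n ≤ N
  · have hnk : (n:ℝ)^k ≤ (N:ℝ)^k := by gcongr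
    have hlt : α * (n:ℝ)^k < 1 := by
      have : α * (n:ℝ)^k ≤ α * (N:ℝ)^k := by gcongr
      linarith
    have hall : (univ : Finset (Fin n)).powersetCard k \ (Red ∪ Blue) = ∅ := by
      rw [← card_eq_zero]
      have := hU.trans_lt hlt
      have h2 : ((univ : Finset (Fin n)).powersetCard k \ (Red ∪ Blue)).card < 1 := by
        exact_mod_cast this
      omega
    have hpos : 0 < δ * (n:ℝ)^k := by positivity
    obtain ⟨A, hA⟩ : Red.Nonempty := by
      rw [← card_pos]; exact_mod_cast hpos.trans_le hRc
    obtain ⟨B, hBm⟩ : Blue.Nonempty := by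
      rw [← card_pos]; exact_mod_cast hpos.trans_le hBc
    obtain ⟨S, hS, ⟨T, hT, hST⟩, ⟨T', hT', hST'⟩⟩ :=
      exists_adj Red Blue hR hB hd hall _ A hA B hBm rfl
    have hn1 : α * (n:ℝ) ≤ 1 := by
      have h : (n:ℝ) ≤ (n:ℝ)^k := le_self_pow₀ hn' (by omega)
      have : α * (n:ℝ) ≤ α * (n:ℝ)^k := by gcongr
      linarith
    have hn2 : α * (n:ℝ)^(k-1) ≤ 1 := by
      have h : (n:ℝ)^(k-1) ≤ (n:ℝ)^k := pow_le_pow_right₀ hn' (by omega)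
      have : α * (n:ℝ)^(k-1) ≤ α * (n:ℝ)^k := by gcongr
      linarith
    refine hn2.trans ?_
    have : ∀ s : Finset (Finset (Fin n)), ∀ x ∈ s, (1:ℝ) ≤ s.card := by
      intro s x hx
      exact_mod_cast card_pos.2 ⟨x, hx⟩
    refine this _ S (mem_filter.2 ⟨hS, hn1.trans ?_, hn1.trans ?_⟩)
    · exact this _ T (mem_filter.2 ⟨hT, hST⟩)
    · exact this _ T' (mem_filter.2 ⟨hT', hST'⟩)
  · by_contra hcon
    have h := large_case hk hn δ α hδ hα Red Blue hR hB hRc hBc hU _ rfl (not_le.1 hcon)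
    rw [← hM] at h
    have hNn : (N:ℝ) ≤ n := by exact_mod_cast (not_le.1 hnN).le
    have h1 : α * M * n ≤ δ ^ 2 / 2 * n := by gcongr
    have h2 : (N:ℝ) * δ ^ 2 ≤ n * δ ^ 2 := by gcongr
    linarith
end

section
/- For every pair of integers k ≥ ℓ ≥ 1 and every δ > 0, there exists ε > 0 such that the following holds for all sufficiently large n. Suppose every non-homogeneous (k,k,k)-pattern F satisfies max_{ℓ≤r≤k} W^r(F) > 0. Then every k-uniform hypergraph G on vertex set [n] with min{ e(G), C(n,k) − e(G) } ≥ δ·n^k satisfies max_{ℓ≤r≤k} W^r(G) ≥ ε. -/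
open Finset

/-- Indicator function of a hypergraph, viewed as a real-valued function on finsets. -/
def hyperInd {V : Type*} [DecidableEq V] (G : Finset (Finset V)) : Finset V → ℝ :=
  fun S => if S ∈ G then 1 else 0


noncomputable def DD {V ι : Type*} [DecidableEq ι] (F : (ι → V) → ℝ) (T : Finset ι)
    (x y : ι → V) : ℝ :=
  ∑ S ∈ T.powerset, (-1 : ℝ) ^ S.card * F (S.piecewise y x)

lemma DD_congr {V ι : Type*} [DecidableEq ι] (F : (ι → V) → ℝ) (T : Finset ι)
    (x y y' : ι → V) (h : ∀ i ∈ T, y i = y' i) : DD F T x y = DD F T x y' := by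
  unfold DD
  refine Finset.sum_congr rfl fun S hS => ?_
  rw [Finset.mem_powerset] at hS
  have : S.piecewise y x = S.piecewise y' x := by
    funext i
    by_cases hi : i ∈ S
    · simp [hi, h i (hS hi)]
    · simp [hi]
  rw [this]

lemma DD_insert {V ι : Type*} [DecidableEq ι] (F : (ι → V) → ℝ) (T : Finset ι)
    (x y : ι → V) (j : ι) (hj : j ∉ T) :
    DD F (insert j T) x y = DD F T x y - DD F T (Function.update x j (y j)) y := by
  unfold DD
  rw [Finset.sum_powerset_insert hj, sub_eq_add_neg, ← Finset.sum_neg_distrib]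
  congr 1
  refine Finset.sum_congr rfl fun S hS => ?_
  rw [Finset.mem_powerset] at hS
  have hjS : j ∉ S := fun h => hj (hS h)
  have : (insert j S).piecewise y x = S.piecewise y (Function.update x j (y j)) := by
    funext i
    by_cases hi : i ∈ S
    · simp [hi]
    · by_cases hij : i = j
      · subst hij; simp [hi]
      · simp [hi, hij]
  rw [this, Finset.card_insert_of_notMem hjS]
  ring

lemma DD_bound {V ι : Type*} [DecidableEq ι] (F : (ι → V) → ℝ) (hF : ∀ x, |F x| ≤ 1)
    (T : Finset ι) (x y : ι → V) : |DD F T x y| ≤ 2 ^ T.card := by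
  unfold DD
  refine (Finset.abs_sum_le_sum_abs _ _).trans ?_
  calc _ ≤ ∑ S ∈ T.powerset, (1 : ℝ) := by
        refine Finset.sum_le_sum fun S _ => ?_
        rw [abs_mul, abs_pow]; simpa using hF _
    _ = _ := by simp

lemma DD_int {V ι : Type*} [DecidableEq ι] (F : (ι → V) → ℝ) (hF : ∀ x, F x = 0 ∨ F x = 1)
    (T : Finset ι) (x y : ι → V) : ∃ z : ℤ, DD F T x y = z := by
  have : ∀ x, ∃ z : ℤ, F x = z := fun x => by
    rcases hF x with h | h
    · exact ⟨0, by simp [h]⟩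
    · exact ⟨1, by simp [h]⟩
  choose g hg using this
  refine ⟨∑ S ∈ T.powerset, (-1) ^ S.card * g (S.piecewise y x), ?_⟩
  unfold DD
  push_cast
  simp [hg]

lemma sum_swap {V ι : Type*} [DecidableEq ι] [Fintype ι] [Fintype V]
    (U : Finset ι) (h : (ι → V) × (ι → V) → ℝ) :
    ∑ p : (ι → V) × (ι → V), h (U.piecewise p.2 p.1, U.piecewise p.1 p.2) = ∑ p, h p := by
  have inv : Function.Involutive
      (fun p : (ι → V) × (ι → V) => (U.piecewise p.2 p.1, U.piecewise p.1 p.2)) := by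
    intro p
    ext i <;> by_cases hi : i ∈ U <;> simp [hi]
  exact Fintype.sum_equiv inv.toPerm _ _ (fun p => rfl)

lemma chain_bound {V ι : Type*} [DecidableEq ι] [Fintype ι] [Fintype V]
    (F : (ι → V) → ℝ) (T : Finset ι) (θ : ℝ) (hθ : 0 ≤ θ)
    (h : ∀ j ∉ T, ∑ p : (ι → V) × (ι → V), DD F (insert j T) p.1 p.2 ^ 2 ≤ θ)
    (U : Finset ι) (hU : Disjoint U T) :
    ∑ p : (ι → V) × (ι → V), (DD F T p.1 p.2 - DD F T (U.piecewise p.2 p.1) p.2) ^ 2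
      ≤ 4 ^ U.card * θ := by
  induction U using Finset.induction_on with
  | empty => simpa using hθ
  | insert j U hjU ih =>
    have hjT : j ∉ T := by
      intro hj; exact (Finset.disjoint_left.1 hU (Finset.mem_insert_self _ _)) hj
    have hUT : Disjoint U T := hU.mono_left (Finset.subset_insert _ _)
    have e1 : ∑ p : (ι → V) × (ι → V), DD F (insert j T) (U.piecewise p.2 p.1) p.2 ^ 2 ≤ θ := by
      have hh := h j hjT
      rw [← sum_swap U] at hh
      · refine le_trans (le_of_eq ?_) hh
        refine Finset.sum_congr rfl fun p _ => ?_
        dsimp only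
        rw [DD_congr F _ _ p.2 (U.piecewise p.1 p.2)]
        intro i hi
        have : i ∉ U := by
          intro hiU
          rcases Finset.mem_insert.1 hi with rfl | hi
          · exact hjU hiU
          · exact Finset.disjoint_left.1 hUT hiU hi
        simp [this]
    have e2 : ∀ p : (ι → V) × (ι → V),
        (DD F T p.1 p.2 - DD F T ((insert j U).piecewise p.2 p.1) p.2) ^ 2 ≤
        2 * (DD F T p.1 p.2 - DD F T (U.piecewise p.2 p.1) p.2) ^ 2 +
        2 * DD F (insert j T) (U.piecewise p.2 p.1) p.2 ^ 2 := by
      intro p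
      rw [DD_insert _ _ _ _ _ hjT, Finset.piecewise_insert]
      nlinarith [sq_nonneg ((DD F T p.1 p.2 - DD F T (U.piecewise p.2 p.1) p.2) -
        (DD F T (U.piecewise p.2 p.1) p.2 -
          DD F T (Function.update (U.piecewise p.2 p.1) j (p.2 j)) p.2))]
    refine (Finset.sum_le_sum fun p _ => e2 p).trans ?_
    rw [Finset.sum_add_distrib, ← Finset.mul_sum, ← Finset.mul_sum,
      Finset.card_insert_of_notMem hjU, pow_succ]
    have := ih hUT
    have h4 : (1 : ℝ) ≤ 4 ^ U.card := one_le_pow₀ (by norm_num)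
    nlinarith

lemma sq_le_cross {V ι : Type*} [DecidableEq ι] [Fintype ι] [Fintype V]
    (F : (ι → V) → ℝ) (T : Finset ι) (θ : ℝ) (hθ : 0 ≤ θ)
    (h : ∀ j ∉ T, ∑ p : (ι → V) × (ι → V), DD F (insert j T) p.1 p.2 ^ 2 ≤ θ) :
    ∑ p : (ι → V) × (ι → V), DD F T p.1 p.2 ^ 2 ≤ 4 ^ (Fintype.card ι) * θ +
      ∑ p : (ι → V) × (ι → V), DD F T p.1 p.2 * DD F T (Tᶜ.piecewise p.2 p.1) p.2 := by
  have h1 := chain_bound F T θ hθ h Tᶜ disjoint_compl_left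
  have h2 : ∑ p : (ι → V) × (ι → V), DD F T (Tᶜ.piecewise p.2 p.1) p.2 ^ 2 =
      ∑ p : (ι → V) × (ι → V), DD F T p.1 p.2 ^ 2 := by
    rw [← sum_swap Tᶜ (fun p => DD F T p.1 p.2 ^ 2)]
    refine Finset.sum_congr rfl fun p _ => ?_
    dsimp only
    rw [DD_congr F _ _ p.2 (Tᶜ.piecewise p.1 p.2)]
    intro i hi
    simp [hi]
  have h3 : ∑ p : (ι → V) × (ι → V),
      (DD F T p.1 p.2 - DD F T (Tᶜ.piecewise p.2 p.1) p.2) ^ 2 =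
      ∑ p : (ι → V) × (ι → V), DD F T p.1 p.2 ^ 2 +
      ∑ p : (ι → V) × (ι → V), DD F T (Tᶜ.piecewise p.2 p.1) p.2 ^ 2 -
      2 * ∑ p : (ι → V) × (ι → V), DD F T p.1 p.2 * DD F T (Tᶜ.piecewise p.2 p.1) p.2 := by
    rw [Finset.mul_sum, ← Finset.sum_add_distrib, ← Finset.sum_sub_distrib]
    exact Finset.sum_congr rfl fun p _ => by ring
  have h4 : (4 : ℝ) ^ (Tᶜ).card ≤ 4 ^ Fintype.card ι :=
    pow_le_pow_right₀ (by norm_num) (Finset.card_le_univ _)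
  have h5 : (4 : ℝ) ^ (Tᶜ).card * θ ≤ 4 ^ Fintype.card ι * θ := by gcongr
  have h6 : 0 ≤ (4 : ℝ) ^ Fintype.card ι * θ := by positivity
  linarith

lemma card_noninj {V I : Type*} [DecidableEq I] [Fintype I] [Fintype V] [DecidableEq V] :
    (#{Φ : I → V | ¬ Function.Injective Φ} : ℝ) * Fintype.card V ≤
      (Fintype.card I : ℝ) ^ 2 * (Fintype.card V : ℝ) ^ (Fintype.card I) := by
  have h1 : ∀ q : I × I, q.1 ≠ q.2 →
      #{Φ : I → V | Φ q.1 = Φ q.2} * Fintype.card V ≤ Fintype.card V ^ Fintype.card I := by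
    rintro ⟨i, j⟩ hij
    dsimp only at hij ⊢
    rw [← Finset.card_univ (α := V), ← Finset.card_product]
    rw [Finset.card_univ, ← Fintype.card_fun, ← Finset.card_univ (α := I → V)]
    refine Finset.card_le_card_of_injOn (fun z => Function.update z.1 i z.2) (by simp) ?_
    rintro ⟨Φ, v⟩ h ⟨Φ', v'⟩ h' heq
    simp only [Finset.coe_product, Set.mem_prod, Finset.mem_coe, Finset.mem_filter,
      Finset.mem_univ, true_and, and_true] at h h'
    dsimp only at heq
    have key : ∀ l, l ≠ i → Φ l = Φ' l := fun l hl => by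
      have := congrFun heq l
      simpa [hl] using this
    have hv : v = v' := by simpa using congrFun heq i
    refine Prod.ext (funext fun l => ?_) hv
    by_cases hl : l = i
    · subst hl
      show Φ l = Φ' l
      rw [h, h', key _ (Ne.symm hij)]
    · exact key l hl
  have h2 : #{Φ : I → V | ¬ Function.Injective Φ} ≤
      ∑ q ∈ (Finset.univ : Finset (I × I)).filter (fun q => q.1 ≠ q.2),
        #{Φ : I → V | Φ q.1 = Φ q.2} := by
    refine le_trans (Finset.card_le_card ?_) Finset.card_biUnion_le
    intro Φ hΦ
    rw [Finset.mem_filter] at hΦ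
    have hΦ := hΦ.2
    unfold Function.Injective at hΦ
    push Not at hΦ
    obtain ⟨i, j, h, hne⟩ := hΦ
    simp only [Finset.mem_biUnion, Finset.mem_filter, Finset.mem_univ, true_and]
    exact ⟨(i, j), hne, h⟩
  have h3 : #{Φ : I → V | ¬ Function.Injective Φ} * Fintype.card V ≤
      Fintype.card I ^ 2 * Fintype.card V ^ Fintype.card I := by
    calc _ ≤ (∑ q ∈ (Finset.univ : Finset (I × I)).filter (fun q => q.1 ≠ q.2),
        #{Φ : I → V | Φ q.1 = Φ q.2}) * Fintype.card V := Nat.mul_le_mul_right _ h2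
      _ ≤ ∑ q ∈ (Finset.univ : Finset (I × I)).filter (fun q => q.1 ≠ q.2),
          Fintype.card V ^ Fintype.card I := by
        rw [Finset.sum_mul]
        exact Finset.sum_le_sum fun q hq => h1 q (by simpa using hq)
      _ ≤ _ := by
        rw [Finset.sum_const, smul_eq_mul]
        refine Nat.mul_le_mul_right _ ((Finset.card_le_univ _).trans ?_)
        simp [sq]
  exact_mod_cast h3

open Classical in
lemma card_proj {V I J : Type*} [DecidableEq I] [DecidableEq J] [Fintype I] [Fintype J]
    [Fintype V] [DecidableEq V] (e : J → I) (he : Function.Injective e) (Q : (J → V) → Prop) :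
    (#{Φ : I → V | Q (Φ ∘ e)} : ℝ) * (Fintype.card V : ℝ) ^ (Fintype.card J) ≤
      (#{x : J → V | Q x} : ℝ) * (Fintype.card V : ℝ) ^ (Fintype.card I) := by
  have : #{Φ : I → V | Q (Φ ∘ e)} * Fintype.card V ^ Fintype.card J ≤
      #{x : J → V | Q x} * Fintype.card V ^ Fintype.card I := by
    rw [← Fintype.card_fun, ← Fintype.card_fun, ← Finset.card_univ, ← Finset.card_univ,
      ← Finset.card_product, ← Finset.card_product]
    refine Finset.card_le_card_of_injOn
      (fun z => (z.1 ∘ e, Function.extend e z.2 z.1)) ?_ ?_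
    · rintro ⟨Φ, x⟩ h
      simpa using h
    · rintro ⟨Φ, x⟩ h ⟨Φ', x'⟩ h' heq
      simp only [Prod.mk.injEq] at heq
      obtain ⟨h1, h2⟩ := heq
      refine Prod.ext (funext fun i => ?_) (funext fun j => ?_)
      · by_cases hi : ∃ j, e j = i
        · obtain ⟨j, rfl⟩ := hi
          exact congrFun h1 j
        · have := congrFun h2 i
          rwa [Function.extend_apply' _ _ _ hi, Function.extend_apply' _ _ _ hi] at this
      · have := congrFun h2 (e j)
        rwa [he.extend_apply, he.extend_apply] at this
  exact_mod_cast this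


lemma avg_pow {V : Type*} [Fintype V] (hV : 0 < Fintype.card V) (d : V → ℝ) (hd0 : ∀ v, 0 ≤ d v)
    (M : ℕ) (δ : ℝ) (hδ : 0 ≤ δ) (h : δ * Fintype.card V ≤ ∑ v, d v) :
    δ ^ (M + 1) * Fintype.card V ≤ ∑ v, d v ^ (M + 1) := by
  have hn : (0 : ℝ) < Fintype.card V := by exact_mod_cast hV
  have e3 := pow_sum_div_card_le_sum_pow (s := (Finset.univ : Finset V))
      (f := d) (fun φ _ => hd0 φ) M
  refine le_trans ?_ e3
  rw [Finset.card_univ, le_div_iff₀ (by positivity)]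
  calc _ = (δ * Fintype.card V) ^ (M + 1) := by ring
    _ ≤ _ := by gcongr

lemma erdos_count {V : Type*} [Fintype V] [DecidableEq V] (hV : 0 < Fintype.card V)
    (s : ℕ) (hs : 0 < s) : ∀ (k : ℕ) (F : (Fin k → V) → ℝ), (∀ x, 0 ≤ F x) →
    ∀ δ : ℝ, 0 ≤ δ → δ * (Fintype.card V : ℝ) ^ k ≤ ∑ x, F x →
    δ ^ (s ^ k) * (Fintype.card V : ℝ) ^ (k * s) ≤
      ∑ φ : Fin k → Fin s → V, ∏ τ : Fin k → Fin s, F (fun i => φ i (τ i)) := by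
  intro k
  induction k with
  | zero =>
    intro F hF δ hδ h
    simp only [Finset.univ_unique, Finset.sum_singleton, Finset.prod_singleton] at h ⊢
    simp only [pow_zero, mul_one, pow_one, zero_mul] at h ⊢
    convert h using 2
  | succ k ih =>
    intro F hF δ hδ h
    set n : ℝ := (Fintype.card V : ℝ) with hn
    have hn0 : 0 < n := by rw [hn]; exact_mod_cast hV
    have hcons : ∑ x, F x = ∑ v, ∑ x : Fin k → V, F (Fin.cons v x) := by
      rw [← Fintype.sum_prod_type']
      exact (Fintype.sum_equiv (Fin.consEquiv (fun _ => V)) _ _ (fun p => rfl)).symm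
    set d : V → ℝ := fun v => (∑ x : Fin k → V, F (Fin.cons v x)) / n ^ k with hd
    have hd0 : ∀ v, 0 ≤ d v := fun v => div_nonneg (Finset.sum_nonneg fun _ _ => hF _) (by positivity)
    have hsum : δ * n ≤ ∑ v, d v := by
      rw [hd, ← Finset.sum_div, ← hcons, le_div_iff₀ (by positivity)]
      rw [pow_succ] at h; linarith
    set H : (Fin k → Fin s → V) → V → ℝ := fun φ v =>
      ∏ τ : Fin k → Fin s, F (Fin.cons v (fun i => φ i (τ i))) with hH
    have hH0 : ∀ φ v, 0 ≤ H φ v := fun φ v => Finset.prod_nonneg fun _ _ => hF _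
    have e1 : ∑ φ : Fin (k+1) → Fin s → V, ∏ τ : Fin (k+1) → Fin s, F (fun i => φ i (τ i)) =
        ∑ φ : Fin k → Fin s → V, (∑ v, H φ v) ^ s := by
      have : ∀ φ : Fin k → Fin s → V, (∑ v, H φ v) ^ s =
          ∑ g : Fin s → V, ∏ j, H φ (g j) := by
        intro φ
        have := Finset.prod_univ_sum (fun _ : Fin s => (Finset.univ : Finset V))
          (fun _ v => H φ v)
        simpa using this
      simp_rw [this]
      rw [Finset.sum_comm, ← Fintype.sum_prod_type']
      refine (Fintype.sum_equiv (Fin.consEquiv (fun _ => Fin s → V)) _ _ ?_).symm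
      rintro ⟨g, φ⟩
      simp only [hH]
      rw [← Fintype.prod_prod_type']
      refine Fintype.prod_equiv (Fin.consEquiv (fun _ => Fin s)) _ _ ?_
      rintro ⟨j, τ⟩
      congr 1
      funext i
      refine Fin.cases ?_ (fun i => ?_) i <;> simp [Fin.consEquiv]
    have e2 : ∑ φ : Fin k → Fin s → V, ∑ v, H φ v ≥ δ ^ (s ^ k) * n * n ^ (k * s) := by
      rw [Finset.sum_comm]
      have a1 : ∀ v, d v ^ (s ^ k) * n ^ (k * s) ≤ ∑ φ, H φ v := fun v =>
        ih (fun x => F (Fin.cons v x)) (fun x => hF _) (d v) (hd0 v)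
          (le_of_eq (by rw [hd]; field_simp))
      have a2 : δ ^ (s ^ k) * n ≤ ∑ v, d v ^ (s ^ k) := by
        obtain ⟨M, hM⟩ : ∃ M, s ^ k = M + 1 :=
          ⟨s ^ k - 1, by have := Nat.pow_pos (n := k) hs; omega⟩
        rw [hM]
        exact avg_pow hV d hd0 M δ hδ hsum
      calc δ ^ (s ^ k) * n * n ^ (k * s) ≤ (∑ v, d v ^ (s ^ k)) * n ^ (k * s) := by gcongr
        _ ≤ _ := by rw [Finset.sum_mul]; exact Finset.sum_le_sum fun v _ => a1 v
    rw [e1]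
    obtain ⟨t, rfl⟩ : ∃ t, s = t + 1 := ⟨s - 1, by omega⟩
    have hcard : (Fintype.card (Fin k → Fin (t + 1) → V) : ℝ) = n ^ (k * (t + 1)) := by
      simp only [Fintype.card_fun, Fintype.card_fin, hn, Nat.cast_pow]
      rw [← pow_mul, mul_comm]
    have e3 := avg_pow (by
        have : (0 : ℝ) < Fintype.card (Fin k → Fin (t + 1) → V) := by rw [hcard]; positivity
        exact_mod_cast this) (fun φ : Fin k → Fin (t + 1) → V => ∑ v, H φ v)
      (fun φ => Finset.sum_nonneg fun v _ => hH0 φ v) t (δ ^ ((t + 1) ^ k) * n) (by positivity)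
      (by rw [hcard]; exact e2)
    refine le_trans (le_of_eq ?_) e3
    rw [hcard, mul_pow, ← pow_mul, ← pow_succ]
    rw [show (k + 1) * (t + 1) = (t + 1) + k * (t + 1) by ring, pow_add]
    ring


lemma ramsey (κ : Type) [Fintype κ] [Nonempty κ] (k : ℕ) : ∀ m : ℕ, ∃ N : ℕ,
    ∀ (α : Type) [LinearOrder α] (A : Finset α), N ≤ A.card → ∀ c : Finset α → κ,
      ∃ H ⊆ A, H.card = m ∧ ∃ col, ∀ J ⊆ H, J.card = k → c J = col := by
  classical
  induction k with
  | zero =>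
    intro m
    refine ⟨m, fun α _ A hA c => ?_⟩
    obtain ⟨H, hH, hm⟩ := Finset.exists_subset_card_eq hA
    exact ⟨H, hH, hm, c ∅, fun J _ h => by rw [Finset.card_eq_zero.1 h]⟩
  | succ k ih =>
    have endhom : ∀ M : ℕ, ∃ N : ℕ, ∀ (α : Type) [LinearOrder α] (A : Finset α), N ≤ A.card →
        ∀ c : Finset α → κ, ∃ B ⊆ A, B.card = M ∧ ∃ g : α → κ, ∀ x ∈ B, ∀ J ⊆ B,
          J.card = k → (∀ y ∈ J, x < y) → c (insert x J) = g x := by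
      intro M
      induction M with
      | zero =>
        refine ⟨0, fun α _ A _ c => ⟨∅, by simp, rfl, fun _ => Classical.arbitrary κ, by simp⟩⟩
      | succ M ihM =>
        obtain ⟨N₁, hN₁⟩ := ihM
        obtain ⟨N₂, hN₂⟩ := ih N₁
        refine ⟨N₂ + 1, fun α _ A hA c => ?_⟩
        have hne : A.Nonempty := Finset.card_pos.1 (by omega)
        set x := A.min' hne with hx
        have hxA : x ∈ A := Finset.min'_mem _ _
        obtain ⟨A', hA', hcard, col, hcol⟩ := hN₂ α (A.erase x)
          (by rw [Finset.card_erase_of_mem hxA]; omega) (fun J => c (insert x J))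
        obtain ⟨B, hB, hBM, g, hg⟩ := hN₁ α A' hcard.ge c
        have hlt : ∀ y ∈ A', x < y := fun y hy => by
          have := Finset.mem_erase.1 (hA' hy)
          exact lt_of_le_of_ne (Finset.min'_le _ _ this.2) (Ne.symm this.1)
        have hxB : x ∉ B := fun h => lt_irrefl _ (hlt x (hB h))
        refine ⟨insert x B, ?_, by rw [Finset.card_insert_of_notMem hxB, hBM],
          fun y => if y = x then col else g y, ?_⟩
        · intro y hy
          rcases Finset.mem_insert.1 hy with rfl | hy
          · exact hxA
          · exact Finset.mem_of_mem_erase (hA' (hB hy))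
        · intro y hy J hJ hJk hyJ
          have hJB : J ⊆ B := by
            intro z hz
            rcases Finset.mem_insert.1 (hJ hz) with rfl | h
            · exfalso
              have h1 := hyJ _ hz
              rcases Finset.mem_insert.1 hy with rfl | h2
              · exact lt_irrefl _ h1
              · exact lt_asymm h1 (hlt _ (hB h2))
            · exact h
          rcases Finset.mem_insert.1 hy with rfl | h2
          · simp only [if_true]
            exact hcol J (hJB.trans hB) hJk
          · have : y ≠ x := fun h => hxB (h ▸ h2)
            show c (insert y J) = if y = x then col else g y
            rw [if_neg this]
            exact hg y h2 J hJB hJk hyJ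
    intro m
    obtain ⟨N, hN⟩ := endhom (Fintype.card κ * m)
    refine ⟨N, fun α _ A hA c => ?_⟩
    obtain ⟨B, hB, hBM, g, hg⟩ := hN α A hA c
    obtain ⟨col, -, hcol⟩ := Finset.exists_le_card_fiber_of_mul_le_card_of_maps_to
      (s := B) (t := (Finset.univ : Finset κ)) (f := g) (n := m) (by simp)
      Finset.univ_nonempty (by rw [hBM, Finset.card_univ])
    obtain ⟨H, hH, hm⟩ := Finset.exists_subset_card_eq hcol
    refine ⟨H, hH.trans ((Finset.filter_subset _ _).trans hB), hm, col, fun J hJ hJk => ?_⟩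
    have hne : J.Nonempty := Finset.card_pos.1 (by omega)
    have hx : J.min' hne ∈ J := Finset.min'_mem _ _
    have hxB := Finset.mem_filter.1 (hH (hJ hx))
    rw [← Finset.insert_erase hx, ← hxB.2]
    refine hg _ hxB.1 _ ?_ ?_ ?_
    · exact (Finset.erase_subset _ _).trans (hJ.trans (hH.trans (Finset.filter_subset _ _)))
    · rw [Finset.card_erase_of_mem hx]; omega
    · intro y hy
      have := Finset.mem_erase.1 hy
      exact lt_of_le_of_ne (Finset.min'_le _ _ this.2) (Ne.symm this.1)


/-- the set R(S,C) -/
def RR {V : Type*} [DecidableEq V] {r m : ℕ} (a b : Fin r → V) (S : Finset (Fin r))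
    (C : Fin m → V) : Finset V :=
  univ.image (S.piecewise b a) ∪ univ.image C

lemma fiber_sum {V : Type*} [Fintype V] [DecidableEq V] {r m k : ℕ} (hk : r + m = k)
    (a b : Fin r → V) (hab : Function.Injective (Sum.elim a b)) (g : Finset V → ℝ) :
    ∑ S : Finset (Fin r), ∑ C : Fin m → V with Function.Injective (Sum.elim (Sum.elim a b) C),
      g (RR a b S C) =
    (m.factorial : ℝ) * ∑ R ∈ (Finset.univ.powersetCard k).filter
      (fun R => ∀ i, (R ∩ {a i, b i}).card = 1), g R := by
  have ha : Function.Injective a := hab.comp Sum.inl_injective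
  have hb : Function.Injective b := hab.comp Sum.inr_injective
  have hne : ∀ i j, a i ≠ b j := fun i j h => by
    have := @hab (Sum.inl i) (Sum.inr j) h
    simp at this
  have hpw : ∀ S : Finset (Fin r), Function.Injective (S.piecewise b a) := by
    intro S i j hij
    by_cases hi : i ∈ S <;> by_cases hj : j ∈ S <;> simp [hi, hj] at hij
    · exact hb hij
    · exact absurd hij.symm (hne _ _)
    · exact absurd hij (hne _ _)
    · exact ha hij
  have hCi : ∀ C : Fin m → V, Function.Injective (Sum.elim (Sum.elim a b) C) ↔
      Function.Injective C ∧ (∀ i j, C i ≠ a j) ∧ (∀ i j, C i ≠ b j) := by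
    intro C
    rw [Sum.elim_injective]
    constructor
    · rintro ⟨-, h1, h2⟩
      exact ⟨h1, fun i j h => h2 (Sum.inl j) i h.symm, fun i j h => h2 (Sum.inr j) i h.symm⟩
    · rintro ⟨h1, h2, h3⟩
      refine ⟨hab, h1, ?_⟩
      rintro (j | j) i h
      · exact h2 i j h.symm
      · exact h3 i j h.symm
  have hma : ∀ S (C : Fin m → V), Function.Injective (Sum.elim (Sum.elim a b) C) →
      ∀ i, (a i ∈ RR a b S C ↔ i ∉ S) := by
    intro S C hC i
    rw [hCi] at hC
    simp only [RR, mem_union, mem_image, mem_univ, true_and]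
    constructor
    · rintro (⟨j, hj⟩ | ⟨j, hj⟩)
      · intro hi
        by_cases hjS : j ∈ S
        · simp [hjS] at hj; exact hne _ _ hj.symm
        · simp [hjS] at hj; exact hjS (ha hj ▸ hi)
      · exact absurd hj (hC.2.1 _ _)
    · intro hi
      exact Or.inl ⟨i, by simp [hi]⟩
  have hmb : ∀ S (C : Fin m → V), Function.Injective (Sum.elim (Sum.elim a b) C) →
      ∀ i, (b i ∈ RR a b S C ↔ i ∈ S) := by
    intro S C hC i
    rw [hCi] at hC
    simp only [RR, mem_union, mem_image, mem_univ, true_and]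
    constructor
    · rintro (⟨j, hj⟩ | ⟨j, hj⟩)
      · by_cases hjS : j ∈ S
        · simp [hjS] at hj; exact hb hj ▸ hjS
        · simp [hjS] at hj; exact absurd hj (hne _ _)
      · exact absurd hj (hC.2.2 _ _)
    · intro hi
      exact Or.inl ⟨i, by simp [hi]⟩
  have hR : ∀ R : Finset V, ∀ i, (R ∩ {a i, b i}).card = 1 ↔ (a i ∈ R ↔ b i ∉ R) := by
    intro R i
    by_cases h1 : a i ∈ R <;> by_cases h2 : b i ∈ R
    · rw [Finset.inter_eq_right.2 (by intro z; simp; rintro (rfl | rfl) <;> assumption)]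
      simp [h1, h2, Finset.card_pair (hne i i)]
    · simp [h1, h2, Finset.inter_insert_of_mem, Finset.inter_singleton_of_notMem]
    · simp [h1, h2, Finset.inter_insert_of_notMem, Finset.inter_singleton_of_mem]
    · simp [h1, h2, Finset.inter_insert_of_notMem, Finset.inter_singleton_of_notMem]
  set X : Finset (Finset (Fin r) × (Fin m → V)) :=
    univ ×ˢ (univ.filter fun C => Function.Injective (Sum.elim (Sum.elim a b) C)) with hX
  set Y := (Finset.univ.powersetCard k).filter
      (fun R : Finset V => ∀ i, (R ∩ {a i, b i}).card = 1) with hY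
  have hmaps : ∀ z ∈ X, RR a b z.1 z.2 ∈ Y := by
    rintro ⟨S, C⟩ hz
    have hC : Function.Injective (Sum.elim (Sum.elim a b) C) := by simpa [hX] using hz
    rw [hY, mem_filter, mem_powersetCard]
    refine ⟨⟨subset_univ _, ?_⟩, ?_⟩
    · have hC' := (hCi C).1 hC
      simp only [RR]
      rw [card_union_of_disjoint, card_image_of_injective _ (hpw S),
        card_image_of_injective _ hC'.1]
      · simpa using hk
      · rw [Finset.disjoint_left]
        rintro v h1 h2
        obtain ⟨i, -, rfl⟩ := mem_image.1 h1
        obtain ⟨j, -, hj⟩ := mem_image.1 h2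
        by_cases hi : i ∈ S
        · simp [hi] at hj; exact hC'.2.2 _ _ hj
        · simp [hi] at hj; exact hC'.2.1 _ _ hj
    · intro i
      rw [hR, hma S C hC, hmb S C hC]
  have hfib : ∀ R ∈ Y, #{z ∈ X | RR a b z.1 z.2 = R} = m.factorial := by
    intro R hRY
    rw [hY, mem_filter, mem_powersetCard] at hRY
    obtain ⟨⟨-, hRk⟩, hRi⟩ := hRY
    simp only [hR] at hRi
    set S₀ : Finset (Fin r) := univ.filter fun i => b i ∈ R with hS₀
    set base := univ.image (S₀.piecewise b a) with hbase
    have hbR : base ⊆ R := by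
      intro v hv
      obtain ⟨i, -, rfl⟩ := mem_image.1 hv
      by_cases hi : i ∈ S₀
      · simp only [hi, piecewise_eq_of_mem]; simpa [hS₀] using hi
      · simp only [hi, not_false_eq_true, piecewise_eq_of_notMem]
        exact (hRi i).2 (by simpa [hS₀] using hi)
    have hcard : (R \ base).card = m := by
      rw [card_sdiff_of_subset hbR, hRk, hbase, card_image_of_injective _ (hpw _)]
      simp; omega
    have hcE : Fintype.card (Fin m ↪ (R \ base : Finset V)) = m.factorial := by
      rw [Fintype.card_embedding_eq, Fintype.card_coe, hcard, Fintype.card_fin,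
        Nat.descFactorial_self]
    rw [← hcE, ← Finset.card_univ]
    symm
    refine Finset.card_bij (fun (C : Fin m ↪ (R \ base : Finset V)) _ =>
      (S₀, fun i => ((C i : (R \ base : Finset V)) : V))) ?_ ?_ ?_
    · intro C _
      have hCm : ∀ i, ((C i : (R \ base : Finset V)) : V) ∈ R ∧
        ((C i : (R \ base : Finset V)) : V) ∉ base := fun i => by
          have := (C i).2; rwa [mem_sdiff] at this
      have hinj : Function.Injective (fun i => ((C i : (R \ base : Finset V)) : V)) :=
        Subtype.val_injective.comp C.injective
      rw [mem_filter]
      refine ⟨?_, ?_⟩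
      · simp only [hX, mem_product, mem_univ, true_and, mem_filter]
        rw [hCi]
        refine ⟨hinj, ?_, ?_⟩
        · intro i j h
          have h1 := hCm i
          rw [h] at h1
          have : j ∉ S₀ := by simpa [hS₀] using (hRi j).1 h1.1
          exact h1.2 (mem_image.2 ⟨j, mem_univ _, by simp [this]⟩)
        · intro i j h
          have h1 := hCm i
          rw [h] at h1
          have : j ∈ S₀ := by simpa [hS₀] using h1.1
          exact h1.2 (mem_image.2 ⟨j, mem_univ _, by simp [this]⟩)
      · have hsub : univ.image (fun i => ((C i : (R \ base : Finset V)) : V)) ⊆ R \ base := by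
          intro v hv
          obtain ⟨i, -, rfl⟩ := mem_image.1 hv
          exact (C i).2
        have heq := Finset.eq_of_subset_of_card_le hsub (by
          rw [hcard, card_image_of_injective _ hinj]; simp)
        simp only [RR]
        rw [heq, ← hbase, union_sdiff_of_subset hbR]
    · intro C _ C' _ h
      ext i
      have := congrFun (Prod.ext_iff.1 h).2 i
      exact this
    · rintro ⟨S, C⟩ hz
      rw [mem_filter] at hz
      have hC : Function.Injective (Sum.elim (Sum.elim a b) C) := by simpa [hX] using hz.1
      have hRR : RR a b S C = R := hz.2
      have hS : S = S₀ := by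
        ext i
        rw [← hmb S C hC i, hRR, hS₀]; simp
      have hC' := (hCi C).1 hC
      have hmem : ∀ i, C i ∈ R \ base := by
        intro i
        rw [mem_sdiff]
        refine ⟨by rw [← hRR]; simp [RR], ?_⟩
        intro h
        obtain ⟨j, -, hj⟩ := mem_image.1 h
        by_cases hi : j ∈ S₀
        · simp [hi] at hj; exact hC'.2.2 _ _ hj.symm
        · simp [hi] at hj; exact hC'.2.1 _ _ hj.symm
      refine ⟨⟨fun i => ⟨C i, hmem i⟩, fun i j h => hC'.1 (by simpa using h)⟩, mem_univ _, ?_⟩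
      simp only [hS]
      rfl
  rw [← Finset.sum_product (s := univ)
    (t := univ.filter fun C => Function.Injective (Sum.elim (Sum.elim a b) C))
    (f := fun z => g (RR a b z.1 z.2)), ← hX, ← Finset.sum_fiberwise_of_maps_to hmaps,
    Finset.mul_sum]
  refine Finset.sum_congr rfl fun R hRY => ?_
  rw [Finset.sum_congr rfl (g := fun _ => g R) (fun z hz => by rw [(mem_filter.1 hz).2]),
    Finset.sum_const, hfib R hRY, nsmul_eq_mul]

lemma sign_card {V : Type*} [Fintype V] [DecidableEq V] {r m : ℕ}
    (a b : Fin r → V) (C : Fin m → V) (S : Finset (Fin r))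
    (hC : Function.Injective (Sum.elim (Sum.elim a b) C)) :
    (RR a b S C ∩ univ.image b).card = S.card := by
  have hab : Function.Injective (Sum.elim a b) := hC.comp Sum.inl_injective
  have hb : Function.Injective b := hab.comp Sum.inr_injective
  rw [← card_image_of_injective S hb]
  congr 1
  ext v
  simp only [RR, mem_inter, mem_union, mem_image, mem_univ, true_and]
  constructor
  · rintro ⟨h, j, rfl⟩
    refine ⟨j, ?_, rfl⟩
    rcases h with ⟨i, hi⟩ | ⟨i, hi⟩
    · by_cases hiS : i ∈ S
      · simp [hiS] at hi; exact hb hi ▸ hiS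
      · simp [hiS] at hi
        have := @hab (Sum.inl i) (Sum.inr j) hi
        simp at this
    · have := @hC (Sum.inr i) (Sum.inl (Sum.inr j)) hi
      simp at this
  · rintro ⟨j, hj, rfl⟩
    exact ⟨Or.inl ⟨j, by simp [hj]⟩, j, rfl⟩


/-- symmetric function on tuples -/
def Fim {V : Type*} [DecidableEq V] (k : ℕ) (f : Finset V → ℝ) : (Fin k → V) → ℝ :=
  fun x => f (univ.image x)

/-- the set of coordinates corresponding to the left summand -/
def TT {r m k : ℕ} (e : Fin r ⊕ Fin m ≃ Fin k) : Finset (Fin k) :=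
  univ.map (Function.Embedding.inl.trans e.toEmbedding)

lemma mem_TT_inl {r m k : ℕ} (e : Fin r ⊕ Fin m ≃ Fin k) (i : Fin r) :
    e (Sum.inl i) ∈ TT e := by
  simp [TT]

lemma mem_TT_inr {r m k : ℕ} (e : Fin r ⊕ Fin m ≃ Fin k) (i : Fin m) :
    e (Sum.inr i) ∉ TT e := by
  simp [TT]

lemma exists_TT {k : ℕ} (T : Finset (Fin k)) :
    ∃ e : Fin T.card ⊕ Fin (k - T.card) ≃ Fin k, TT e = T := by
  classical
  have h1 : Fintype.card {x // x ∈ T} = T.card := Fintype.card_coe T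
  have h2 : Fintype.card {x // ¬ x ∈ T} = k - T.card := by
    rw [Fintype.card_subtype_compl, h1, Fintype.card_fin]
  let e1 := (Fintype.equivFinOfCardEq h1).symm
  let e2 := (Fintype.equivFinOfCardEq h2).symm
  refine ⟨(Equiv.sumCongr e1 e2).trans (Equiv.sumCompl (fun x => x ∈ T)), ?_⟩
  ext x
  simp only [TT, mem_map, mem_univ, true_and]
  constructor
  · rintro ⟨i, rfl⟩
    simp
  · intro hx
    exact ⟨e1.symm ⟨x, hx⟩, by simp⟩

lemma DD_eq {V : Type*} [DecidableEq V] {r m k : ℕ} (e : Fin r ⊕ Fin m ≃ Fin k)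
    (f : Finset V → ℝ) (a b : Fin r → V) (C C' : Fin m → V) :
    DD (Fim k f) (TT e) (Sum.elim a C ∘ e.symm) (Sum.elim b C' ∘ e.symm) =
      ∑ S : Finset (Fin r), (-1 : ℝ) ^ S.card * f (RR a b S C) := by
  unfold DD
  symm
  refine Finset.sum_bij (fun S _ => S.map (Function.Embedding.inl.trans e.toEmbedding)) ?_ ?_ ?_ ?_
  · intro S _
    rw [mem_powerset, TT]
    exact Finset.map_subset_map.2 (subset_univ _)
  · intro S _ S' _ h
    exact Finset.map_injective _ h
  · intro S hS
    rw [mem_powerset, TT, Finset.subset_map_iff] at hS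
    obtain ⟨u, -, rfl⟩ := hS
    exact ⟨u, mem_univ _, rfl⟩
  · intro S _
    rw [card_map]
    congr 1
    unfold Fim
    congr 1
    ext v
    simp only [RR, mem_union, mem_image, mem_univ, true_and]
    constructor
    · rintro (⟨i, rfl⟩ | ⟨i, rfl⟩)
      · refine ⟨e (Sum.inl i), ?_⟩
        by_cases hi : i ∈ S <;> simp [Finset.piecewise, hi]
      · refine ⟨e (Sum.inr i), ?_⟩
        simp [Finset.piecewise]
    · rintro ⟨j, rfl⟩
      obtain ⟨j, rfl⟩ := e.surjective j
      rcases j with i | i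
      · left
        refine ⟨i, ?_⟩
        by_cases hi : i ∈ S <;> simp [Finset.piecewise, hi]
      · right
        refine ⟨i, ?_⟩
        simp [Finset.piecewise]

lemma sum_good {V : Type*} [Fintype V] [DecidableEq V] {r m k : ℕ} (hk : r + m = k)
    (f : Finset V → ℝ) (a b : Fin r → V) (hab : Function.Injective (Sum.elim a b)) :
    ∑ C : Fin m → V with Function.Injective (Sum.elim (Sum.elim a b) C),
      ∑ S : Finset (Fin r), (-1 : ℝ) ^ S.card * f (RR a b S C) =
    (m.factorial : ℝ) * ∑ R ∈ (Finset.univ.powersetCard k).filter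
      (fun R => ∀ i, (R ∩ {a i, b i}).card = 1),
        (-1 : ℝ) ^ (R ∩ Finset.image b Finset.univ).card * f R := by
  rw [← fiber_sum hk a b hab
    (fun R => (-1 : ℝ) ^ (R ∩ Finset.image b Finset.univ).card * f R), Finset.sum_comm]
  refine Finset.sum_congr rfl fun S _ => Finset.sum_congr rfl fun C hC => ?_
  rw [sign_card a b C S (mem_filter.1 hC).2]

lemma sum_good_avg {V : Type*} [Fintype V] [DecidableEq V] {r m k : ℕ} (hk : r + m = k)
    (f : Finset V → ℝ) (a b : Fin r → V) (hab : Function.Injective (Sum.elim a b)) :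
    ∑ C : Fin m → V with Function.Injective (Sum.elim (Sum.elim a b) C),
      ∑ S : Finset (Fin r), (-1 : ℝ) ^ S.card * f (RR a b S C) =
    2 ^ r * (#{C : Fin m → V | Function.Injective (Sum.elim (Sum.elim a b) C)} : ℝ) *
      signedAvg k f a b := by
  rw [sum_good hk f a b hab]
  have h1 := fiber_sum (m := m) hk a b hab (fun _ => 1)
  simp only [Finset.sum_const, nsmul_eq_mul, mul_one, Finset.card_univ, Fintype.card_finset,
    Fintype.card_fin] at h1
  push_cast at h1
  rw [h1, signedAvg]
  by_cases h0 : (#((Finset.univ.powersetCard k).filter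
      (fun R : Finset V => ∀ i, (R ∩ {a i, b i}).card = 1)) : ℝ) = 0
  · have : ((Finset.univ.powersetCard k).filter
      (fun R : Finset V => ∀ i, (R ∩ {a i, b i}).card = 1)) = ∅ := by
      exact Finset.card_eq_zero.1 (by exact_mod_cast h0)
    rw [this]; simp
  · field_simp

lemma Wpow_sq {V : Type*} [Fintype V] [DecidableEq V] (k r : ℕ) (f : Finset V → ℝ) :
    ∑ p ∈ (Finset.univ : Finset ((Fin r → V) × (Fin r → V))).filter
        (fun p => Function.Injective (Sum.elim p.1 p.2)), (signedAvg k f p.1 p.2) ^ 2 ≤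
      (Fintype.card V : ℝ) ^ (2 * r) * Wpow k r f ^ 2 := by
  unfold Wpow
  set P := (Finset.univ : Finset ((Fin r → V) × (Fin r → V))).filter
        (fun p => Function.Injective (Sum.elim p.1 p.2)) with hP
  have h0 : 0 ≤ ∑ p ∈ P, (signedAvg k f p.1 p.2) ^ 2 := Finset.sum_nonneg fun _ _ => sq_nonneg _
  rw [Real.sq_sqrt (div_nonneg h0 (by positivity))]
  have hc : (P.card : ℝ) ≤ (Fintype.card V : ℝ) ^ (2 * r) := by
    have := Finset.card_le_univ P
    rw [Fintype.card_prod, Fintype.card_fun, Fintype.card_fin, ← pow_add, ← two_mul] at this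
    exact_mod_cast this
  rcases Finset.eq_empty_or_nonempty P with h | h
  · rw [h]; simp
  · have hpos : (0 : ℝ) < P.card := by exact_mod_cast Finset.card_pos.2 h
    calc _ = (P.card : ℝ) * ((∑ p ∈ P, (signedAvg k f p.1 p.2) ^ 2) / P.card) := by field_simp
      _ ≤ _ := by gcongr

lemma cross_bound {V : Type*} [Fintype V] [DecidableEq V] {r m k : ℕ}
    (e : Fin r ⊕ Fin m ≃ Fin k) (f : Finset V → ℝ) (hf : ∀ S, |f S| ≤ 1) :
    ∑ p : (Fin k → V) × (Fin k → V),
      DD (Fim k f) (TT e) p.1 p.2 * DD (Fim k f) (TT e) ((TT e)ᶜ.piecewise p.2 p.1) p.2 ≤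
    4 ^ r * (Fintype.card V : ℝ) ^ (2 * k) * Wpow k r f ^ 2 +
    2 * 4 ^ r * (#{p : (Fin k → V) × (Fin k → V) | ¬ Function.Injective (Sum.elim p.1 p.2)} : ℝ) := by
  have hk : r + m = k := by simpa using Fintype.card_congr e
  set n : ℝ := (Fintype.card V : ℝ) with hn
  set E : (Fin r → V) → (Fin r → V) → (Fin m → V) → ℝ := fun a b C =>
    ∑ S : Finset (Fin r), (-1 : ℝ) ^ S.card * f (RR a b S C) with hE
  have hEb : ∀ a b C, |E a b C| ≤ 2 ^ r := by
    intro a b C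
    have := DD_bound (Fim k f) (fun x => hf _) (TT e) (Sum.elim a C ∘ e.symm)
      (Sum.elim b C ∘ e.symm)
    rw [DD_eq] at this
    simpa [TT] using this
  set g : (Fin r → V) → (Fin r → V) → (Fin m → V) → ℝ := fun a b C =>
    if Function.Injective (Sum.elim (Sum.elim a b) C) then E a b C else 0 with hg
  have hgb : ∀ a b C, |g a b C| ≤ 2 ^ r := by
    intro a b C
    simp only [hg]
    split_ifs
    · exact hEb a b C
    · simp
  let eq1 : ((Fin r → V) × (Fin r → V)) × ((Fin m → V) × (Fin m → V)) ≃
      (Fin k → V) × (Fin k → V) :=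
    { toFun := fun z => (Sum.elim z.1.1 z.2.1 ∘ e.symm, Sum.elim z.1.2 z.2.2 ∘ e.symm)
      invFun := fun p => ((fun i => p.1 (e (Sum.inl i)), fun i => p.2 (e (Sum.inl i))),
        (fun i => p.1 (e (Sum.inr i)), fun i => p.2 (e (Sum.inr i))))
      left_inv := by
        rintro ⟨⟨a, b⟩, C, C'⟩; simp
      right_inv := by
        rintro ⟨x, y⟩
        ext j
        · obtain ⟨j, rfl⟩ := e.surjective j
          rcases j with j | j <;> simp
        · obtain ⟨j, rfl⟩ := e.surjective j
          rcases j with j | j <;> simp }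
  have key : ∀ z, DD (Fim k f) (TT e) (eq1 z).1 (eq1 z).2 *
      DD (Fim k f) (TT e) ((TT e)ᶜ.piecewise (eq1 z).2 (eq1 z).1) (eq1 z).2 ≤
      g z.1.1 z.1.2 z.2.1 * g z.1.1 z.1.2 z.2.2 +
      2 * 4 ^ r * (if ¬ Function.Injective (Sum.elim (eq1 z).1 (eq1 z).2) then 1 else 0) := by
    rintro ⟨⟨a, b⟩, C, C'⟩
    have e1 : (TT e)ᶜ.piecewise (Sum.elim b C' ∘ e.symm) (Sum.elim a C ∘ e.symm) =
        Sum.elim a C' ∘ e.symm := by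
      funext j
      obtain ⟨j, rfl⟩ := e.surjective j
      rcases j with j | j
      · simp [mem_TT_inl]
      · simp [mem_TT_inr]
    show DD (Fim k f) (TT e) (Sum.elim a C ∘ e.symm) (Sum.elim b C' ∘ e.symm) *
      DD (Fim k f) (TT e) ((TT e)ᶜ.piecewise (Sum.elim b C' ∘ e.symm) (Sum.elim a C ∘ e.symm))
        (Sum.elim b C' ∘ e.symm) ≤ g a b C * g a b C' + 2 * 4 ^ r *
        (if ¬ Function.Injective (Sum.elim (Sum.elim a C ∘ e.symm) (Sum.elim b C' ∘ e.symm))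
          then 1 else 0)
    rw [e1, DD_eq, DD_eq]
    change E a b C * E a b C' ≤ _
    by_cases hinj : Function.Injective (Sum.elim (Sum.elim a C ∘ e.symm) (Sum.elim b C' ∘ e.symm))
    · have h1 : Function.Injective (Sum.elim (Sum.elim a b) C) := by
        have : Sum.elim (Sum.elim a b) C =
          Sum.elim (Sum.elim a C ∘ e.symm) (Sum.elim b C' ∘ e.symm) ∘
          (Sum.elim (Sum.elim (fun i => Sum.inl (e (Sum.inl i))) (fun i => Sum.inr (e (Sum.inl i))))
            (fun i => Sum.inl (e (Sum.inr i)))) := by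
          funext j
          rcases j with (j | j) | j <;> simp
        rw [this]
        refine hinj.comp ?_
        rintro ((i | i) | i) ((j | j) | j) h <;> simpa using h
      have h2 : Function.Injective (Sum.elim (Sum.elim a b) C') := by
        have : Sum.elim (Sum.elim a b) C' =
          Sum.elim (Sum.elim a C ∘ e.symm) (Sum.elim b C' ∘ e.symm) ∘
          (Sum.elim (Sum.elim (fun i => Sum.inl (e (Sum.inl i))) (fun i => Sum.inr (e (Sum.inl i))))
            (fun i => Sum.inr (e (Sum.inr i)))) := by
          funext j
          rcases j with (j | j) | j <;> simp
        rw [this]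
        refine hinj.comp ?_
        rintro ((i | i) | i) ((j | j) | j) h <;> simpa using h
      simp only [hg, h1, h2, hinj]
      simp
    · rw [if_pos hinj]
      have b1 := abs_le.1 (show |E a b C * E a b C'| ≤ 4 ^ r by
        rw [abs_mul, show (4 : ℝ) ^ r = 2 ^ r * 2 ^ r by rw [← mul_pow]; norm_num]
        exact mul_le_mul (hEb _ _ _) (hEb _ _ _) (abs_nonneg _) (by positivity))
      have b2 := abs_le.1 (show |g a b C * g a b C'| ≤ 4 ^ r by
        rw [abs_mul, show (4 : ℝ) ^ r = 2 ^ r * 2 ^ r by rw [← mul_pow]; norm_num]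
        exact mul_le_mul (hgb _ _ _) (hgb _ _ _) (abs_nonneg _) (by positivity))
      linarith [b1.2, b2.1]
  rw [← Equiv.sum_comp eq1]
  refine (Finset.sum_le_sum fun z _ => key z).trans ?_
  rw [Finset.sum_add_distrib, ← Finset.mul_sum,
    Equiv.sum_comp eq1 (fun p => if ¬ Function.Injective (Sum.elim p.1 p.2) then (1 : ℝ) else 0),
    Finset.sum_boole]
  refine add_le_add ?_ le_rfl
  rw [Fintype.sum_prod_type]
  have hsq : ∀ q : (Fin r → V) × (Fin r → V),
      ∑ w : (Fin m → V) × (Fin m → V), g q.1 q.2 w.1 * g q.1 q.2 w.2 =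
      (∑ C, g q.1 q.2 C) ^ 2 := by
    intro q
    rw [Fintype.sum_prod_type, sq, Finset.sum_mul_sum]
  have hle : ∀ q : (Fin r → V) × (Fin r → V), (∑ C, g q.1 q.2 C) ^ 2 ≤
      if Function.Injective (Sum.elim q.1 q.2) then
        4 ^ r * n ^ (2 * m) * signedAvg k f q.1 q.2 ^ 2 else 0 := by
    rintro ⟨a, b⟩
    dsimp only
    split_ifs with hab
    · have : ∑ C, g a b C = 2 ^ r *
        (#{C : Fin m → V | Function.Injective (Sum.elim (Sum.elim a b) C)} : ℝ) *
        signedAvg k f a b := by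
        rw [← sum_good_avg hk f a b hab, Finset.sum_filter]
      rw [this, mul_pow, mul_pow]
      have hc : (#{C : Fin m → V | Function.Injective (Sum.elim (Sum.elim a b) C)} : ℝ) ≤
          n ^ m := by
        have := Finset.card_le_univ
          ({C : Fin m → V | Function.Injective (Sum.elim (Sum.elim a b) C)} : Finset (Fin m → V))
        rw [Fintype.card_fun, Fintype.card_fin] at this
        rw [hn]; exact_mod_cast this
      rw [← pow_mul, mul_comm r 2, pow_mul, mul_comm 2 m, pow_mul]
      rw [show (2 : ℝ) ^ 2 = 4 by norm_num]
      gcongr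
    · have : ∀ C, g a b C = 0 := fun C => by
        simp only [hg]
        rw [if_neg]
        intro h
        exact hab (h.comp Sum.inl_injective)
      simp [this]
  calc _ = ∑ q : (Fin r → V) × (Fin r → V), (∑ C, g q.1 q.2 C) ^ 2 :=
        Finset.sum_congr rfl fun q _ => hsq q
    _ ≤ _ := Finset.sum_le_sum fun q _ => hle q
    _ = 4 ^ r * n ^ (2 * m) * ∑ p ∈ (Finset.univ : Finset ((Fin r → V) × (Fin r → V))).filter
        (fun p => Function.Injective (Sum.elim p.1 p.2)), (signedAvg k f p.1 p.2) ^ 2 := by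
        rw [← Finset.sum_filter, Finset.mul_sum]
    _ ≤ 4 ^ r * n ^ (2 * m) * (n ^ (2 * r) * Wpow k r f ^ 2) := by
        gcongr
        exact Wpow_sq k r f
    _ = _ := by
        rw [← hk]; ring


lemma hyperInd_cases {V : Type*} [DecidableEq V] (G : Finset (Finset V)) (S : Finset V) :
    hyperInd G S = 0 ∨ hyperInd G S = 1 := by
  unfold hyperInd
  split_ifs <;> simp

lemma hyperInd_abs {V : Type*} [DecidableEq V] (G : Finset (Finset V)) (S : Finset V) :
    |hyperInd G S| ≤ 1 := by
  rcases hyperInd_cases G S with h | h <;> simp [h]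

lemma noninj_pairs {V : Type*} [Fintype V] [DecidableEq V] (k : ℕ) :
    (#{p : (Fin k → V) × (Fin k → V) | ¬ Function.Injective (Sum.elim p.1 p.2)} : ℝ) *
      Fintype.card V ≤ (2 * k : ℝ) ^ 2 * (Fintype.card V : ℝ) ^ (2 * k) := by
  have h := card_noninj (V := V) (I := Fin k ⊕ Fin k)
  have hc : #{p : (Fin k → V) × (Fin k → V) | ¬ Function.Injective (Sum.elim p.1 p.2)} =
      #{Φ : Fin k ⊕ Fin k → V | ¬ Function.Injective Φ} := by
    refine Finset.card_bij (fun p _ => Sum.elim p.1 p.2) ?_ ?_ ?_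
    · intro p hp
      rw [mem_filter] at hp ⊢
      exact ⟨mem_univ _, hp.2⟩
    · rintro ⟨a, b⟩ _ ⟨c, d⟩ _ h
      refine Prod.ext (funext fun i => congrFun h (Sum.inl i)) (funext fun i => congrFun h (Sum.inr i))
    · intro Φ hΦ
      rw [mem_filter] at hΦ
      refine ⟨(Φ ∘ Sum.inl, Φ ∘ Sum.inr), ?_, ?_⟩
      · rw [mem_filter]
        exact ⟨mem_univ _, by simpa [Sum.elim_comp_inl_inr] using hΦ.2⟩
      · simp
  rw [hc]
  refine h.trans (le_of_eq ?_)
  simp [two_mul]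

lemma step_bound {V : Type*} [Fintype V] [DecidableEq V] (k : ℕ) (f : Finset V → ℝ)
    (hf : ∀ S, |f S| ≤ 1) (T : Finset (Fin k)) (θ ε : ℝ) (hθ : 0 ≤ θ)
    (hV : 0 < Fintype.card V)
    (h : ∀ j ∉ T, ∑ p : (Fin k → V) × (Fin k → V), DD (Fim k f) (insert j T) p.1 p.2 ^ 2 ≤ θ)
    (hW : Wpow k T.card f ≤ ε) :
    ∑ p : (Fin k → V) × (Fin k → V), DD (Fim k f) T p.1 p.2 ^ 2 ≤
      4 ^ k * θ + 4 ^ k * (Fintype.card V : ℝ) ^ (2 * k) * ε ^ 2 +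
      2 * 4 ^ k * ((2 * k : ℝ) ^ 2 * (Fintype.card V : ℝ) ^ (2 * k) / Fintype.card V) := by
  have h1 := sq_le_cross (Fim k f) T θ hθ h
  obtain ⟨e, he⟩ := exists_TT T
  have h2 := cross_bound e f hf
  rw [he] at h2
  have hn : (0 : ℝ) < Fintype.card V := by exact_mod_cast hV
  have h3 := (le_div_iff₀ hn).2 (noninj_pairs (V := V) k)
  have hTk : T.card ≤ k := by simpa using Finset.card_le_univ T
  have h4 : (4 : ℝ) ^ T.card ≤ 4 ^ k := pow_le_pow_right₀ (by norm_num) hTk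
  have hW0 : 0 ≤ Wpow k T.card f := Real.sqrt_nonneg _
  rw [Fintype.card_fin] at h1
  refine h1.trans ?_
  rw [add_assoc]
  refine add_le_add le_rfl (h2.trans ?_)
  gcongr

lemma partA (k ℓ : ℕ) : ∀ d : ℕ, ∀ η : ℝ, 0 < η → ∃ ε : ℝ, 0 < ε ∧ ∃ n₀ : ℕ, ∀ n : ℕ, n₀ ≤ n →
    ∀ G : Finset (Finset (Fin n)),
      (∀ r, ℓ ≤ r → r ≤ k → Wpow k r (hyperInd G) < ε) →
      ∀ T : Finset (Fin k), T.card + d = k → ℓ ≤ T.card →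
        ∑ p : (Fin k → Fin n) × (Fin k → Fin n),
          DD (Fim k (hyperInd G)) T p.1 p.2 ^ 2 ≤ η * (n : ℝ) ^ (2 * k) := by
  intro d
  induction d with
  | zero =>
    intro η hη
    refine ⟨min 1 (η / (3 * 4 ^ k)), by positivity, ⌈2 * 4 ^ k * (2 * k : ℝ) ^ 2 * 3 / η⌉₊ + 1, ?_⟩
    intro n hn G hW T hT hℓ
    have hn0 : 0 < n := by omega
    have hnR : (0 : ℝ) < n := by exact_mod_cast hn0
    have hnη : 2 * 4 ^ k * (2 * k : ℝ) ^ 2 * 3 / η ≤ n :=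
      (Nat.le_ceil _).trans (Nat.cast_le.2 (by omega))
    have hTu : T = univ := by
      rw [← Finset.card_eq_iff_eq_univ, Fintype.card_fin]; omega
    have := step_bound k (hyperInd G) (hyperInd_abs G) T 0 (min 1 (η / (3 * 4 ^ k))) le_rfl
      (by simpa using hn0) (by intro j hj; simp [hTu] at hj)
      (hW _ hℓ (by omega)).le
    rw [Fintype.card_fin] at this
    refine this.trans ?_
    set ε := min 1 (η / (3 * 4 ^ k)) with hε
    have h1 : ε ^ 2 ≤ η / (3 * 4 ^ k) := by
      have a0 : 0 < ε := by positivity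
      have a1 : ε ≤ 1 := min_le_left _ _
      have a2 : ε ≤ η / (3 * 4 ^ k) := min_le_right _ _
      nlinarith
    have h2 : 4 ^ k * (n : ℝ) ^ (2 * k) * ε ^ 2 ≤ η / 3 * (n : ℝ) ^ (2 * k) := by
      calc _ ≤ 4 ^ k * (n : ℝ) ^ (2 * k) * (η / (3 * 4 ^ k)) := by gcongr
        _ = _ := by field_simp
    have h3 : 2 * 4 ^ k * ((2 * k : ℝ) ^ 2 * (n : ℝ) ^ (2 * k) / n) ≤ η / 3 * (n : ℝ) ^ (2 * k) := by
      have : 2 * 4 ^ k * (2 * k : ℝ) ^ 2 / n ≤ η / 3 := by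
        rw [div_le_iff₀ hη] at hnη
        rw [div_le_iff₀ hnR]; linarith
      calc _ = 2 * 4 ^ k * (2 * k : ℝ) ^ 2 / n * (n : ℝ) ^ (2 * k) := by ring
        _ ≤ _ := by gcongr
    have h4 : 0 ≤ η * (n : ℝ) ^ (2 * k) := by positivity
    linarith
  | succ d ih =>
    intro η hη
    obtain ⟨ε', hε', n₁, hn₁⟩ := ih (η / (3 * 4 ^ k)) (by positivity)
    refine ⟨min ε' (min 1 (η / (3 * 4 ^ k))), by positivity,
      max n₁ (⌈2 * 4 ^ k * (2 * k : ℝ) ^ 2 * 3 / η⌉₊ + 1), ?_⟩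
    intro n hn G hW T hT hℓ
    have hn1 := le_of_max_le_left hn
    have hn2 := le_of_max_le_right hn
    have hn0 : 0 < n := by omega
    have hnR : (0 : ℝ) < n := by exact_mod_cast hn0
    have hnη : 2 * 4 ^ k * (2 * k : ℝ) ^ 2 * 3 / η ≤ n :=
      (Nat.le_ceil _).trans (Nat.cast_le.2 (by omega))
    set ε := min ε' (min 1 (η / (3 * 4 ^ k))) with hε
    have hIH := hn₁ n hn1 G (fun r h1 h2 => (hW r h1 h2).trans_le (min_le_left _ _))
    have := step_bound k (hyperInd G) (hyperInd_abs G) T (η / (3 * 4 ^ k) * (n : ℝ) ^ (2 * k)) ε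
      (by positivity) (by simpa using hn0)
      (by
        intro j hj
        refine hIH (insert j T) ?_ ?_
        · rw [Finset.card_insert_of_notMem hj]; omega
        · rw [Finset.card_insert_of_notMem hj]; omega)
      (hW _ hℓ (by omega)).le
    rw [Fintype.card_fin] at this
    refine this.trans ?_
    have h1 : ε ^ 2 ≤ η / (3 * 4 ^ k) := by
      have a0 : 0 < ε := by positivity
      have a1 : ε ≤ 1 := (min_le_right _ _).trans (min_le_left _ _)
      have a2 : ε ≤ η / (3 * 4 ^ k) := (min_le_right _ _).trans (min_le_right _ _)
      nlinarith
    have h2 : 4 ^ k * (n : ℝ) ^ (2 * k) * ε ^ 2 ≤ η / 3 * (n : ℝ) ^ (2 * k) := by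
      calc _ ≤ 4 ^ k * (n : ℝ) ^ (2 * k) * (η / (3 * 4 ^ k)) := by gcongr
        _ = _ := by field_simp
    have h3 : 2 * 4 ^ k * ((2 * k : ℝ) ^ 2 * (n : ℝ) ^ (2 * k) / n) ≤ η / 3 * (n : ℝ) ^ (2 * k) := by
      have : 2 * 4 ^ k * (2 * k : ℝ) ^ 2 / n ≤ η / 3 := by
        rw [div_le_iff₀ hη] at hnη
        rw [div_le_iff₀ hnR]; linarith
      calc _ = 2 * 4 ^ k * (2 * k : ℝ) ^ 2 / n * (n : ℝ) ^ (2 * k) := by ring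
        _ ≤ _ := by gcongr
    have h5 : 4 ^ k * (η / (3 * 4 ^ k) * (n : ℝ) ^ (2 * k)) = η / 3 * (n : ℝ) ^ (2 * k) := by
      field_simp
    linarith

/-- If all derivatives in directions of size `ℓ` vanish, the same holds for larger sets. -/
lemma DD_zero_mono {V : Type*} {k : ℕ} (F : (Fin k → V) → ℝ) (T T' : Finset (Fin k))
    (hTT : T ⊆ T')
    (h : ∀ x y : Fin k → V, Function.Injective (Sum.elim x y) → DD F T x y = 0) :
    ∀ x y : Fin k → V, Function.Injective (Sum.elim x y) → DD F T' x y = 0 := by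
  classical
  induction T' using Finset.strongInduction with
  | H T' ih =>
    intro x y hxy
    rcases hTT.eq_or_ssubset with rfl | hss
    · exact h x y hxy
    · obtain ⟨j, hj, hjT⟩ := Finset.exists_of_ssubset hss
      have hsub : T ⊆ T'.erase j := by
        intro i hi
        exact Finset.mem_erase.2 ⟨fun h => hjT (h ▸ hi), hTT hi⟩
      have ih' := ih (T'.erase j) (Finset.erase_ssubset hj) hsub
      rw [← Finset.insert_erase hj, DD_insert _ _ _ _ _ (Finset.notMem_erase _ _),
        ih' x y hxy,
        DD_congr F (T'.erase j) _ y (Function.update y j (x j)) (by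
          intro i hi
          have : i ≠ j := (Finset.mem_erase.1 hi).1
          simp [this]),
        ih', sub_zero]
      have : Sum.elim (Function.update x j (y j)) (Function.update y j (x j)) =
          Sum.elim x y ∘ (Equiv.swap (Sum.inl j) (Sum.inr j)) := by
        funext i
        rcases i with i | i
        · by_cases hi : i = j
          · subst hi; simp
          · simp only [Sum.elim_inl, Function.comp]
            rw [Equiv.swap_apply_of_ne_of_ne (by simpa using hi) (by simp)]
            simp [hi]
        · by_cases hi : i = j
          · subst hi; simp
          · simp only [Sum.elim_inr, Function.comp]
            rw [Equiv.swap_apply_of_ne_of_ne (by simp) (by simpa using hi)]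
            simp [hi]
      rw [this]
      exact hxy.comp (Equiv.injective _)

lemma Wpow_zero {V : Type*} [Fintype V] [DecidableEq V] {k : ℕ} (f : Finset V → ℝ) (r ℓ : ℕ)
    (hk : 2 * k ≤ Fintype.card V)
    (hℓr : ℓ ≤ r) (hrk : r ≤ k)
    (h : ∀ T : Finset (Fin k), T.card = ℓ →
      ∀ x y : Fin k → V, Function.Injective (Sum.elim x y) → DD (Fim k f) T x y = 0) :
    Wpow k r f = 0 := by
  have hs : ∀ a b : Fin r → V, Function.Injective (Sum.elim a b) → signedAvg k f a b = 0 := by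
    intro a b hab
    obtain ⟨m, hm⟩ : ∃ m, r + m = k := ⟨k - r, by omega⟩
    have key : ∀ C : Fin m → V, Function.Injective (Sum.elim (Sum.elim a b) C) →
        ∑ S : Finset (Fin r), (-1 : ℝ) ^ S.card * f (RR a b S C) = 0 := by
      intro C hC
      let e : Fin r ⊕ Fin m ≃ Fin k := finSumFinEquiv.trans (finCongr hm)
      have hcard : m ≤ ((univ.image (Sum.elim (Sum.elim a b) C))ᶜ).card := by
        rw [card_compl, card_image_of_injective _ hC]
        simp; omega
      obtain ⟨Z, hZ, hZm⟩ := Finset.exists_subset_card_eq hcard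
      let C' : Fin m → V := fun i => Z.equivFin.symm (i.cast hZm.symm)
      have hC'i : Function.Injective C' := by
        intro i j hij
        have := Z.equivFin.symm.injective (Subtype.val_injective hij)
        simpa using this
      have hC'm : ∀ i z, C' i ≠ Sum.elim (Sum.elim a b) C z := by
        intro i z hz
        have h1 : C' i ∈ Z := (Z.equivFin.symm (i.cast hZm.symm)).2
        have h2 := hZ h1
        rw [mem_compl] at h2
        exact h2 (hz ▸ mem_image_of_mem _ (mem_univ z))
      have hinj : Function.Injective
          (Sum.elim (Sum.elim a C ∘ e.symm) (Sum.elim b C' ∘ e.symm)) := by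
        have hbig : Function.Injective (Sum.elim (Sum.elim (Sum.elim a b) C) C') := by
          rw [Sum.elim_injective]
          exact ⟨hC, hC'i, fun z i h => hC'm i z h.symm⟩
        have : Sum.elim (Sum.elim a C ∘ e.symm) (Sum.elim b C' ∘ e.symm) =
            Sum.elim (Sum.elim (Sum.elim a b) C) C' ∘
            Sum.elim (Sum.elim (fun i => Sum.inl (Sum.inl (Sum.inl i)))
              (fun i => Sum.inl (Sum.inr i)) ∘ e.symm)
              (Sum.elim (fun i => Sum.inl (Sum.inl (Sum.inr i)))
              (fun i => Sum.inr i) ∘ e.symm) := by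
          funext j
          rcases j with j | j <;> obtain ⟨j, rfl⟩ := e.surjective j <;>
            rcases j with j | j <;> simp
        rw [this]
        refine hbig.comp ?_
        rintro (i | i) (j | j) hij <;> obtain ⟨i, rfl⟩ := e.surjective i <;>
          obtain ⟨j, rfl⟩ := e.surjective j <;> rcases i with i | i <;>
          rcases j with j | j <;> simpa using hij
      have hT : ℓ ≤ (TT e).card := by simpa [TT] using hℓr
      obtain ⟨T, hTs, hTc⟩ := Finset.exists_subset_card_eq hT
      have := DD_zero_mono (Fim k f) T (TT e) hTs (h T hTc) _ _ hinj
      rwa [DD_eq] at this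
    have h1 := sum_good hm f a b hab
    rw [Finset.sum_eq_zero (fun C hC => key C (mem_filter.1 hC).2)] at h1
    have h2 : (m.factorial : ℝ) ≠ 0 := by exact_mod_cast m.factorial_ne_zero
    have h3 := (mul_eq_zero.1 h1.symm).resolve_left h2
    rw [signedAvg, h3, zero_div]
  unfold Wpow
  rw [Finset.sum_eq_zero, zero_div, Real.sqrt_zero]
  intro p hp
  rw [hs p.1 p.2 (mem_filter.1 hp).2]; simp


lemma exists_tuple {n k : ℕ} (e : Finset (Fin n)) (he : e.card = k) :
    ∃ x : Fin k → Fin n, univ.image x = e := by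
  refine ⟨e.orderEmbOfFin he, ?_⟩
  apply Finset.coe_injective
  simp

lemma card_tuples {n k : ℕ} (H : Finset (Finset (Fin n))) (hH : ∀ e ∈ H, e.card = k) :
    (H.card : ℝ) ≤ ∑ x : Fin k → Fin n, if univ.image x ∈ H then (1 : ℝ) else 0 := by
  rw [Finset.sum_boole]
  norm_cast
  refine Finset.card_le_card_of_surjOn (fun x => univ.image x) ?_
  intro e he
  obtain ⟨x, hx⟩ := exists_tuple e (hH e he)
  refine ⟨x, ?_, hx⟩
  have he' : e ∈ H := he
  simp [hx, he']

lemma count_partite {n k s : ℕ} (hn : 0 < n) (hs : 0 < s) (δ : ℝ) (hδ : 0 ≤ δ)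
    (H : Finset (Finset (Fin n))) (hH : ∀ e ∈ H, e.card = k)
    (hc : δ * (n : ℝ) ^ k ≤ H.card) :
    δ ^ (s ^ k) * (n : ℝ) ^ (k * s) ≤
      (#{φ : Fin k → Fin s → Fin n | ∀ τ : Fin k → Fin s, univ.image (fun i => φ i (τ i)) ∈ H} : ℝ) := by
  have := erdos_count (V := Fin n) (by simpa using hn) s hs k
    (fun x => if univ.image x ∈ H then (1 : ℝ) else 0)
    (fun x => by split_ifs <;> norm_num) δ hδ
    (by rw [Fintype.card_fin]; exact hc.trans (card_tuples H hH))
  rw [Fintype.card_fin] at this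
  refine this.trans (le_of_eq ?_)
  rw [← Finset.sum_boole]
  refine Finset.sum_congr rfl fun φ _ => ?_
  rw [Finset.prod_boole]
  simp

open Classical in
lemma bad_card {I : Type*} [Fintype I] {n k : ℕ} (hn0 : 0 < n) (η : ℝ)
    (F : (Fin k → Fin n) → ℝ) (hF : ∀ x, F x = 0 ∨ F x = 1) (T : Finset (Fin k))
    (hS : ∑ p : (Fin k → Fin n) × (Fin k → Fin n), DD F T p.1 p.2 ^ 2 ≤ η * (n : ℝ) ^ (2 * k))
    (u : Fin k ⊕ Fin k → I) (hu : Function.Injective u) :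
    (#{Φ : I → Fin n | DD F T ((Φ ∘ u) ∘ Sum.inl) ((Φ ∘ u) ∘ Sum.inr) ≠ 0} : ℝ) ≤
      η * (n : ℝ) ^ (Fintype.card I) := by
  have hnR : (0 : ℝ) < n := by exact_mod_cast hn0
  have h1 := card_proj (V := Fin n) u hu
    (fun x => DD F T (x ∘ Sum.inl) (x ∘ Sum.inr) ≠ 0)
  rw [Fintype.card_fin, Fintype.card_sum, Fintype.card_fin, ← two_mul] at h1
  have h2 : (#{x : Fin k ⊕ Fin k → Fin n | DD F T (x ∘ Sum.inl) (x ∘ Sum.inr) ≠ 0} : ℝ) ≤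
      η * (n : ℝ) ^ (2 * k) := by
    refine le_trans ?_ hS
    rw [← Finset.sum_boole,
      ← Equiv.sum_comp (Equiv.sumArrowEquivProdArrow (Fin k) (Fin k) (Fin n))]
    refine Finset.sum_le_sum fun x _ => ?_
    show (if DD F T (x ∘ Sum.inl) (x ∘ Sum.inr) ≠ 0 then (1 : ℝ) else 0) ≤
      DD F T (x ∘ Sum.inl) (x ∘ Sum.inr) ^ 2
    split_ifs with h
    · obtain ⟨z, hz⟩ := DD_int F hF T (x ∘ Sum.inl) (x ∘ Sum.inr)
      rw [hz] at h ⊢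
      have hz0 : z ≠ 0 := by exact_mod_cast h
      have : 1 ≤ z ^ 2 := by
        have := sq_pos_of_ne_zero (a := z) hz0
        omega
      exact_mod_cast this
    · positivity
  have h3 := h1.trans (mul_le_mul_of_nonneg_right (le_trans (le_of_eq (by congr!)) h2)
    (by positivity : (0 : ℝ) ≤ (n : ℝ) ^ (Fintype.card I)))
  have hp : (0 : ℝ) < (n : ℝ) ^ (2 * k) := by positivity
  refine le_of_mul_le_mul_right (le_trans (le_of_eq ?_) (h3.trans (le_of_eq ?_))) hp
  · congr!
  · ring

open Classical in
lemma exists_avoid {I : Type*} [Fintype I] (k ℓ : ℕ) (c : ℝ) (hc0 : 0 < c) :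
    ∃ η : ℝ, 0 < η ∧ ∃ n₀ : ℕ, ∀ n : ℕ, n₀ ≤ n → 0 < n → ∀ A : Finset (I → Fin n),
      c * (n : ℝ) ^ (Fintype.card I) ≤ A.card →
      ∀ F : (Fin k → Fin n) → ℝ, (∀ x, F x = 0 ∨ F x = 1) →
      (∀ T : Finset (Fin k), T.card = ℓ → ∑ p : (Fin k → Fin n) × (Fin k → Fin n),
          DD F T p.1 p.2 ^ 2 ≤ η * (n : ℝ) ^ (2 * k)) →
      ∃ Φ ∈ A, Function.Injective Φ ∧
        ∀ T : Finset (Fin k), T.card = ℓ → ∀ u w : Fin k → I,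
          Function.Injective (Sum.elim u w) → DD F T (Φ ∘ u) (Φ ∘ w) = 0 := by
  obtain ⟨NN, hNN⟩ : ∃ x : ℝ, x = (2 : ℝ) ^ k * (Fintype.card (Fin k ⊕ Fin k → I) : ℝ) + 1 :=
    ⟨_, rfl⟩
  have hNN0 : 0 < NN := by rw [hNN]; positivity
  obtain ⟨Q, hQ⟩ : ∃ x : ℝ, x = (Fintype.card I : ℝ) ^ 2 := ⟨_, rfl⟩
  obtain ⟨η, hη⟩ : ∃ x : ℝ, x = c / (3 * NN) := ⟨_, rfl⟩
  have hη0 : 0 < η := by rw [hη]; positivity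
  refine ⟨η, hη0, ⌈3 * Q / c⌉₊ + 1, ?_⟩
  intro n hn hn0 A hA' F hF hS
  have hnR : (0 : ℝ) < n := by exact_mod_cast hn0
  have hnc : 3 * Q / c ≤ n := (Nat.le_ceil _).trans (Nat.cast_le.2 (by omega))
  obtain ⟨P, hP⟩ : ∃ x : ℝ, x = (n : ℝ) ^ (Fintype.card I) := ⟨_, rfl⟩
  have hP0 : 0 < P := by rw [hP]; positivity
  let B1 : Finset (I → Fin n) := {Φ : I → Fin n | ¬ Function.Injective Φ}
  let Bad : Finset (Fin k) → (Fin k ⊕ Fin k → I) → Finset (I → Fin n) := fun T u =>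
    {Φ : I → Fin n | DD F T ((Φ ∘ u) ∘ Sum.inl) ((Φ ∘ u) ∘ Sum.inr) ≠ 0}
  let B2 : Finset (I → Fin n) :=
    ((univ : Finset (Finset (Fin k))).filter (fun T => T.card = ℓ)).biUnion fun T =>
    ((univ : Finset (Fin k ⊕ Fin k → I)).filter Function.Injective).biUnion fun u => Bad T u
  have b1 : (B1.card : ℝ) ≤ c / 3 * P := by
    have h1 := card_noninj (V := Fin n) (I := I)
    rw [Fintype.card_fin, ← hQ, ← hP] at h1
    have h2 : Q ≤ c / 3 * n := by
      rw [div_le_iff₀ hc0] at hnc; linarith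
    have h3 : (B1.card : ℝ) * n ≤ Q * P := by
      refine le_trans (le_of_eq ?_) h1
      congr!
    have h4 : (B1.card : ℝ) * n ≤ (c / 3 * P) * n := by
      have := mul_le_mul_of_nonneg_right h2 hP0.le
      nlinarith
    exact le_of_mul_le_mul_right h4 hnR
  have bad1 : ∀ T : Finset (Fin k), T.card = ℓ → ∀ u : Fin k ⊕ Fin k → I, Function.Injective u →
      ((Bad T u).card : ℝ) ≤ η * P := by
    intro T hT u hu
    have := bad_card hn0 η F hF T (hS T hT) u hu
    rw [hP]
    refine le_trans (le_of_eq ?_) this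
    congr!
  have b2 : (B2.card : ℝ) ≤ c / 3 * P := by
    have h1 : (B2.card : ℝ) ≤ ∑ T ∈ (univ : Finset (Finset (Fin k))).filter (fun T => T.card = ℓ),
        ∑ u ∈ (univ : Finset (Fin k ⊕ Fin k → I)).filter Function.Injective,
          ((Bad T u).card : ℝ) := by
      have := (Finset.card_biUnion_le (s := (univ : Finset (Finset (Fin k))).filter
        (fun T => T.card = ℓ)) (t := fun T =>
        ((univ : Finset (Fin k ⊕ Fin k → I)).filter Function.Injective).biUnion
          fun u => Bad T u)).trans (Finset.sum_le_sum fun T _ => Finset.card_biUnion_le)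
      exact_mod_cast this
    have hηP : 0 ≤ η * P := by positivity
    have h2 := h1.trans (Finset.sum_le_sum fun T hT => Finset.sum_le_sum fun u hu =>
            bad1 T (mem_filter.1 hT).2 u (mem_filter.1 hu).2)
    have h3 : ∑ T ∈ (univ : Finset (Finset (Fin k))).filter (fun T => T.card = ℓ),
        ∑ u ∈ (univ : Finset (Fin k ⊕ Fin k → I)).filter Function.Injective, η * P ≤
        ∑ T : Finset (Fin k), ∑ u : Fin k ⊕ Fin k → I, η * P := by
      refine (Finset.sum_le_sum_of_subset_of_nonneg (Finset.filter_subset _ _)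
            (fun _ _ _ => Finset.sum_nonneg fun _ _ => hηP)).trans ?_
      refine Finset.sum_le_sum fun T _ => ?_
      exact Finset.sum_le_sum_of_subset_of_nonneg (Finset.filter_subset _ _)
            (fun _ _ _ => hηP)
    have h4 : ∑ T : Finset (Fin k), ∑ u : Fin k ⊕ Fin k → I, η * P = (NN - 1) * (η * P) := by
      rw [hNN]
      simp only [Finset.sum_const, nsmul_eq_mul, Finset.card_univ, Fintype.card_finset,
            Fintype.card_fin, Nat.cast_pow, Nat.cast_ofNat]
      ring
    have h5 : NN * (η * P) = c / 3 * P := by rw [hη]; field_simp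
    linarith
  by_contra hcon
  have hsub : A ⊆ B1 ∪ B2 := by
    intro Φ hΦ
    by_contra hnot
    rw [mem_union, not_or] at hnot
    refine hcon ⟨Φ, hΦ, ?_, ?_⟩
    · by_contra h
      exact hnot.1 (mem_filter.2 ⟨mem_univ _, h⟩)
    · intro T hT u w huw
      by_contra h
      refine hnot.2 ?_
      refine mem_biUnion.2 ⟨T, by simp [hT], ?_⟩
      refine mem_biUnion.2 ⟨Sum.elim u w, mem_filter.2 ⟨mem_univ _, huw⟩, ?_⟩
      exact mem_filter.2 ⟨mem_univ _, h⟩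
  have h1 : (A.card : ℝ) ≤ B1.card + B2.card := by
    exact_mod_cast (Finset.card_le_card hsub).trans (Finset.card_union_le _ _)
  have h2 : 0 < c * P := by positivity
  rw [← hP] at hA'
  linarith

lemma find_good (k s ℓ : ℕ) (hs : 0 < s) (δ : ℝ) (hδ : 0 < δ) :
    ∃ η : ℝ, 0 < η ∧ ∃ n₀ : ℕ, ∀ n : ℕ, n₀ ≤ n → ∀ G : Finset (Finset (Fin n)),
      (∀ e ∈ G, e.card = k) →
      δ * (n : ℝ) ^ k ≤ min (G.card : ℝ) ((n.choose k : ℝ) - G.card) →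
      (∀ T : Finset (Fin k), T.card = ℓ → ∑ p : (Fin k → Fin n) × (Fin k → Fin n),
          DD (Fim k (hyperInd G)) T p.1 p.2 ^ 2 ≤ η * (n : ℝ) ^ (2 * k)) →
      ∃ Φ : (Fin k ⊕ Fin k) × Fin s → Fin n, Function.Injective Φ ∧
        (∀ τ : Fin k → Fin s, univ.image (fun i => Φ (Sum.inl i, τ i)) ∈ G) ∧
        (∀ τ : Fin k → Fin s, univ.image (fun i => Φ (Sum.inr i, τ i)) ∉ G) ∧
        ∀ T : Finset (Fin k), T.card = ℓ → ∀ u w : Fin k → (Fin k ⊕ Fin k) × Fin s,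
          Function.Injective (Sum.elim u w) →
            DD (Fim k (hyperInd G)) T (Φ ∘ u) (Φ ∘ w) = 0 := by
  classical
  set I := (Fin k ⊕ Fin k) × Fin s with hI
  set c : ℝ := δ ^ (s ^ k) * δ ^ (s ^ k) with hc
  have hc0 : 0 < c := by positivity
  obtain ⟨η, hη0, n₀, hav⟩ := exists_avoid (I := I) k ℓ c hc0
  refine ⟨η, hη0, n₀ + 1, ?_⟩
  intro n hn G hG hGδ hS
  have hn0 : 0 < n := by omega
  set Gc : Finset (Finset (Fin n)) := univ.powersetCard k \ G with hGc
  have hGcc : (Gc.card : ℝ) = (n.choose k : ℝ) - G.card := by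
    have hsub : G ⊆ univ.powersetCard k := fun e he => by
      rw [mem_powersetCard]; exact ⟨subset_univ _, hG e he⟩
    rw [hGc, Finset.card_sdiff_of_subset hsub, Nat.cast_sub (Finset.card_le_card hsub)]
    simp
  have c1 := count_partite hn0 hs δ hδ.le G hG (hGδ.trans (min_le_left _ _))
  have c2 := count_partite (k := k) hn0 hs δ hδ.le Gc
    (fun e he => (mem_powersetCard.1 (mem_sdiff.1 he).1).2)
    (by rw [hGcc]; exact hGδ.trans (min_le_right _ _))
  set A1 := ({φ : Fin k → Fin s → Fin n | ∀ τ : Fin k → Fin s,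
    univ.image (fun i => φ i (τ i)) ∈ G} : Finset _) with hA1
  set A2 := ({φ : Fin k → Fin s → Fin n | ∀ τ : Fin k → Fin s,
    univ.image (fun i => φ i (τ i)) ∈ Gc} : Finset _) with hA2
  set A := ({Φ : I → Fin n | (∀ τ : Fin k → Fin s, univ.image (fun i => Φ (Sum.inl i, τ i)) ∈ G) ∧
        (∀ τ : Fin k → Fin s, univ.image (fun i => Φ (Sum.inr i, τ i)) ∈ Gc)} : Finset _) with hA
  have hAc : A1.card * A2.card ≤ A.card := by
    rw [← Finset.card_product]
    refine Finset.card_le_card_of_injOn (fun z => fun q : I => Sum.elim z.1 z.2 q.1 q.2) ?_ ?_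
    · rintro ⟨φ, ψ⟩ hz
      simp only [coe_product, Set.mem_prod, mem_coe, hA1, hA2, mem_filter, mem_univ, true_and] at hz
      simp only [hA, coe_filter, mem_univ, true_and, Set.mem_ofPred_eq]
      exact ⟨fun τ => hz.1 τ, fun τ => hz.2 τ⟩
    · rintro ⟨φ, ψ⟩ - ⟨φ', ψ'⟩ - h
      refine Prod.ext (funext fun i => funext fun j => ?_) (funext fun i => funext fun j => ?_)
      · exact congrFun h (Sum.inl i, j)
      · exact congrFun h (Sum.inr i, j)
  have hcardI : Fintype.card I = k * s + k * s := by
    simp [hI]; ring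
  have hA' : c * (n : ℝ) ^ (Fintype.card I) ≤ A.card := by
    calc c * (n : ℝ) ^ (Fintype.card I) =
        (δ ^ (s ^ k) * (n : ℝ) ^ (k * s)) * (δ ^ (s ^ k) * (n : ℝ) ^ (k * s)) := by
          rw [hcardI, pow_add, hc]; ring
      _ ≤ (A1.card : ℝ) * A2.card := by gcongr
      _ ≤ _ := by exact_mod_cast hAc
  obtain ⟨Φ, hΦ, hinj, hz⟩ := hav n (by omega) hn0 A hA' (Fim k (hyperInd G))
    (fun x => hyperInd_cases G _) hS
  rw [hA, mem_filter] at hΦ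
  exact ⟨Φ, hinj, hΦ.2.1, fun τ => (mem_sdiff.1 (hΦ.2.2 τ)).2, hz⟩


lemma mono_counts {k : ℕ} (z y : Fin k → Fin k) (hz : Monotone z) (hy : Monotone y)
    (h : ∀ i, #{q | z q = i} = #{q | y q = i}) : z = y := by
  have h1 : ∀ i, Nonempty ({q // z q = i} ≃ {q // y q = i}) := fun i => by
    refine ⟨Fintype.equivOfCardEq ?_⟩
    rw [Fintype.card_subtype, Fintype.card_subtype]
    exact h i
  let E : ∀ i, {q // z q = i} ≃ {q // y q = i} := fun i => (h1 i).some
  let σ : Equiv.Perm (Fin k) := (Equiv.sigmaFiberEquiv z).symm.trans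
    ((Equiv.sigmaCongrRight E).trans (Equiv.sigmaFiberEquiv y))
  have hσ : z = y ∘ σ := by
    funext q
    exact (E (z q) ⟨q, rfl⟩).2.symm
  have h2 := Tuple.unique_monotone (f := y) (σ := σ) (τ := 1)
    (by rw [← hσ]; exact hz) (by simpa using hy)
  rw [hσ, h2]; rfl

lemma realize {k : ℕ} (m : Fin k → Fin k) (hm : Monotone m) :
    ∃ S : Finset (Fin (k * k)), ∃ hS : S.card = k, ∀ q, (S.orderEmbOfFin hS q).divNat = m q := by
  have hst : StrictMono (fun i : Fin k => finProdFinEquiv (m i, i)) := by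
    intro i j hij
    have h1 := hm hij.le
    rw [Fin.lt_def] at hij ⊢
    rw [Fin.le_def] at h1
    have := Nat.mul_le_mul_left k h1
    simp only [finProdFinEquiv_apply_val]
    omega
  have hcard : (univ.image (fun i : Fin k => finProdFinEquiv (m i, i))).card = k := by
    rw [Finset.card_image_of_injective _ hst.injective]; simp
  refine ⟨_, hcard, ?_⟩
  have := Finset.orderEmbOfFin_unique hcard (f := fun i : Fin k => finProdFinEquiv (m i, i))
    (fun i => mem_image_of_mem _ (mem_univ _)) hst
  intro q
  rw [← this]
  have h2 := finProdFinEquiv.symm_apply_apply (m q, q)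
  exact congrArg Prod.fst h2

lemma parts_card {k : ℕ} (i : Fin k) : #{q : Fin (k * k) | q.divNat = i} = k := by
  have : ({q : Fin (k * k) | q.divNat = i} : Finset _) =
      univ.image (fun j : Fin k => finProdFinEquiv (i, j)) := by
    ext q
    simp only [mem_filter, mem_univ, true_and, mem_image]
    constructor
    · intro h
      refine ⟨q.modNat, ?_⟩
      rw [← h]
      exact finProdFinEquiv.apply_symm_apply q
    · rintro ⟨j, rfl⟩
      exact congrArg Prod.fst (finProdFinEquiv.symm_apply_apply (i, j))
  rw [this, Finset.card_image_of_injective]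
  · simp
  · intro a b hab
    simpa using hab

lemma inter_count {k : ℕ} (S : Finset (Fin (k * k))) (hS : S.card = k) (i : Fin k) :
    (S ∩ ({q : Fin (k * k) | q.divNat = i} : Finset _)).card =
      #{q : Fin k | (S.orderEmbOfFin hS q).divNat = i} := by
  rw [← Finset.card_map (S.orderEmbOfFin hS).toEmbedding]
  congr 1
  ext q
  have hr := Finset.range_orderEmbOfFin S hS
  simp only [mem_inter, mem_filter, mem_univ, true_and, mem_map]
  constructor
  · rintro ⟨h1, h2⟩
    have : q ∈ Set.range (S.orderEmbOfFin hS) := by rw [hr]; exact h1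
    obtain ⟨a, rfl⟩ := this
    exact ⟨a, h2, rfl⟩
  · rintro ⟨a, h, rfl⟩
    exact ⟨Finset.orderEmbOfFin_mem S hS a, h⟩

lemma pattern_exists {k n s : ℕ} (hk : 2 ≤ k) (G : Finset (Finset (Fin n)))
    (Φ : (Fin k ⊕ Fin k) × Fin s → Fin n) (ι : Fin (k * k) → Fin s)
    (cs : (Fin k → Fin k ⊕ Fin k) → Prop)
    (hc : ∀ (z : Fin k ↪o Fin (k * k)) (τ : Fin k → Fin k ⊕ Fin k),
      univ.image (fun q => Φ (τ q, ι (z q))) ∈ G ↔ cs τ)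
    (hl : cs Sum.inl) (hr : ¬ cs Sum.inr) :
    ∃ κ : Fin k → Fin k ⊕ Fin k, ∃ F : Finset (Finset (Fin (k * k))),
      (∀ S, S ∈ F ↔ S.card = k ∧ S.image (fun q => Φ (κ q.divNat, ι q)) ∈ G) ∧
      (∀ S T : Finset (Fin (k * k)), S.card = k → T.card = k →
        (∀ i : Fin k, (S ∩ ({q : Fin (k * k) | q.divNat = i} : Finset _)).card =
          (T ∩ ({q : Fin (k * k) | q.divNat = i} : Finset _)).card) → (S ∈ F ↔ T ∈ F)) ∧
      (∃ S : Finset (Fin (k * k)), S.card = k ∧ S ∈ F) ∧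
      (∃ T : Finset (Fin (k * k)), T.card = k ∧ T ∉ F) := by
  classical
  have key : ∀ (κ : Fin k → Fin k ⊕ Fin k) (S : Finset (Fin (k * k))) (hS : S.card = k),
      S.image (fun q => Φ (κ q.divNat, ι q)) ∈ G ↔
        cs (fun q => κ (S.orderEmbOfFin hS q).divNat) := by
    intro κ S hS
    rw [← hc (S.orderEmbOfFin hS)]
    have : S.image (fun q => Φ (κ q.divNat, ι q)) = univ.image (fun q : Fin k =>
        Φ (κ (S.orderEmbOfFin hS q).divNat, ι (S.orderEmbOfFin hS q))) := by
      have hr := Finset.image_orderEmbOfFin_univ S hS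
      conv_lhs => rw [← hr]
      rw [Finset.image_image]
      rfl
    rw [this]
  -- it suffices to find two monotone maps
  have suff : ∀ (κ : Fin k → Fin k ⊕ Fin k) (m m' : Fin k → Fin k), Monotone m → Monotone m' →
      cs (κ ∘ m) → ¬ cs (κ ∘ m') → ∃ κ : Fin k → Fin k ⊕ Fin k,
      ∃ F : Finset (Finset (Fin (k * k))),
      (∀ S, S ∈ F ↔ S.card = k ∧ S.image (fun q => Φ (κ q.divNat, ι q)) ∈ G) ∧
      (∀ S T : Finset (Fin (k * k)), S.card = k → T.card = k →
        (∀ i : Fin k, (S ∩ ({q : Fin (k * k) | q.divNat = i} : Finset _)).card =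
          (T ∩ ({q : Fin (k * k) | q.divNat = i} : Finset _)).card) → (S ∈ F ↔ T ∈ F)) ∧
      (∃ S : Finset (Fin (k * k)), S.card = k ∧ S ∈ F) ∧
      (∃ T : Finset (Fin (k * k)), T.card = k ∧ T ∉ F) := by
    intro κ m m' hm hm' h1 h2
    refine ⟨κ, univ.filter (fun S => S.card = k ∧ S.image (fun q => Φ (κ q.divNat, ι q)) ∈ G),
      fun S => by simp, ?_, ?_, ?_⟩
    · intro S T hS hT h
      simp only [mem_filter, mem_univ, true_and, hS, hT]
      rw [key κ S hS, key κ T hT]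
      have hmono : ∀ (S : Finset (Fin (k * k))) (hS : S.card = k),
          Monotone (fun q => (S.orderEmbOfFin hS q).divNat) := by
        intro S hS a b hab
        have := (S.orderEmbOfFin hS).monotone hab
        rw [Fin.le_def] at this ⊢
        exact Nat.div_le_div_right this
      have := mono_counts _ _ (hmono S hS) (hmono T hT) (fun i => by
        rw [← inter_count, ← inter_count]; exact h i)
      have h3 : (fun q => κ (S.orderEmbOfFin hS q).divNat) =
          (fun q => κ (T.orderEmbOfFin hT q).divNat) :=
        congrArg (fun f : Fin k → Fin k => κ ∘ f) this
      rw [h3]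
    · obtain ⟨S, hS, h⟩ := realize m hm
      refine ⟨S, hS, ?_⟩
      simp only [mem_filter, mem_univ, true_and, hS]
      rw [key κ S hS]
      simpa only [h, Function.comp_def] using h1
    · obtain ⟨S, hS, h⟩ := realize m' hm'
      refine ⟨S, hS, ?_⟩
      simp only [mem_filter, mem_univ, true_and, hS]
      rw [key κ S hS]
      simpa only [h, Function.comp_def] using h2
  let o : Fin k := ⟨0, by omega⟩
  let e : Fin k := ⟨1, by omega⟩
  have hoe : e ≠ o := by simp [o, e]
  by_cases hA : cs (fun _ => Sum.inl o)
  · by_cases hB : cs (fun _ => Sum.inr o)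
    · exact suff Sum.inr (fun _ => o) id monotone_const monotone_id hB hr
    · refine suff (fun i => if i = o then Sum.inl o else Sum.inr o) (fun _ => o) (fun _ => e)
        monotone_const monotone_const ?_ ?_
      · have : ((fun i => if i = o then Sum.inl o else Sum.inr o) ∘ fun _ : Fin k => o) =
          (fun _ => (Sum.inl o : Fin k ⊕ Fin k)) := by funext; simp
        rw [this]; exact hA
      · have : ((fun i => if i = o then Sum.inl o else Sum.inr o) ∘ fun _ : Fin k => e) =
          (fun _ => (Sum.inr o : Fin k ⊕ Fin k)) := by funext; simp [hoe]
        rw [this]; exact hB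
  · exact suff Sum.inl id (fun _ => o) monotone_id monotone_const hl hA

lemma DD_pull {V W : Type*} [DecidableEq V] [DecidableEq W] {k : ℕ} (f : Finset V → ℝ)
    (g : Finset W → ℝ) (Ψ : V → W) (hf : ∀ S : Finset V, S.card = k → f S = g (S.image Ψ))
    (T : Finset (Fin k)) (x y : Fin k → V) (hxy : Function.Injective (Sum.elim x y)) :
    DD (Fim k f) T x y = DD (Fim k g) T (Ψ ∘ x) (Ψ ∘ y) := by
  unfold DD
  refine Finset.sum_congr rfl fun S _ => ?_
  congr 1
  unfold Fim
  have hinj : Function.Injective (S.piecewise y x) := by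
    have : S.piecewise y x = Sum.elim x y ∘
        (fun i => if i ∈ S then Sum.inr i else Sum.inl i) := by
      funext i
      by_cases hi : i ∈ S <;> simp [hi]
    rw [this]
    refine hxy.comp ?_
    intro i j hij
    by_cases hi : i ∈ S <;> by_cases hj : j ∈ S <;> simp [hi, hj] at hij <;> exact hij
  rw [hf _ (by rw [Finset.card_image_of_injective _ hinj]; simp), Finset.image_image]
  congr 2
  funext i
  by_cases hi : i ∈ S <;> simp [hi]

theorem stmt17 (k ℓ : ℕ) (hℓ : 1 ≤ ℓ) (hlk : ℓ ≤ k) (hk : 2 ≤ k)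
    (δ : ℝ) (hδ : 0 < δ) :
    ∃ ε : ℝ, 0 < ε ∧ ∃ n₀ : ℕ, ∀ n : ℕ, n₀ ≤ n →
      (∀ F : Finset (Finset (Fin (k * k))),
        ∀ parts : Fin k → Finset (Fin (k * k)),
          (∀ e ∈ F, e.card = k) →
          (∀ i, (parts i).card = k) →
          (∀ i j, i ≠ j → Disjoint (parts i) (parts j)) →
          (∀ S T : Finset (Fin (k * k)), S.card = k → T.card = k →
            (∀ i, (S ∩ parts i).card = (T ∩ parts i).card) → (S ∈ F ↔ T ∈ F)) →
          (∃ S : Finset (Fin (k * k)), S.card = k ∧ S ∈ F) →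
          (∃ T : Finset (Fin (k * k)), T.card = k ∧ T ∉ F) →
          ∃ r : ℕ, ℓ ≤ r ∧ r ≤ k ∧ 0 < Wpow k r (hyperInd F)) →
      ∀ G : Finset (Finset (Fin n)), (∀ e ∈ G, e.card = k) →
        δ * (n : ℝ) ^ k ≤ min (G.card : ℝ) ((n.choose k : ℝ) - G.card) →
        ∃ r : ℕ, ℓ ≤ r ∧ r ≤ k ∧ ε ≤ Wpow k r (hyperInd G) := by
  classical
  obtain ⟨N, hN⟩ := ramsey ((Fin k → Fin k ⊕ Fin k) → Bool) k (k * k)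
  obtain ⟨η, hη, n₀, hgood⟩ := find_good k (N + 1) ℓ (Nat.succ_pos _) δ hδ
  obtain ⟨ε, hε, n₁, hA⟩ := partA k ℓ (k - ℓ) η hη
  refine ⟨ε, hε, max n₀ n₁, ?_⟩
  intro n hn hpat G hG hGδ
  by_contra hcon
  push Not at hcon
  obtain ⟨Φ, hΦ, hΦl, hΦr, hΦz⟩ := hgood n (le_trans (le_max_left _ _) hn) G hG hGδ
    (fun T hT => hA n (le_trans (le_max_right _ _) hn) G hcon T (by omega) (by omega))
  let col : Finset (Fin (N + 1)) → (Fin k → Fin k ⊕ Fin k) → Bool := fun J τ =>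
    if hJ : J.card = k then
      decide (univ.image (fun q => Φ (τ q, J.orderEmbOfFin hJ q)) ∈ G) else false
  obtain ⟨H, -, hH, c, hcol⟩ := hN (Fin (N + 1)) univ (by simp) col
  let ι := H.orderEmbOfFin hH
  have hc : ∀ (z : Fin k ↪o Fin (k * k)) (τ : Fin k → Fin k ⊕ Fin k),
      univ.image (fun q => Φ (τ q, ι (z q))) ∈ G ↔ c τ = true := by
    intro z τ
    have hinj : Function.Injective (fun q => ι (z q)) := ι.injective.comp z.injective
    have hJ : (univ.image (fun q => ι (z q))).card = k := by
      rw [Finset.card_image_of_injective _ hinj]; simp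
    have h1 := hcol (univ.image (fun q => ι (z q))) (by
      intro a ha
      obtain ⟨q, -, rfl⟩ := mem_image.1 ha
      exact Finset.orderEmbOfFin_mem H hH _) hJ
    have h2 := Finset.orderEmbOfFin_unique hJ (f := fun q => ι (z q))
      (fun i => mem_image_of_mem _ (mem_univ _)) (ι.strictMono.comp z.strictMono)
    rw [← h1]
    simp only [col, hJ, dif_pos, decide_eq_true_eq]
    rw [← h2]
  have hkk : k ≤ k * k := Nat.le_mul_of_pos_left k (by omega)
  have hl : c Sum.inl = true := (hc (Fin.castLEOrderEmb hkk) _).1 (hΦl _)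
  have hr : ¬ c Sum.inr = true := fun h => hΦr _ ((hc (Fin.castLEOrderEmb hkk) _).2 h)
  obtain ⟨κ, F, hF, hF1, hF2, hF3⟩ := pattern_exists hk G Φ ι (fun τ => c τ = true) hc hl hr
  obtain ⟨r, hr1, hr2, hr3⟩ := hpat F (fun i => univ.filter fun q => q.divNat = i)
    (fun e he => ((hF e).1 he).1) parts_card
    (fun i j hij => Finset.disjoint_left.2 fun q h1 h2 =>
      hij ((mem_filter.1 h1).2.symm.trans (mem_filter.1 h2).2)) hF1 hF2 hF3
  refine hr3.ne' (Wpow_zero (hyperInd F) r ℓ ?_ hr1 hr2 ?_)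
  · rw [Fintype.card_fin]; exact Nat.mul_le_mul_right k hk
  · intro T hT x y hxy
    rw [DD_pull (hyperInd F) (hyperInd G) (fun q => Φ (κ q.divNat, ι q)) ?_ T x y hxy]
    · refine hΦz T hT (fun i => (κ (x i).divNat, ι (x i))) (fun i => (κ (y i).divNat, ι (y i))) ?_
      have : Sum.elim (fun i => (κ (x i).divNat, ι (x i))) (fun i => (κ (y i).divNat, ι (y i))) =
          (fun q => (κ q.divNat, ι q)) ∘ Sum.elim x y := by
        funext i; cases i <;> rfl
      rw [this]
      refine Function.Injective.comp ?_ hxy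
      intro a b hab
      exact ι.injective (Prod.ext_iff.1 hab).2
    · intro S hS
      unfold hyperInd
      simp [hF, hS]
end
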